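/- Let d ≥ 1 and let (q,r) and (q̃,r̃) be admissible pairs. There is a constant C = C(d,q,r,q̃,r̃) > 0 such that for every interval I ⊆ [0,∞) containing 0 and every F ∈ 𝒮(ℝ × ℝ^d), the inhomogeneous Strichartz estimate ‖ ∫₀ᵗ e^{i(t-s)Δ} F(s,·) ds ‖_{L^q_I L^r} ≤ C ‖F‖_{L^{q̃'}_I L^{r̃'}} holds, where q̃' and r̃' are the conjugate exponents of q̃ and r̃. -/

import Mathlib

open MeasureTheory Complex Filter
open scoped ENNReal RealInnerProductSpace

noncomputable section

/-- `d`-dimensional Euclidean space. -/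
abbrev Ed (d : ℕ) := EuclideanSpace ℝ (Fin d)

/-- Fourier transform: `f̂(ξ) = ∫ e^{-i x·ξ} f(x) dx`. -/
def FT (d : ℕ) (f : Ed d → ℂ) (ξ : Ed d) : ℂ :=
  ∫ x, Complex.exp (-Complex.I * (⟪x, ξ⟫ : ℝ)) * f x

/-- Inverse Fourier transform: `(F⁻¹ g)(x) = (2π)^{-d} ∫ e^{i x·ξ} g(ξ) dξ`. -/
def FTinv (d : ℕ) (g : Ed d → ℂ) (x : Ed d) : ℂ :=
  (((2 * Real.pi) ^ d : ℝ) : ℂ)⁻¹ * ∫ ξ, Complex.exp (Complex.I * (⟪x, ξ⟫ : ℝ)) * g ξ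

/-- Schrödinger propagator `e^{itΔ} f = F⁻¹(e^{-it|ξ|²} f̂(ξ))`. -/
def schrod (d : ℕ) (t : ℝ) (f : Ed d → ℂ) : Ed d → ℂ :=
  FTinv d fun ξ => Complex.exp (-Complex.I * t * (‖ξ‖ ^ 2 : ℝ)) * FT d f ξ

/-- An admissible (Schrödinger) pair: `2 ≤ q,r ≤ ∞`, `2/q + d/r = d/2`, `(q,r,d) ≠ (2,∞,2)`. -/
def Admissible (d : ℕ) (q r : ℝ≥0∞) : Prop :=
  2 ≤ q ∧ 2 ≤ r ∧ 2 / q + d / r = d / 2 ∧ ¬(q = 2 ∧ r = ∞ ∧ d = 2)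

/-- Mixed space-time norm `‖u‖_{L^q_I X} = (∫_I (g t)^q dt)^{1/q}` where `g t = ‖u(t,·)‖_X`,
with the essential supremum modification when `q = ∞`. -/
def mixedNorm (q : ℝ≥0∞) (I : Set ℝ) (g : ℝ → ℝ≥0∞) : ℝ≥0∞ :=
  if q = ∞ then essSup g (volume.restrict I)
  else (∫⁻ t in I, g t ^ q.toReal) ^ (1 / q.toReal)

/-! ### Integral inequalities for nonnegative functions -/

theorem lintegral_mul_le_L2_mul_L2 {α : Type*} [MeasurableSpace α] (μ : Measure α)
    {f g : α → ℝ≥0∞} (hf : AEMeasurable f μ) (hg : AEMeasurable g μ) :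
    ∫⁻ a, f a * g a ∂μ ≤
      (∫⁻ a, f a ^ 2 ∂μ) ^ (1 / 2 : ℝ) * (∫⁻ a, g a ^ 2 ∂μ) ^ (1 / 2 : ℝ) := by
  simpa [ENNReal.rpow_two] using
    ENNReal.lintegral_mul_le_Lp_mul_Lq μ Real.HolderConjugate.two_two hf hg

/-- Schur's test for a convolution kernel. -/
theorem lintegral_conv_le {G : Type*} [AddCommGroup G] [MeasurableSpace G] [MeasurableAdd₂ G]
    [MeasurableSub₂ G] (μ : Measure G) [SFinite μ] [μ.IsAddRightInvariant]
    {K a b : G → ℝ≥0∞} (hK : Measurable K) (ha : Measurable a) (hb : Measurable b) :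
    ∫⁻ t, ∫⁻ s, K (t - s) * (a s * b t) ∂μ ∂μ ≤
      (∫⁻ t, K t ∂μ) *
        ((∫⁻ t, a t ^ 2 ∂μ) ^ (1 / 2 : ℝ) * (∫⁻ t, b t ^ 2 ∂μ) ^ (1 / 2 : ℝ)) := by
  calc ∫⁻ t, ∫⁻ s, K (t - s) * (a s * b t) ∂μ ∂μ
      = ∫⁻ s, ∫⁻ t, K (t - s) * (a s * b t) ∂μ ∂μ :=
        lintegral_lintegral_swap (by fun_prop)
    _ = ∫⁻ s, ∫⁻ t, K t * (a s * b (t + s)) ∂μ ∂μ := by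
        refine lintegral_congr fun s => ?_
        rw [← lintegral_add_right_eq_self _ s]
        simp
    _ = ∫⁻ t, ∫⁻ s, K t * (a s * b (t + s)) ∂μ ∂μ :=
        lintegral_lintegral_swap (by fun_prop)
    _ = ∫⁻ t, K t * ∫⁻ s, a s * b (s + t) ∂μ ∂μ := by
        refine lintegral_congr fun t => ?_
        rw [lintegral_const_mul _ (by fun_prop)]
        simp_rw [add_comm t]
    _ ≤ ∫⁻ t, K t * ((∫⁻ t, a t ^ 2 ∂μ) ^ (1 / 2 : ℝ) * (∫⁻ t, b t ^ 2 ∂μ) ^ (1 / 2 : ℝ)) ∂μ := by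
        refine lintegral_mono fun t => ?_
        dsimp only
        gcongr
        refine (lintegral_mul_le_L2_mul_L2 μ (by fun_prop) (by fun_prop)).trans_eq ?_
        rw [lintegral_add_right_eq_self (fun s => b s ^ 2) t]
    _ = _ := lintegral_mul_const _ hK

theorem tsum_conv_le {K a b : ℤ → ℝ≥0∞} :
    ∑' k, ∑' l, K (k - l) * (a k * b l) ≤
      (∑' n, K n) * ((∑' n, a n ^ 2) ^ (1 / 2 : ℝ) * (∑' n, b n ^ 2) ^ (1 / 2 : ℝ)) := by
  have h := lintegral_conv_le (Measure.count : Measure ℤ) (K := K) (a := b) (b := a)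
    (by fun_prop) (by fun_prop) (by fun_prop)
  simp only [lintegral_count] at h
  simpa [mul_comm] using h

theorem tsum_conv_add_le {K a b : ℤ → ℝ≥0∞} :
    ∑' k, ∑' l, K (k + l) * (a k * b l) ≤
      (∑' n, K n) * ((∑' n, a n ^ 2) ^ (1 / 2 : ℝ) * (∑' n, b n ^ 2) ^ (1 / 2 : ℝ)) := by
  have h := tsum_conv_le (K := K) (a := a) (b := fun l => b (-l))
  have hb := (Equiv.neg ℤ).tsum_eq (fun n => b n ^ 2)
  simp only [Equiv.neg_apply] at hb
  rw [hb] at h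
  refine le_of_eq_of_le (tsum_congr fun k => ?_) h
  rw [← (Equiv.neg ℤ).tsum_eq]
  simp [sub_eq_add_neg]

theorem tsum_two_rpow_neg_abs_ne_top {γ : ℝ} (hγ : 0 < γ) :
    ∑' n : ℤ, (2 : ℝ≥0∞) ^ (-(γ * |(n : ℝ)|)) ≠ ∞ := by
  have hnat : ∑' n : ℕ, (2 : ℝ≥0∞) ^ (-(γ * (n : ℝ))) ≠ ∞ := by
    have : ∀ n : ℕ, (2 : ℝ≥0∞) ^ (-(γ * (n : ℝ))) = ((2 : ℝ≥0∞) ^ (-γ)) ^ n := fun n => by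
      rw [← ENNReal.rpow_natCast, ← ENNReal.rpow_mul]; ring_nf
    simp_rw [this, ENNReal.tsum_geometric]
    refine ENNReal.inv_ne_top.2 (tsub_pos_of_lt ?_).ne'
    exact ENNReal.rpow_lt_one_of_one_lt_of_neg (by norm_num) (by linarith)
  refine ne_top_of_le_ne_top (ENNReal.add_ne_top.2 ⟨hnat, hnat⟩) ?_
  rw [← (Equiv.intEquivNatSumNat.symm).tsum_eq, ENNReal.summable.tsum_sum ENNReal.summable]
  refine add_le_add ?_ ?_
  · refine ENNReal.tsum_le_tsum fun n => ?_
    simp [Equiv.intEquivNatSumNat]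
  · refine ENNReal.tsum_le_tsum fun n => ?_
    have : ((Equiv.intEquivNatSumNat.symm (Sum.inr n) : ℤ) : ℝ) = -((n : ℝ) + 1) := by
      simp [Equiv.intEquivNatSumNat, Int.negSucc_eq]
    rw [this, abs_neg, abs_of_nonneg (by positivity)]
    refine ENNReal.rpow_le_rpow_of_exponent_le (by norm_num) ?_
    nlinarith

theorem two_rpow_mul (x y : ℝ) : (2 : ℝ≥0∞) ^ x * 2 ^ y = 2 ^ (x + y) :=
  (ENNReal.rpow_add _ _ (by norm_num) (by norm_num)).symm

/-- Summing the minimum of a growing and a decaying geometric progression. -/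
theorem exists_tsum_min_le {α β : ℝ} (hα : 0 < α) (hβ : 0 < β) :
    ∃ C : ℝ≥0∞, C ≠ ∞ ∧ ∀ x : ℝ,
      ∑' n : ℤ, min ((2 : ℝ≥0∞) ^ (α * n)) (2 ^ ((α + β) * x) * 2 ^ (-(β * n))) ≤
        C * 2 ^ (α * x) := by
  set γ := min α β with hγ
  have hγ0 : 0 < γ := lt_min hα hβ
  refine ⟨2 ^ γ * ∑' n : ℤ, (2 : ℝ≥0∞) ^ (-(γ * |(n : ℝ)|)),
    ENNReal.mul_ne_top (ENNReal.rpow_ne_top_of_nonneg hγ0.le (by norm_num))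
      (tsum_two_rpow_neg_abs_ne_top hγ0), fun x => ?_⟩
  have key : ∀ n : ℤ,
      min ((2 : ℝ≥0∞) ^ (α * n)) (2 ^ ((α + β) * x) * 2 ^ (-(β * n))) ≤
        2 ^ γ * 2 ^ (-(γ * |((n - ⌊x⌋ : ℤ) : ℝ)|)) * 2 ^ (α * x) := by
    intro n
    have h1 := Int.floor_le x
    have h2 := Int.lt_floor_add_one x
    rw [two_rpow_mul, two_rpow_mul, two_rpow_mul]
    have ha : γ ≤ α := min_le_left _ _
    have hb : γ ≤ β := min_le_right _ _
    push_cast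
    rcases le_or_gt n ⌊x⌋ with h | h
    · have h' : (n : ℝ) ≤ ⌊x⌋ := by exact_mod_cast h
      refine (min_le_left _ _).trans (ENNReal.rpow_le_rpow_of_exponent_le (by norm_num) ?_)
      rw [abs_of_nonpos (by linarith)]
      nlinarith [mul_nonneg (sub_nonneg.2 ha) (sub_nonneg.2 h')]
    · have h' : (⌊x⌋ : ℝ) + 1 ≤ n := by exact_mod_cast h
      refine (min_le_right _ _).trans (ENNReal.rpow_le_rpow_of_exponent_le (by norm_num) ?_)
      rw [abs_of_nonneg (by linarith)]
      nlinarith [mul_nonneg (sub_nonneg.2 hb) (by linarith : 0 ≤ (n : ℝ) - x)]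
  refine (ENNReal.tsum_le_tsum key).trans_eq ?_
  rw [ENNReal.tsum_mul_right, ENNReal.tsum_mul_left]
  congr 2
  exact (Equiv.subRight ⌊x⌋).tsum_eq (fun n : ℤ => (2 : ℝ≥0∞) ^ (-(γ * |(n : ℝ)|)))

theorem lintegral_abs_lt_rpow {lam : ℝ} (hlam : lam < 1) {ρ : ℝ} (hρ : 0 < ρ) :
    ∫⁻ τ in {τ : ℝ | |τ| < ρ}, ENNReal.ofReal (|τ| ^ (-lam)) =
      ENNReal.ofReal (2 / (1 - lam) * ρ ^ (1 - lam)) := by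
  have hset : {τ : ℝ | |τ| < ρ} = Set.Ioo (-ρ) ρ := by ext; simp [abs_lt]
  have hi : IntervalIntegrable (fun τ : ℝ => |τ| ^ (-lam)) volume 0 ρ := by
    refine (intervalIntegral.intervalIntegrable_rpow' (r := -lam) (by linarith)).congr ?_
    intro τ hτ
    rw [Set.uIoc_of_le hρ.le] at hτ
    simp [abs_of_pos hτ.1]
  have hi' : IntervalIntegrable (fun τ : ℝ => |τ| ^ (-lam)) volume (-ρ) 0 := by
    have := hi.comp_sub_left 0
    simpa using this.symm
  rw [hset, ← Measure.restrict_congr_set Ioo_ae_eq_Ioc.symm,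
    ← ofReal_integral_eq_lintegral_ofReal
      ((intervalIntegrable_iff_integrableOn_Ioc_of_le (by linarith)).1 (hi'.trans hi))
      (ae_of_all _ fun τ => by positivity),
    ← intervalIntegral.integral_of_le (by linarith)]
  congr 1
  rw [← intervalIntegral.integral_add_adjacent_intervals hi' hi]
  have h0 : ∫ τ in (0 : ℝ)..ρ, |τ| ^ (-lam) = ρ ^ (1 - lam) / (1 - lam) := by
    rw [intervalIntegral.integral_congr (g := fun τ : ℝ => τ ^ (-lam)),
      integral_rpow (Or.inl (by linarith))]
    · rw [Real.zero_rpow (by linarith)]; ring_nf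
    · intro τ hτ
      rw [Set.uIcc_of_le hρ.le] at hτ
      simp [abs_of_nonneg hτ.1]
  have h1 : ∫ τ in (-ρ)..(0 : ℝ), |τ| ^ (-lam) = ∫ τ in (0 : ℝ)..ρ, |τ| ^ (-lam) := by
    have := intervalIntegral.integral_comp_neg (a := 0) (b := ρ) (fun τ : ℝ => |τ| ^ (-lam))
    simpa using this.symm
  rw [h1, h0]; ring

theorem lintegral_le_abs_rpow {σ : ℝ} (hσ : 1 < σ) {ρ : ℝ} (hρ : 0 < ρ) :
    ∫⁻ τ in {τ : ℝ | ρ ≤ |τ|}, ENNReal.ofReal (|τ| ^ (-σ)) ≤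
      ENNReal.ofReal (2 / (σ - 1) * ρ ^ (1 - σ)) := by
  have hset : {τ : ℝ | ρ ≤ |τ|} ⊆ Set.Ici ρ ∪ Set.Iic (-ρ) := by
    intro τ hτ
    rcases le_abs.1 (Set.mem_ofPred.1 hτ) with h | h
    · exact Or.inl h
    · exact Or.inr (by simp; linarith)
  have h0 : ∫⁻ τ in Set.Ici ρ, ENNReal.ofReal (|τ| ^ (-σ)) =
      ENNReal.ofReal (ρ ^ (1 - σ) / (σ - 1)) := by
    rw [setLIntegral_congr_fun (g := fun τ => ENNReal.ofReal (τ ^ (-σ))) measurableSet_Ici,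
      setLIntegral_congr Ioi_ae_eq_Ici.symm,
      ← ofReal_integral_eq_lintegral_ofReal (integrableOn_Ioi_rpow_of_lt (by linarith) hρ),
      integral_Ioi_rpow_of_lt (by linarith) hρ]
    · congr 1
      rw [show -σ + 1 = -(σ - 1) by ring, show 1 - σ = -(σ - 1) by ring, neg_div_neg_eq]
    · filter_upwards [ae_restrict_mem measurableSet_Ioi] with τ hτ
      exact Real.rpow_nonneg (hρ.trans hτ).le _
    · intro τ hτ
      simp only [abs_of_pos (hρ.trans_le hτ)]
  have h1 : ∫⁻ τ in Set.Iic (-ρ), ENNReal.ofReal (|τ| ^ (-σ)) =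
      ∫⁻ τ in Set.Ici ρ, ENNReal.ofReal (|τ| ^ (-σ)) := by
    have := (Measure.measurePreserving_neg (volume : Measure ℝ)).setLIntegral_comp_preimage
      (s := Set.Iic (-ρ)) measurableSet_Iic (f := fun τ => ENNReal.ofReal (|τ| ^ (-σ)))
      (by fun_prop)
    simpa using this.symm
  refine (lintegral_mono_set hset).trans ((lintegral_union_le _ _ _).trans_eq ?_)
  rw [h1, h0, ← ENNReal.ofReal_add (by have : 0 < σ - 1 := by linarith
                                       positivity) (by have : 0 < σ - 1 := by linarith
                                                       positivity)]
  congr 1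
  ring

theorem exists_lintegral_sublevel_le {θ : ℝ} (h0 : 0 < θ) (h1 : θ < 1 / 2) :
    ∃ C : ℝ≥0∞, C ≠ 0 ∧ C ≠ ∞ ∧ ∀ g : ℝ → ℝ≥0∞, Measurable g →
      (∫⁻ t, g t ^ (1 / (1 - θ)) ≤ 1) → ∀ (s : ℝ) (x : ℝ≥0∞),
      ∫⁻ t in {t | g t ≤ x}, ENNReal.ofReal (|t - s| ^ (-(2 * θ))) * g t ≤
        C * x ^ (θ / (1 - θ)) := by
  set C₁ : ℝ := 2 / (1 - 2 * θ) with hC₁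
  set C₂ : ℝ := 2 ^ θ with hC₂
  have hC₁0 : 0 < C₁ := div_pos two_pos (by linarith)
  have hC₂0 : 0 < C₂ := by positivity
  have hθ1 : 0 < 1 - θ := by linarith
  refine ⟨ENNReal.ofReal (C₁ + C₂), by simp; positivity, by simp, fun g hg hg1 s x => ?_⟩
  rcases eq_or_ne x ∞ with rfl | hx
  · rw [ENNReal.top_rpow_of_pos (by positivity), ENNReal.mul_top (by simp; positivity)]
    exact le_top
  rcases eq_or_ne x 0 with rfl | hx0
  · rw [setLIntegral_congr_fun (g := fun _ => 0) (measurableSet_le hg measurable_const)]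
    · simp
    · intro t ht
      simp [nonpos_iff_eq_zero.1 (show g t ≤ 0 from ht)]
  set y := x.toReal with hy
  have hxy : x = ENNReal.ofReal y := (ENNReal.ofReal_toReal hx).symm
  have hy0 : 0 < y := ENNReal.toReal_pos hx0 hx
  set ρ : ℝ := y ^ (-(1 / (1 - θ))) with hρ
  have hρ0 : 0 < ρ := by positivity
  have hmeas : Measurable fun τ : ℝ => ENNReal.ofReal (|τ| ^ (-(2 * θ))) := by fun_prop
  have hnear : ∫⁻ t in {t | g t ≤ x} ∩ {t | |t - s| < ρ},
      ENNReal.ofReal (|t - s| ^ (-(2 * θ))) * g t ≤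
        ENNReal.ofReal (C₁ * y ^ (θ / (1 - θ))) := by
    calc _ ≤ ∫⁻ t in {t | g t ≤ x} ∩ {t | |t - s| < ρ},
          ENNReal.ofReal (|t - s| ^ (-(2 * θ))) * x := by
          refine setLIntegral_mono (by fun_prop) fun t ht => ?_
          gcongr
          exact ht.1
      _ ≤ ∫⁻ t in {t | |t - s| < ρ}, ENNReal.ofReal (|t - s| ^ (-(2 * θ))) * x :=
          lintegral_mono_set Set.inter_subset_right
      _ = (∫⁻ t in {t | |t - s| < ρ}, ENNReal.ofReal (|t - s| ^ (-(2 * θ)))) * x :=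
          lintegral_mul_const _ (by fun_prop)
      _ = (∫⁻ τ in {τ : ℝ | |τ| < ρ}, ENNReal.ofReal (|τ| ^ (-(2 * θ)))) * x := by
          congr 1
          exact (measurePreserving_sub_right volume s).setLIntegral_comp_preimage
            (s := {τ : ℝ | |τ| < ρ}) (measurableSet_lt (by fun_prop) (by fun_prop)) hmeas
      _ = _ := by
          rw [lintegral_abs_lt_rpow (by linarith) hρ0, hxy,
            ← ENNReal.ofReal_mul (by have : 0 < 1 - 2 * θ := by linarith
                                     positivity)]
          congr 1
          rw [mul_assoc, hρ, ← Real.rpow_mul hy0.le]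
          nth_rewrite 2 [← Real.rpow_one y]
          rw [← Real.rpow_add hy0]
          congr 2
          field_simp
          ring
  have hfar : ∫⁻ t in {t | ρ ≤ |t - s|}, ENNReal.ofReal (|t - s| ^ (-(2 * θ))) * g t ≤
        ENNReal.ofReal (C₂ * y ^ (θ / (1 - θ))) := by
    have hpq : (1 / θ).HolderConjugate (1 / (1 - θ)) := by
      refine Real.holderConjugate_iff.2 ⟨?_, by simp⟩
      rw [lt_div_iff₀ h0]; linarith
    refine (ENNReal.lintegral_mul_le_Lp_mul_Lq _ hpq (by fun_prop) (by fun_prop)).trans ?_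
    simp only [one_div_one_div]
    have e1 : (∫⁻ t in {t | ρ ≤ |t - s|}, g t ^ (1 / (1 - θ))) ^ (1 - θ) ≤ 1 := by
      refine ENNReal.rpow_le_one ((setLIntegral_le_lintegral _ _).trans hg1) hθ1.le
    have e2 : (∫⁻ t in {t | ρ ≤ |t - s|}, ENNReal.ofReal (|t - s| ^ (-(2 * θ))) ^ (1 / θ)) ≤
        ENNReal.ofReal (2 * ρ ^ (-1 : ℝ)) := by
      have : ∀ τ : ℝ, ENNReal.ofReal (|τ| ^ (-(2 * θ))) ^ (1 / θ) =
          ENNReal.ofReal (|τ| ^ (-2 : ℝ)) := fun τ => by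
        rw [ENNReal.ofReal_rpow_of_nonneg (by positivity) (by positivity),
          ← Real.rpow_mul (abs_nonneg _)]
        congr 2
        field_simp
      simp_rw [this]
      refine ((measurePreserving_sub_right volume s).setLIntegral_comp_preimage
            (s := {τ : ℝ | ρ ≤ |τ|}) (f := fun τ => ENNReal.ofReal (|τ| ^ (-2 : ℝ)))
            (measurableSet_le (by fun_prop) (by fun_prop)) (by fun_prop)).trans_le ?_
      refine (lintegral_le_abs_rpow one_lt_two hρ0).trans_eq ?_
      norm_num
    refine (mul_le_mul' (ENNReal.rpow_le_rpow e2 h0.le) e1).trans_eq ?_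
    rw [mul_one, ENNReal.ofReal_rpow_of_nonneg (by positivity) h0.le,
      Real.mul_rpow two_pos.le (by positivity), hρ, ← Real.rpow_mul hy0.le, ← Real.rpow_mul hy0.le]
    congr 3
    field_simp
  have hsub : {t | g t ≤ x} ⊆ ({t | g t ≤ x} ∩ {t | |t - s| < ρ}) ∪ {t | ρ ≤ |t - s|} := by
    intro t ht
    rcases lt_or_ge |t - s| ρ with h | h
    · exact Or.inl ⟨ht, h⟩
    · exact Or.inr h
  refine (lintegral_mono_set hsub).trans ((lintegral_union_le _ _ _).trans
    ((add_le_add hnear hfar).trans_eq ?_))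
  rw [← ENNReal.ofReal_add (by positivity) (by positivity), ← add_mul,
    ENNReal.ofReal_mul (by positivity), hxy, ENNReal.ofReal_rpow_of_pos hy0]

/-- The one-dimensional Hardy–Littlewood–Sobolev inequality, in bilinear diagonal form. -/
theorem exists_hardyLittlewoodSobolev {θ : ℝ} (h0 : 0 < θ) (h1 : θ < 1 / 2) :
    ∃ C : ℝ≥0∞, C ≠ ∞ ∧ ∀ f g : ℝ → ℝ≥0∞, Measurable f → Measurable g →
      ∫⁻ t, ∫⁻ s, ENNReal.ofReal (|t - s| ^ (-(2 * θ))) * (f s * g t) ≤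
        C * ((∫⁻ t, f t ^ (1 / (1 - θ))) ^ (1 - θ) * (∫⁻ t, g t ^ (1 / (1 - θ))) ^ (1 - θ)) := by
  obtain ⟨C, hC0, hC, H⟩ := exists_lintegral_sublevel_le h0 h1
  have hθ1 : 0 < 1 - θ := by linarith
  have half : ∀ f g : ℝ → ℝ≥0∞, Measurable f → Measurable g →
      (∫⁻ t, f t ^ (1 / (1 - θ)) ≤ 1) → (∫⁻ t, g t ^ (1 / (1 - θ)) ≤ 1) →
      ∫⁻ s, ∫⁻ t, {t | g t ≤ f s}.indicator
        (fun t => ENNReal.ofReal (|t - s| ^ (-(2 * θ))) * (f s * g t)) t ≤ C := by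
    intro f g hf hg hf1 hg1
    calc _ ≤ ∫⁻ s, C * f s ^ (1 / (1 - θ)) := by
          refine lintegral_mono fun s => ?_
          dsimp only
          rw [lintegral_indicator (measurableSet_le hg measurable_const)]
          have : ∀ t, ENNReal.ofReal (|t - s| ^ (-(2 * θ))) * (f s * g t) =
              f s * (ENNReal.ofReal (|t - s| ^ (-(2 * θ))) * g t) := fun t => by ring
          simp_rw [this]
          rw [lintegral_const_mul _ (by fun_prop)]
          refine (mul_le_mul_right (H g hg hg1 s (f s)) _).trans_eq ?_
          rw [mul_left_comm]
          congr 1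
          nth_rewrite 1 [← ENNReal.rpow_one (f s)]
          rw [← ENNReal.rpow_add_of_nonneg _ _ zero_le_one (by positivity)]
          congr 1
          field_simp
          ring
      _ = C * ∫⁻ s, f s ^ (1 / (1 - θ)) := lintegral_const_mul _ (by fun_prop)
      _ ≤ C * 1 := by gcongr
      _ = C := mul_one C
  have unit : ∀ f g : ℝ → ℝ≥0∞, Measurable f → Measurable g →
      (∫⁻ t, f t ^ (1 / (1 - θ)) ≤ 1) → (∫⁻ t, g t ^ (1 / (1 - θ)) ≤ 1) →
      ∫⁻ t, ∫⁻ s, ENNReal.ofReal (|t - s| ^ (-(2 * θ))) * (f s * g t) ≤ 2 * C := by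
    intro f g hf hg hf1 hg1
    have hm : Measurable fun z : ℝ × ℝ => {t | g t ≤ f z.2}.indicator
        (fun t => ENNReal.ofReal (|t - z.2| ^ (-(2 * θ))) * (f z.2 * g t)) z.1 := by
      refine Measurable.ite (p := fun z : ℝ × ℝ => g z.1 ≤ f z.2)
        (measurableSet_le (by fun_prop) (by fun_prop)) (by fun_prop) measurable_const
    calc _ ≤ ∫⁻ t, ∫⁻ s, ({t | g t ≤ f s}.indicator
            (fun t => ENNReal.ofReal (|t - s| ^ (-(2 * θ))) * (f s * g t)) t +
          {s | f s ≤ g t}.indicator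
            (fun s => ENNReal.ofReal (|s - t| ^ (-(2 * θ))) * (g t * f s)) s) := by
          refine lintegral_mono fun t => lintegral_mono fun s => ?_
          rcases le_total (g t) (f s) with h | h
          · refine le_add_right ?_
            simp [h]
          · refine le_add_left ?_
            simp [h, abs_sub_comm t s, mul_comm (g t)]
      _ = (∫⁻ t, ∫⁻ s, {t | g t ≤ f s}.indicator
            (fun t => ENNReal.ofReal (|t - s| ^ (-(2 * θ))) * (f s * g t)) t) +
          ∫⁻ t, ∫⁻ s, {s | f s ≤ g t}.indicator
            (fun s => ENNReal.ofReal (|s - t| ^ (-(2 * θ))) * (g t * f s)) s := by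
          rw [← lintegral_add_left hm.lintegral_prod_right']
          exact lintegral_congr fun t => lintegral_add_left (hm.comp measurable_prodMk_left) _
      _ ≤ C + C := by
          refine add_le_add ?_ (half g f hg hf hg1 hf1)
          rw [lintegral_lintegral_swap hm.aemeasurable]
          exact half f g hf hg hf1 hg1
      _ = 2 * C := (two_mul C).symm
  refine ⟨2 * C, ENNReal.mul_ne_top (by norm_num) hC, fun f g hf hg => ?_⟩
  set A := (∫⁻ t, f t ^ (1 / (1 - θ))) ^ (1 - θ) with hA
  set B := (∫⁻ t, g t ^ (1 / (1 - θ))) ^ (1 - θ) with hB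
  have zero : ∀ f : ℝ → ℝ≥0∞, Measurable f → (∫⁻ t, f t ^ (1 / (1 - θ))) ^ (1 - θ) = 0 →
      f =ᵐ[volume] 0 := by
    intro f hf h
    rw [ENNReal.rpow_eq_zero_iff_of_pos hθ1, lintegral_eq_zero_iff (by fun_prop)] at h
    filter_upwards [h] with t ht
    simpa [hθ1, hθ1.le, not_lt.2 (by linarith : θ ≤ 1)] using ht
  have normal : ∀ f : ℝ → ℝ≥0∞, Measurable f → (∫⁻ t, f t ^ (1 / (1 - θ))) ^ (1 - θ) ≠ 0 →
      (∫⁻ t, f t ^ (1 / (1 - θ))) ^ (1 - θ) ≠ ∞ →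
      ∫⁻ t, (((∫⁻ t, f t ^ (1 / (1 - θ))) ^ (1 - θ))⁻¹ * f t) ^ (1 / (1 - θ)) ≤ 1 := by
    intro f hf h h'
    simp_rw [ENNReal.mul_rpow_of_nonneg _ _ (by positivity : 0 ≤ 1 / (1 - θ))]
    rw [lintegral_const_mul _ (by fun_prop), ENNReal.inv_rpow, ← ENNReal.rpow_mul,
      mul_one_div_cancel hθ1.ne', ENNReal.rpow_one]
    exact ENNReal.inv_mul_le_one _
  rcases eq_or_ne A 0 with hA0 | hA0
  · have hf0 := zero f hf hA0
    refine le_of_eq_of_le ?_ (zero_le (a := _))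
    rw [lintegral_eq_zero_iff' (by fun_prop)]
    refine ae_of_all _ fun t => ?_
    rw [Pi.zero_apply, lintegral_eq_zero_iff' (by fun_prop)]
    filter_upwards [hf0] with s hs
    simp [hs]
  rcases eq_or_ne B 0 with hB0 | hB0
  · have hg0 := zero g hg hB0
    refine le_of_eq_of_le ?_ (zero_le (a := _))
    rw [lintegral_eq_zero_iff' (by fun_prop)]
    filter_upwards [hg0] with t ht
    simp [ht]
  rcases eq_or_ne A ∞ with hA1 | hA1
  · rw [hA1, ENNReal.top_mul hB0, ENNReal.mul_top (by simp [hC0])]; exact le_top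
  rcases eq_or_ne B ∞ with hB1 | hB1
  · rw [hB1, ENNReal.mul_top hA0, ENNReal.mul_top (by simp [hC0])]; exact le_top
  have h := unit _ _ (hf.const_mul A⁻¹) (hg.const_mul B⁻¹) (normal f hf hA0 hA1)
    (normal g hg hB0 hB1)
  calc _ = ∫⁻ t, ∫⁻ s, A * B *
        (ENNReal.ofReal (|t - s| ^ (-(2 * θ))) * (A⁻¹ * f s * (B⁻¹ * g t))) := by
        refine lintegral_congr fun t => lintegral_congr fun s => ?_
        have e : A * A⁻¹ = 1 := ENNReal.mul_inv_cancel hA0 hA1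
        have e' : B * B⁻¹ = 1 := ENNReal.mul_inv_cancel hB0 hB1
        calc _ = (A * A⁻¹) * (B * B⁻¹) *
              (ENNReal.ofReal (|t - s| ^ (-(2 * θ))) * (f s * g t)) := by rw [e, e']; ring
          _ = _ := by ring
    _ = A * B * ∫⁻ t, ∫⁻ s,
        (ENNReal.ofReal (|t - s| ^ (-(2 * θ))) * (A⁻¹ * f s * (B⁻¹ * g t))) := by
        rw [← lintegral_const_mul _ (by fun_prop)]
        exact lintegral_congr fun t => lintegral_const_mul _ (by fun_prop)
    _ ≤ A * B * (2 * C) := by gcongr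
    _ = _ := mul_comm _ _

/-! ### Decomposition into level sets -/

theorem two_rpow_ne_zero (x : ℝ) : (2 : ℝ≥0∞) ^ x ≠ 0 :=
  (ENNReal.rpow_pos (by norm_num) (by norm_num)).ne'

section LevelSets

variable {X : Type*} [MeasurableSpace X] {ν : Measure X}

/-- The set where `|f|` lies between `2 ^ k * N` and `2 ^ (k + 1) * N`. -/
def levelSet (N : ℝ≥0∞) (f : X → ℂ) (k : ℤ) : Set X :=
  {x | 2 ^ (k : ℝ) * N ≤ ‖f x‖ₑ ∧ ‖f x‖ₑ < 2 ^ ((k : ℝ) + 1) * N}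

/-- The `ℓ²`-coefficients of the decomposition of `f ∈ L^p` along its level sets. -/
def levelCoeff (p : ℝ) (N : ℝ≥0∞) (ν : Measure X) (f : X → ℂ) (k : ℤ) : ℝ≥0∞ :=
  N ^ (1 - p / 2) * (∫⁻ x, (levelSet N f k).indicator (fun x => ‖f x‖ₑ ^ p) x ∂ν) ^ (1 / 2 : ℝ)

theorem measurableSet_levelSet {f : X → ℂ} (hf : Measurable f) (N : ℝ≥0∞) (k : ℤ) :
    MeasurableSet (levelSet N f k) :=
  (measurableSet_le measurable_const hf.enorm).inter (measurableSet_lt hf.enorm measurable_const)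

theorem pairwise_disjoint_of_dyadic {Y : Type*} (N g : Y → ℝ≥0∞) :
    Pairwise (Function.onFun Disjoint fun k : ℤ =>
      {x | 2 ^ (k : ℝ) * N x ≤ g x ∧ g x < 2 ^ ((k : ℝ) + 1) * N x}) := by
  have key : ∀ k l : ℤ, k < l → Disjoint
      {x | 2 ^ (k : ℝ) * N x ≤ g x ∧ g x < 2 ^ ((k : ℝ) + 1) * N x}
      {x | 2 ^ (l : ℝ) * N x ≤ g x ∧ g x < 2 ^ ((l : ℝ) + 1) * N x} := by
    intro k l hkl
    refine Set.disjoint_left.2 fun x hx hx' => ?_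
    have h1 : ((k : ℝ) + 1) ≤ l := by exact_mod_cast hkl
    have h2 : (2 : ℝ≥0∞) ^ ((k : ℝ) + 1) * N x ≤ 2 ^ (l : ℝ) * N x := by
      gcongr
      norm_num
    exact absurd (hx.2.trans_le (h2.trans hx'.1)) (lt_irrefl _)
  intro k l hkl
  rcases lt_or_gt_of_ne hkl with h | h
  · exact key k l h
  · exact (key l k h).symm

theorem exists_mem_dyadic {N y : ℝ≥0∞} (hN : N ≠ 0) (hN' : N ≠ ∞) (hy : y ≠ 0) (hy' : y ≠ ∞) :
    ∃ k : ℤ, 2 ^ (k : ℝ) * N ≤ y ∧ y < 2 ^ ((k : ℝ) + 1) * N := by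
  obtain ⟨k, hk, hk'⟩ := ENNReal.exists_mem_Ico_zpow (x := y / N) (y := 2)
    (ENNReal.div_ne_zero.2 ⟨hy, hN'⟩) (ENNReal.div_ne_top hy' hN) (by norm_num) (by norm_num)
  refine ⟨k, ?_, ?_⟩
  · rw [ENNReal.rpow_intCast]
    exact (ENNReal.le_div_iff_mul_le (Or.inl hN) (Or.inl hN')).1 hk
  · rw [show (k : ℝ) + 1 = ((k + 1 : ℤ) : ℝ) by push_cast; rfl, ENNReal.rpow_intCast]
    exact (ENNReal.div_lt_iff (Or.inl hN) (Or.inl hN')).1 hk'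

variable {p : ℝ} {f : X → ℂ}

theorem lintegral_enorm_rpow_eq (hp : 1 < p) :
    ∫⁻ x, ‖f x‖ₑ ^ p ∂ν = eLpNorm f (ENNReal.ofReal p) ν ^ p := by
  have hp0 : 0 < p := by linarith
  rw [eLpNorm_eq_lintegral_rpow_enorm_toReal (by simpa using hp0) (by simp),
    ENNReal.toReal_ofReal hp0.le, ← ENNReal.rpow_mul, one_div_mul_cancel hp0.ne', ENNReal.rpow_one]

theorem tsum_levelCoeff_sq_le (hf : Measurable f) (hp : 1 < p) (hp2 : p < 2) :
    ∑' k, levelCoeff p (eLpNorm f (ENNReal.ofReal p) ν) ν f k ^ 2 ≤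
      eLpNorm f (ENNReal.ofReal p) ν ^ 2 := by
  set N := eLpNorm f (ENNReal.ofReal p) ν with hN
  have h : ∀ k, levelCoeff p N ν f k ^ 2 =
      N ^ (2 - p) * ∫⁻ x in levelSet N f k, ‖f x‖ₑ ^ p ∂ν := fun k => by
    rw [levelCoeff, lintegral_indicator (measurableSet_levelSet hf N k), mul_pow,
      ← ENNReal.rpow_two, ← ENNReal.rpow_two, ← ENNReal.rpow_mul, ← ENNReal.rpow_mul]
    norm_num
    ring_nf
  simp_rw [h]
  rw [ENNReal.tsum_mul_left, ← lintegral_iUnion (measurableSet_levelSet hf N)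
    (pairwise_disjoint_of_dyadic (fun _ => N) fun x => ‖f x‖ₑ)]
  refine (mul_le_mul_right (setLIntegral_le_lintegral _ _) _).trans_eq ?_
  rw [lintegral_enorm_rpow_eq hp, ← hN, ← ENNReal.rpow_add_of_nonneg _ _ (by linarith)
    (by linarith), ← ENNReal.rpow_two]
  congr 1
  ring

theorem eLpNorm_two_indicator_levelSet_le (hf : Measurable f) (hp : 1 < p) (hp2 : p < 2)
    (N : ℝ≥0∞) (k : ℤ) :
    eLpNorm ((levelSet N f k).indicator f) 2 ν ≤
      2 * 2 ^ ((1 - p / 2) * k) * levelCoeff p N ν f k := by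
  have hm := measurableSet_levelSet hf N k
  rw [eLpNorm_indicator_eq_eLpNorm_restrict hm,
    eLpNorm_eq_lintegral_rpow_enorm_toReal (by norm_num) (by norm_num), levelCoeff,
    lintegral_indicator hm]
  set J := ∫⁻ x in levelSet N f k, ‖f x‖ₑ ^ p ∂ν with hJ
  have h1 : ∫⁻ x in levelSet N f k, ‖f x‖ₑ ^ (2 : ℝ≥0∞).toReal ∂ν ≤
      (2 ^ ((k : ℝ) + 1) * N) ^ (2 - p) * J := by
    rw [hJ, ← lintegral_const_mul _ (by fun_prop)]
    refine setLIntegral_mono (by fun_prop) fun x hx => ?_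
    have : (2 : ℝ≥0∞).toReal = (2 - p) + p := by simp
    rw [this, ENNReal.rpow_add_of_nonneg _ _ (by linarith) (by linarith)]
    gcongr
    exact hx.2.le
  refine (ENNReal.rpow_le_rpow h1 (by positivity)).trans ?_
  rw [ENNReal.mul_rpow_of_nonneg _ _ (by positivity), ← ENNReal.rpow_mul,
    ENNReal.mul_rpow_of_nonneg _ _ (by norm_num; linarith), ← ENNReal.rpow_mul]
  have e1 : (2 - p) * (1 / (2 : ℝ≥0∞).toReal) = 1 - p / 2 := by simp; ring
  have e2 : (1 / (2 : ℝ≥0∞).toReal) = 1 / 2 := by simp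
  rw [e1, e2, ← mul_assoc]
  gcongr
  nth_rewrite 2 [← ENNReal.rpow_one 2]
  rw [two_rpow_mul]
  refine ENNReal.rpow_le_rpow_of_exponent_le (by norm_num) ?_
  nlinarith

theorem eLpNorm_one_indicator_levelSet_le (hf : Measurable f) (hp : 1 < p)
    (k : ℤ) :
    eLpNorm ((levelSet (eLpNorm f (ENNReal.ofReal p) ν) f k).indicator f) 1 ν ≤
      2 ^ (-((p - 1) * k)) * levelCoeff p (eLpNorm f (ENNReal.ofReal p) ν) ν f k := by
  set N := eLpNorm f (ENNReal.ofReal p) ν with hNdef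
  have hm := measurableSet_levelSet hf N k
  rcases eq_or_ne N 0 with h0 | h0
  · have : levelSet N f k = ∅ := by ext x; simp [levelSet, h0]
    simp [this]
  rcases eq_or_ne N ∞ with hN | hN
  · have : levelSet N f k = ∅ := Set.eq_empty_of_forall_notMem fun x hx => by
      have h := hx.1
      rw [hN, ENNReal.mul_top (two_rpow_ne_zero _), top_le_iff] at h
      exact enorm_ne_top h
    simp [this]
  rw [eLpNorm_indicator_eq_eLpNorm_restrict hm, eLpNorm_one_eq_lintegral_enorm, levelCoeff,
    lintegral_indicator hm]
  set J := ∫⁻ x in levelSet N f k, ‖f x‖ₑ ^ p ∂ν with hJ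
  have hJN : J ≤ N ^ p := (setLIntegral_le_lintegral _ _).trans_eq (lintegral_enorm_rpow_eq hp)
  have h2 : (2 : ℝ≥0∞) ^ (k : ℝ) * N ≠ 0 := mul_ne_zero (two_rpow_ne_zero _) h0
  have h1 : ∫⁻ x in levelSet N f k, ‖f x‖ₑ ∂ν ≤ (2 ^ (k : ℝ) * N) ^ (1 - p) * J := by
    rw [hJ, ← lintegral_const_mul _ (by fun_prop)]
    refine setLIntegral_mono (by fun_prop) fun x hx => ?_
    have hx0 : ‖f x‖ₑ ≠ 0 := fun h => h2 (nonpos_iff_eq_zero.1 (h ▸ hx.1))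
    nth_rewrite 1 [← ENNReal.rpow_one ‖f x‖ₑ]
    rw [show (1 : ℝ) = (1 - p) + p by ring, ENNReal.rpow_add _ _ hx0 enorm_ne_top]
    simp only [sub_add_cancel]
    refine mul_le_mul_left ?_ _
    rw [← neg_sub p 1, ENNReal.rpow_neg, ENNReal.rpow_neg]
    exact ENNReal.inv_le_inv.2 (ENNReal.rpow_le_rpow hx.1 (by linarith))
  have h3 : J ≤ N ^ (p / 2) * J ^ (1 / 2 : ℝ) := by
    calc J = J ^ (1 / 2 : ℝ) * J ^ (1 / 2 : ℝ) := by
          rw [← ENNReal.rpow_add_of_nonneg _ _ (by norm_num) (by norm_num)]; norm_num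
      _ ≤ (N ^ p) ^ (1 / 2 : ℝ) * J ^ (1 / 2 : ℝ) := by gcongr
      _ = _ := by rw [← ENNReal.rpow_mul]; ring_nf
  refine h1.trans ((mul_le_mul_right h3 _).trans_eq ?_)
  rw [ENNReal.mul_rpow_of_ne_zero (two_rpow_ne_zero _) h0, ← ENNReal.rpow_mul, ← mul_assoc, ← mul_assoc,
    mul_assoc _ (N ^ (1 - p)), ← ENNReal.rpow_add _ _ h0 hN]
  congr 3 <;> ring

theorem ae_mem_iUnion_levelSet (hf : Measurable f) (hp : 1 < p)
    (hN : eLpNorm f (ENNReal.ofReal p) ν ≠ ∞) :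
    ∀ᵐ x ∂ν, f x ≠ 0 → x ∈ ⋃ k, levelSet (eLpNorm f (ENNReal.ofReal p) ν) f k := by
  rcases eq_or_ne (eLpNorm f (ENNReal.ofReal p) ν) 0 with h0 | h0
  · rw [eLpNorm_eq_zero_iff hf.aestronglyMeasurable (by simp; linarith)] at h0
    filter_upwards [h0] with x hx hx'
    exact absurd hx hx'
  · refine ae_of_all _ fun x hx => Set.mem_iUnion.2 ?_
    exact exists_mem_dyadic h0 hN (by simpa using hx) enorm_ne_top

end LevelSets

theorem hasSum_setIntegral_of_cover {Y E ι : Type*} [MeasurableSpace Y] [NormedAddCommGroup E]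
    [NormedSpace ℝ E] [Countable ι] {μ : Measure Y} {h : Y → E} (hh : Integrable h μ)
    {s : ι → Set Y} (hs : ∀ k, MeasurableSet (s k)) (hd : Pairwise (Function.onFun Disjoint s))
    (h0 : ∀ᵐ y ∂μ, h y ≠ 0 → y ∈ ⋃ k, s k) :
    HasSum (fun k => ∫ y in s k, h y ∂μ) (∫ y, h y ∂μ) := by
  have e : ∫ y, h y ∂μ = ∫ y in ⋃ k, s k, h y ∂μ := by
    rw [← integral_indicator (MeasurableSet.iUnion hs)]
    refine integral_congr_ae ?_
    filter_upwards [h0] with y hy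
    by_cases hy0 : h y = 0
    · simp [Set.indicator, hy0]
    · rw [Set.indicator_of_mem (hy hy0)]
  rw [e]
  exact hasSum_integral_iUnion hs hd hh.integrableOn

section InnerProduct

variable {H : Type*} [NormedAddCommGroup H] [InnerProductSpace ℂ H]

theorem enorm_inner_le (a b : H) : ‖inner ℂ a b‖ₑ ≤ ‖a‖ₑ * ‖b‖ₑ := by
  simp only [← ofReal_norm, ← ENNReal.ofReal_mul (norm_nonneg _)]
  exact ENNReal.ofReal_le_ofReal (norm_inner_le_norm a b)

theorem enorm_inner_comm (a b : H) : ‖inner ℂ a b‖ₑ = ‖inner ℂ b a‖ₑ := by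
  simp only [← ofReal_norm, norm_inner_symm a b]

theorem enorm_inner_self (a : H) : ‖inner ℂ a a‖ₑ = ‖a‖ₑ ^ 2 := by
  rw [inner_self_eq_norm_sq_to_K]
  simp [← ofReal_norm]

theorem enorm_inner_le_tsum {ι : Type*} {a b : ι → H} {A B : H} (ha : HasSum a A)
    (hb : HasSum b B) :
    ‖inner ℂ A B‖ₑ ≤ ∑' k, ∑' l, ‖inner ℂ (a k) (b l)‖ₑ := by
  have h1 : ∀ (c : H) {b : ι → H} {B : H}, HasSum b B →
      ‖inner ℂ c B‖ₑ ≤ ∑' l, ‖inner ℂ c (b l)‖ₑ := by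
    intro c b B hb
    have := (innerSL ℂ c).hasSum hb
    simp only [innerSL_apply_apply] at this
    rw [← this.tsum_eq]
    exact enorm_tsum_le_tsum_enorm
  rw [enorm_inner_comm]
  refine (h1 B ha).trans (ENNReal.tsum_le_tsum fun k => ?_)
  rw [enorm_inner_comm]
  exact h1 _ hb

variable {Y : Type*} [MeasurableSpace Y] {μ : Measure Y}

theorem enorm_inner_integral_le [CompleteSpace H] (a : H) (v : Y → H) :
    ‖inner ℂ a (∫ y, v y ∂μ)‖ₑ ≤ ∫⁻ y, ‖inner ℂ a (v y)‖ₑ ∂μ := by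
  by_cases hv : Integrable v μ
  · rw [← integral_inner hv]
    exact enorm_integral_le_lintegral_enorm _
  · simp [integral_undef hv]

theorem enorm_inner_integral_smul_le [CompleteSpace H] {D : ℝ≥0∞} {a : H} {f : Y → ℂ}
    {v : Y → H} (hf : AEMeasurable f μ) (hD : ∀ y, ‖inner ℂ a (v y)‖ₑ ≤ D) :
    ‖inner ℂ a (∫ y, f y • v y ∂μ)‖ₑ ≤ D * eLpNorm f 1 μ := by
  refine (enorm_inner_integral_le _ _).trans ?_
  rw [eLpNorm_one_eq_lintegral_enorm, ← lintegral_const_mul'' _ hf.enorm]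
  refine lintegral_mono fun y => ?_
  rw [inner_smul_right, enorm_mul, mul_comm]
  gcongr
  exact hD y

end InnerProduct

/-- The Lebesgue exponent `p` with `1 / p = 1 / 2 + θ / σ`, dual to the one paired with the time
exponent `1 / θ` in a `σ`-admissible pair. -/
def inputExponent (σ θ : ℝ) : ℝ := (1 / 2 + θ / σ)⁻¹

section Family

variable {X : Type*} [MeasurableSpace X] {H : Type*} [NormedAddCommGroup H]
  [InnerProductSpace ℂ H]

/-- A family of vectors `V (t, x)` generating a group of operators `f ↦ ∫ f x • V (t, x)` which
satisfies the energy estimate and the dispersive estimate with decay rate `σ`. -/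
structure DispersiveFamily (σ : ℝ) (C : ℝ≥0∞) (ν : Measure X) (V : ℝ × X → H) : Prop where
  stronglyMeasurable : StronglyMeasurable V
  bounded : ∃ M : ℝ, ∀ z, ‖V z‖ ≤ M
  energy : ∀ (t : ℝ) (f : X → ℂ), Integrable f ν →
    ‖∫ x, f x • V (t, x) ∂ν‖ₑ ≤ C * eLpNorm f 2 ν
  decay : ∀ z w : ℝ × X, z.1 ≠ w.1 →
    ‖inner ℂ (V z) (V w)‖ₑ ≤ C * ENNReal.ofReal (|z.1 - w.1| ^ (-σ))

/-- The superposition `∫ f x • V (t, x)`. -/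
def synth (ν : Measure X) (V : ℝ × X → H) (t : ℝ) (f : X → ℂ) : H := ∫ x, f x • V (t, x) ∂ν

variable {ν : Measure X} {V : ℝ × X → H} {σ : ℝ} {C : ℝ≥0∞}

namespace DispersiveFamily

variable (hV : DispersiveFamily σ C ν V)
include hV

theorem integrable_smul {t : ℝ} {f : X → ℂ} (hf : Integrable f ν) :
    Integrable (fun x => f x • V (t, x)) ν := by
  obtain ⟨M, hM⟩ := hV.bounded
  refine (hf.norm.mul_const M).mono' (hf.aestronglyMeasurable.smul
    (hV.stronglyMeasurable.comp_measurable measurable_prodMk_left).aestronglyMeasurable)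
    (ae_of_all _ fun x => ?_)
  rw [norm_smul]
  gcongr
  exact hM _

theorem enorm_inner_synth_le_L2 {t s : ℝ} {f g : X → ℂ} (hf : Integrable f ν)
    (hg : Integrable g ν) :
    ‖inner ℂ (synth ν V t g) (synth ν V s f)‖ₑ ≤ C ^ 2 * (eLpNorm f 2 ν * eLpNorm g 2 ν) := by
  refine (enorm_inner_le _ _).trans
    ((mul_le_mul' (hV.energy t g hg) (hV.energy s f hf)).trans_eq (by ring))

theorem enorm_inner_synth_le_L1 [CompleteSpace H] {t s : ℝ} (hts : t ≠ s) {f g : X → ℂ}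
    (hf : Integrable f ν) (hg : Integrable g ν) :
    ‖inner ℂ (synth ν V t g) (synth ν V s f)‖ₑ ≤
      C * ENNReal.ofReal (|t - s| ^ (-σ)) * (eLpNorm f 1 ν * eLpNorm g 1 ν) := by
  refine (enorm_inner_integral_smul_le (D := C * ENNReal.ofReal (|t - s| ^ (-σ)) * eLpNorm g 1 ν)
    hf.aemeasurable fun x => ?_).trans_eq (by ring)
  rw [enorm_inner_comm]
  refine enorm_inner_integral_smul_le hg.aemeasurable fun y => ?_
  have := hV.decay (s, x) (t, y) hts.symm
  rwa [abs_sub_comm] at this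

theorem hasSum_synth {t : ℝ} {f : X → ℂ} (hf : Measurable f) (hfi : Integrable f ν) {p : ℝ}
    (hp : 1 < p) (hN : eLpNorm f (ENNReal.ofReal p) ν ≠ ∞) :
    HasSum (fun k => synth ν V t ((levelSet (eLpNorm f (ENNReal.ofReal p) ν) f k).indicator f))
      (synth ν V t f) := by
  set N := eLpNorm f (ENNReal.ofReal p) ν with hNd
  have hm := measurableSet_levelSet hf N
  convert hasSum_setIntegral_of_cover (hV.integrable_smul (t := t) hfi) hm
    (pairwise_disjoint_of_dyadic (fun _ => N) fun x => ‖f x‖ₑ) ?_ using 2 with k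
  · rw [synth, ← integral_indicator (hm k)]
    refine integral_congr_ae (ae_of_all _ fun x => ?_)
    by_cases hx : x ∈ levelSet N f k <;> simp [hx]
  · rfl
  · filter_upwards [ae_mem_iUnion_levelSet hf hp hN] with x hx h
    exact hx fun h0 => h (by simp [h0])

end DispersiveFamily

/-- The fixed-time dispersive estimate in the intermediate Lebesgue spaces. -/
theorem exists_enorm_inner_synth_le [CompleteSpace H] (σ : ℝ) (hσ : 0 < σ) {C : ℝ≥0∞}
    (hC : C ≠ ∞) (ν : Measure X) {θ : ℝ} (h0 : 0 < θ) (h1 : θ ≤ σ / 2) :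
    ∃ K : ℝ≥0∞, K ≠ ∞ ∧ ∀ V : ℝ × X → H, DispersiveFamily σ C ν V →
      ∀ (f g : X → ℂ) (t s : ℝ), t ≠ s → Measurable f → Measurable g → Integrable f ν →
      Integrable g ν → eLpNorm f (ENNReal.ofReal (inputExponent σ θ)) ν ≠ ∞ →
      eLpNorm g (ENNReal.ofReal (inputExponent σ θ)) ν ≠ ∞ →
      ‖inner ℂ (synth ν V t g) (synth ν V s f)‖ₑ ≤
        K * ENNReal.ofReal (|t - s| ^ (-(2 * θ))) *
          (eLpNorm f (ENNReal.ofReal (inputExponent σ θ)) ν *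
            eLpNorm g (ENNReal.ofReal (inputExponent σ θ)) ν) := by
  rcases h1.eq_or_lt with rfl | h1
  · refine ⟨C, hC, fun V hV f g t s hts _ _ hfi hgi _ _ => ?_⟩
    have e : inputExponent σ (σ / 2) = 1 := by
      rw [inputExponent]; field_simp; norm_num
    have := hV.enorm_inner_synth_le_L1 hts hfi hgi
    rw [e, ENNReal.ofReal_one]
    convert this using 5
    ring
  set p := inputExponent σ θ with hp
  have hpos : 0 < 1 / 2 + θ / σ := by positivity
  have hθσ : θ / σ < 1 / 2 := by rw [div_lt_iff₀ hσ]; linarith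
  have hp1 : 1 < p := by
    rw [hp, inputExponent]; exact (one_lt_inv₀ hpos).2 (by linarith)
  have hp2 : p < 2 := by
    rw [hp, inputExponent, inv_lt_comm₀ hpos (by norm_num)]
    have : 0 < θ / σ := by positivity
    norm_num at this ⊢
    linarith
  obtain ⟨K, hK, hsum⟩ := exists_tsum_min_le (α := 1 - p / 2) (β := p - 1) (by linarith)
    (by linarith)
  refine ⟨(4 * C ^ 2 + C) * K, by finiteness,
    fun V hV f g t s hts hf hg hfi hgi hNf hNg => ?_⟩
  set Nf := eLpNorm f (ENNReal.ofReal p) ν with hNf_def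
  set Ng := eLpNorm g (ENNReal.ofReal p) ν with hNg_def
  have hτ : 0 < |t - s| := abs_pos.2 (sub_ne_zero.2 hts)
  have h2x : ∀ y : ℝ, ENNReal.ofReal (|t - s| ^ y) = 2 ^ (Real.logb 2 |t - s| * y) := fun y => by
    rw [← ENNReal.ofReal_rpow_of_pos hτ, ENNReal.rpow_mul]
    congr 1
    rw [show (2 : ℝ≥0∞) = ENNReal.ofReal 2 by simp, ENNReal.ofReal_rpow_of_pos (by norm_num),
      Real.rpow_logb (by norm_num) (by norm_num) hτ]
  set x := -(2 * σ / p) * Real.logb 2 |t - s| with hx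
  set c := levelCoeff p Nf ν f
  set d := levelCoeff p Ng ν g
  set κ : ℤ → ℝ≥0∞ := fun n => min ((2 : ℝ≥0∞) ^ ((1 - p / 2) * n))
    (2 ^ ((1 - p / 2 + (p - 1)) * x) * 2 ^ (-((p - 1) * n))) with hκ
  have hp0 : p ≠ 0 := by linarith
  have term : ∀ k l : ℤ, ‖inner ℂ (synth ν V t ((levelSet Ng g k).indicator g))
      (synth ν V s ((levelSet Nf f l).indicator f))‖ₑ ≤
      (4 * C ^ 2 + C) * (κ (k + l) * (d k * c l)) := by
    intro k l
    have hfl := hfi.indicator (measurableSet_levelSet hf Nf l)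
    have hgk := hgi.indicator (measurableSet_levelSet hg Ng k)
    have b1 := (hV.enorm_inner_synth_le_L2 (t := t) (s := s) hfl hgk).trans
      (mul_le_mul_right (mul_le_mul' (eLpNorm_two_indicator_levelSet_le hf hp1 hp2 Nf l)
        (eLpNorm_two_indicator_levelSet_le hg hp1 hp2 Ng k)) _)
    have b2 := (hV.enorm_inner_synth_le_L1 hts hfl hgk).trans
      (mul_le_mul_right (mul_le_mul' (eLpNorm_one_indicator_levelSet_le hf hp1 l)
        (eLpNorm_one_indicator_levelSet_le hg hp1 k)) _)
    rcases min_choice ((2 : ℝ≥0∞) ^ ((1 - p / 2) * ((k + l : ℤ) : ℝ)))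
      (2 ^ ((1 - p / 2 + (p - 1)) * x) * 2 ^ (-((p - 1) * ((k + l : ℤ) : ℝ)))) with h | h
    · refine b1.trans ?_
      simp only [hκ, h]
      calc _ = 4 * C ^ 2 * ((2 ^ ((1 - p / 2) * k) * 2 ^ ((1 - p / 2) * l)) * (d k * c l)) := by
            ring
        _ = 4 * C ^ 2 * (2 ^ ((1 - p / 2) * ((k + l : ℤ) : ℝ)) * (d k * c l)) := by
            rw [two_rpow_mul]; push_cast; ring_nf
        _ ≤ _ := by gcongr; exact le_self_add
    · refine b2.trans ?_
      simp only [hκ, h]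
      calc _ = C * (ENNReal.ofReal (|t - s| ^ (-σ)) *
            (2 ^ (-((p - 1) * k)) * 2 ^ (-((p - 1) * l))) * (d k * c l)) := by ring
        _ = C * (2 ^ ((1 - p / 2 + (p - 1)) * x) * 2 ^ (-((p - 1) * ((k + l : ℤ) : ℝ))) *
            (d k * c l)) := by
            rw [two_rpow_mul, h2x, hx]
            congr 4
            · field_simp; ring
            · push_cast; ring
        _ ≤ _ := by gcongr; exact le_add_self
  have hsq : ∀ N : ℝ≥0∞, (N ^ 2) ^ (1 / 2 : ℝ) = N := fun N => by
    rw [← ENNReal.rpow_two, ← ENNReal.rpow_mul]; norm_num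
  calc ‖inner ℂ (synth ν V t g) (synth ν V s f)‖ₑ
      ≤ ∑' k, ∑' l, (4 * C ^ 2 + C) * (κ (k + l) * (d k * c l)) :=
        (enorm_inner_le_tsum (hV.hasSum_synth hg hgi hp1 hNg)
          (hV.hasSum_synth hf hfi hp1 hNf)).trans
          (ENNReal.tsum_le_tsum fun k => ENNReal.tsum_le_tsum fun l => term k l)
    _ = (4 * C ^ 2 + C) * ∑' k, ∑' l, κ (k + l) * (d k * c l) := by
        simp_rw [ENNReal.tsum_mul_left]
    _ ≤ (4 * C ^ 2 + C) * ((∑' n, κ n) *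
          ((∑' n, d n ^ 2) ^ (1 / 2 : ℝ) * (∑' n, c n ^ 2) ^ (1 / 2 : ℝ))) := by
        gcongr; exact tsum_conv_add_le
    _ ≤ (4 * C ^ 2 + C) * (K * 2 ^ ((1 - p / 2) * x) *
          ((Ng ^ 2) ^ (1 / 2 : ℝ) * (Nf ^ 2) ^ (1 / 2 : ℝ))) := by
        gcongr
        · exact hsum x
        · exact tsum_levelCoeff_sq_le hg hp1 hp2
        · exact tsum_levelCoeff_sq_le hf hp1 hp2
    _ = _ := by
        have e : (1 - p / 2) * x = Real.logb 2 |t - s| * (-(2 * θ)) := by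
          have : 1 / p = 1 / 2 + θ / σ := by rw [hp, inputExponent]; simp
          have h3 : (1 - p / 2) * x = -(2 * σ * (1 / p - 1 / 2)) * Real.logb 2 |t - s| := by
            rw [hx]; field_simp
          rw [h3, this]; field_simp; ring
        rw [hsq, hsq, h2x, e]
        ring

end Family

section SpaceTime

variable {X : Type*} [MeasurableSpace X] {H : Type*} [NormedAddCommGroup H]
  [InnerProductSpace ℂ H]

/-- Measurable functions on space-time which are integrable, and integrable at every time. -/
structure SpaceTimeIntegrable (ν : Measure X) (F : ℝ × X → ℂ) : Prop where
  measurable : Measurable F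
  integrable : Integrable F (volume.prod ν)
  slice : ∀ t, Integrable (fun x => F (t, x)) ν

theorem SpaceTimeIntegrable.indicator {ν : Measure X} {F : ℝ × X → ℂ}
    (hF : SpaceTimeIntegrable ν F) {S : Set (ℝ × X)} (hS : MeasurableSet S) :
    SpaceTimeIntegrable ν (S.indicator F) where
  measurable := hF.measurable.indicator hS
  integrable := hF.integrable.indicator hS
  slice t :=
    (hF.slice t).indicator (measurable_prodMk_left hS : MeasurableSet (Prod.mk t ⁻¹' S))

/-- The superposition of the vectors `F z • V z` over the times in `J`. -/
def timeSynth (ν : Measure X) (V : ℝ × X → H) (J : Set ℝ) (F : ℝ × X → ℂ) : H :=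
  ∫ w in Prod.fst ⁻¹' J, F w • V w ∂(volume.prod ν)

/-- The times `s` related to `t` by `R`. -/
def timeSlice (R : Set (ℝ × ℝ)) (t : ℝ) : Set ℝ := {s | (s, t) ∈ R}

theorem measurableSet_timeSlice {R : Set (ℝ × ℝ)} (hR : MeasurableSet R) (t : ℝ) :
    MeasurableSet (timeSlice R t) := measurable_prodMk_right hR

/-- The Duhamel-type operator integrating over the times related by `R`. -/
def retarded (ν : Measure X) (V : ℝ × X → H) (R : Set (ℝ × ℝ)) (F : ℝ × X → ℂ) (z : ℝ × X) : ℂ :=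
  inner ℂ (V z) (timeSynth ν V (timeSlice R z.1) F)

/-- The integrand of `retardedForm`. -/
def retardedKernel (V : ℝ × X → H) (R : Set (ℝ × ℝ)) (F G : ℝ × X → ℂ)
    (p : (ℝ × X) × (ℝ × X)) : ℂ :=
  R.indicator 1 (p.2.1, p.1.1) *
    (starRingEnd ℂ (G p.1) * F p.2 * inner ℂ (V p.1) (V p.2))

/-- The sesquilinear form of the operator `retarded`. -/
def retardedForm (ν : Measure X) (V : ℝ × X → H) (R : Set (ℝ × ℝ)) (F G : ℝ × X → ℂ) : ℂ :=
  ∫ p, retardedKernel V R F G p ∂((volume.prod ν).prod (volume.prod ν))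

theorem stronglyMeasurable_indicator_times {R : Set (ℝ × ℝ)} (hR : MeasurableSet R) :
    StronglyMeasurable fun p : (ℝ × X) × (ℝ × X) => (R.indicator 1 (p.2.1, p.1.1) : ℂ) :=
  ((measurable_one.indicator hR).comp (g := (R.indicator (1 : ℝ × ℝ → ℂ)))
    (f := fun p : (ℝ × X) × (ℝ × X) => (p.2.1, p.1.1)) (by fun_prop)).stronglyMeasurable

variable {ν : Measure X} [SigmaFinite ν] {V : ℝ × X → H} {σ : ℝ} {C : ℝ≥0∞} {F G : ℝ × X → ℂ}
  {R : Set (ℝ × ℝ)} {J : Set ℝ}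

omit [MeasurableSpace X] in
theorem norm_retardedKernel_le {M : ℝ} (hM : ∀ z, ‖V z‖ ≤ M) (p : (ℝ × X) × (ℝ × X)) :
    ‖retardedKernel V R F G p‖ ≤ M ^ 2 * (‖G p.1‖ * ‖F p.2‖) := by
  have h0 : 0 ≤ M := (norm_nonneg _).trans (hM p.1)
  have h1 : ‖inner ℂ (V p.1) (V p.2)‖ ≤ M ^ 2 := (norm_inner_le_norm _ _).trans
    ((mul_le_mul (hM _) (hM _) (norm_nonneg _) h0).trans_eq (by ring))
  have h2 : ‖(R.indicator 1 (p.2.1, p.1.1) : ℂ)‖ ≤ 1 := by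
    by_cases h : (p.2.1, p.1.1) ∈ R <;> simp [h]
  rw [retardedKernel, norm_mul, norm_mul, norm_mul, RCLike.norm_conj]
  calc _ ≤ 1 * (‖G p.1‖ * ‖F p.2‖ * M ^ 2) := by gcongr
    _ = _ := by ring

theorem enorm_retardedForm_comm (R : Set (ℝ × ℝ)) (F G : ℝ × X → ℂ) :
    ‖retardedForm ν V R F G‖ₑ = ‖retardedForm ν V (Prod.swap ⁻¹' R) G F‖ₑ := by
  rw [retardedForm, ← integral_prod_swap, retardedForm,
    ← (RCLike.enorm_conj (∫ p, retardedKernel V (Prod.swap ⁻¹' R) G F p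
      ∂((volume.prod ν).prod (volume.prod ν)))), ← integral_conj]
  congr 2 with p
  simp only [retardedKernel, Prod.fst_swap, Prod.snd_swap, map_mul, inner_conj_symm,
    Complex.conj_conj]
  by_cases h : (p.1.1, p.2.1) ∈ R <;> simp [Set.indicator, h, mul_comm]

namespace DispersiveFamily

variable (hV : DispersiveFamily σ C ν V)
include hV

omit [SigmaFinite ν] in
theorem integrable_smul_spaceTime (hF : SpaceTimeIntegrable ν F) :
    Integrable (fun w => F w • V w) (volume.prod ν) := by
  obtain ⟨M, hM⟩ := hV.bounded
  refine (hF.integrable.norm.mul_const M).mono' (hF.integrable.aestronglyMeasurable.smul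
    hV.stronglyMeasurable.aestronglyMeasurable) (ae_of_all _ fun x => ?_)
  rw [norm_smul]
  gcongr
  exact hM _

theorem timeSynth_eq (hF : SpaceTimeIntegrable ν F) (J : Set ℝ) :
    timeSynth ν V J F = ∫ s in J, synth ν V s fun x => F (s, x) := by
  have e : (Prod.fst ⁻¹' J : Set (ℝ × X)) = J ×ˢ Set.univ := by ext; simp
  rw [timeSynth, e, setIntegral_prod _ (hV.integrable_smul_spaceTime hF).integrableOn]
  simp [synth]

omit [SigmaFinite ν] in
theorem stronglyMeasurable_retardedKernel (hF : SpaceTimeIntegrable ν F)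
    (hG : SpaceTimeIntegrable ν G) (hR : MeasurableSet R) :
    StronglyMeasurable (retardedKernel V R F G) := by
  refine (stronglyMeasurable_indicator_times hR).mul (((?_ : StronglyMeasurable _).mul ?_).mul ?_)
  · exact (continuous_conj.measurable.comp (hG.measurable.comp measurable_fst)).stronglyMeasurable
  · exact (hF.measurable.comp measurable_snd).stronglyMeasurable
  · exact (hV.stronglyMeasurable.comp_measurable measurable_fst).inner
      (hV.stronglyMeasurable.comp_measurable measurable_snd)

omit [SigmaFinite ν] in
theorem integrable_retardedKernel (hF : SpaceTimeIntegrable ν F)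
    (hG : SpaceTimeIntegrable ν G) (hR : MeasurableSet R) :
    Integrable (retardedKernel V R F G) ((volume.prod ν).prod (volume.prod ν)) := by
  obtain ⟨M, hM⟩ := hV.bounded
  exact ((hG.integrable.norm.mul_prod hF.integrable.norm).const_mul (M ^ 2)).mono'
    (hV.stronglyMeasurable_retardedKernel hF hG hR).aestronglyMeasurable
    (ae_of_all _ fun p => norm_retardedKernel_le hM p)

variable [CompleteSpace H]

omit [SigmaFinite ν] in
theorem retarded_eq_integral (hF : SpaceTimeIntegrable ν F) (hR : MeasurableSet R) (z : ℝ × X) :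
    retarded ν V R F z = ∫ w, R.indicator 1 (w.1, z.1) * (F w * inner ℂ (V z) (V w))
      ∂(volume.prod ν) := by
  rw [retarded, timeSynth,
    ← integral_inner (hV.integrable_smul_spaceTime hF).integrableOn,
    ← integral_indicator (measurable_fst (measurableSet_timeSlice hR z.1))]
  refine integral_congr_ae (ae_of_all _ fun w => ?_)
  by_cases h : (w.1, z.1) ∈ R <;> simp [timeSlice, Set.indicator, h, inner_smul_right]

theorem stronglyMeasurable_retarded (hF : SpaceTimeIntegrable ν F) (hR : MeasurableSet R) :
    StronglyMeasurable (retarded ν V R F) := by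
  have e : retarded ν V R F = fun z => ∫ w, R.indicator 1 (w.1, z.1) *
      (F w * inner ℂ (V z) (V w)) ∂(volume.prod ν) := funext (hV.retarded_eq_integral hF hR)
  rw [e]
  refine StronglyMeasurable.integral_prod_right' (f := fun p : (ℝ × X) × (ℝ × X) =>
    (R.indicator 1 (p.2.1, p.1.1) : ℂ) * (F p.2 * inner ℂ (V p.1) (V p.2))) ?_
  have h := (stronglyMeasurable_indicator_times (X := X) hR).mul
    ((hF.measurable.comp measurable_snd).stronglyMeasurable.mul
      ((hV.stronglyMeasurable.comp_measurable (g := Prod.fst) measurable_fst).inner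
        (hV.stronglyMeasurable.comp_measurable measurable_snd)))
  exact h

omit [SigmaFinite ν] [CompleteSpace H] in
theorem exists_norm_retarded_le (hF : SpaceTimeIntegrable ν F) :
    ∃ B : ℝ, ∀ R z, ‖retarded ν V R F z‖ ≤ B := by
  obtain ⟨M, hM⟩ := hV.bounded
  refine ⟨M * ∫ w, ‖F w • V w‖ ∂(volume.prod ν), fun R z => (norm_inner_le_norm _ _).trans ?_⟩
  have h0 : 0 ≤ M := (norm_nonneg _).trans (hM z)
  gcongr
  · exact hM z
  · exact (norm_integral_le_integral_norm _).trans (setIntegral_le_integral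
      (hV.integrable_smul_spaceTime hF).norm (ae_of_all _ fun _ => norm_nonneg _))

omit [SigmaFinite ν] in
theorem integral_retardedKernel (hF : SpaceTimeIntegrable ν F) (hR : MeasurableSet R)
    (z : ℝ × X) :
    ∫ w, retardedKernel V R F G (z, w) ∂(volume.prod ν) =
      starRingEnd ℂ (G z) * retarded ν V R F z := by
  rw [hV.retarded_eq_integral hF hR, ← integral_const_mul]
  refine integral_congr_ae (ae_of_all _ fun w => ?_)
  simp only [retardedKernel]
  ring

theorem retardedForm_eq_integral (hF : SpaceTimeIntegrable ν F)
    (hG : SpaceTimeIntegrable ν G) (hR : MeasurableSet R) :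
    retardedForm ν V R F G = ∫ z, starRingEnd ℂ (G z) * retarded ν V R F z ∂(volume.prod ν) := by
  rw [retardedForm, integral_prod _ (hV.integrable_retardedKernel hF hG hR)]
  simp_rw [hV.integral_retardedKernel hF hR]

theorem retardedForm_eq_integral_inner (hF : SpaceTimeIntegrable ν F)
    (hG : SpaceTimeIntegrable ν G) (hR : MeasurableSet R) :
    retardedForm ν V R F G =
      ∫ t, inner ℂ (synth ν V t fun x => G (t, x)) (timeSynth ν V (timeSlice R t) F) := by
  have hi := (hV.integrable_retardedKernel hF hG hR).integral_prod_left
  simp_rw [hV.integral_retardedKernel hF hR] at hi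
  rw [hV.retardedForm_eq_integral hF hG hR, integral_prod _ hi]
  refine integral_congr_ae (ae_of_all _ fun t => ?_)
  simp only [retarded]
  rw [synth, ← inner_conj_symm, ← integral_inner (hV.integrable_smul (hG.slice t)),
    ← integral_conj]
  simp [inner_smul_right]

theorem enorm_retardedForm_le (hF : SpaceTimeIntegrable ν F)
    (hG : SpaceTimeIntegrable ν G) (hR : MeasurableSet R) :
    ‖retardedForm ν V R F G‖ₑ ≤
      ∫⁻ t, ‖inner ℂ (synth ν V t fun x => G (t, x)) (timeSynth ν V (timeSlice R t) F)‖ₑ := by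
  rw [hV.retardedForm_eq_integral_inner hF hG hR]
  exact enorm_integral_le_lintegral_enorm _

theorem enorm_inner_timeSynth_le (hF : SpaceTimeIntegrable ν F) (a : H) (J : Set ℝ) :
    ‖inner ℂ a (timeSynth ν V J F)‖ₑ ≤
      ∫⁻ s in J, ‖inner ℂ a (synth ν V s fun x => F (s, x))‖ₑ := by
  rw [hV.timeSynth_eq hF]
  exact enorm_inner_integral_le _ _

theorem enorm_retardedForm_le_lintegral (hF : SpaceTimeIntegrable ν F)
    (hG : SpaceTimeIntegrable ν G) (hR : MeasurableSet R) :
    ‖retardedForm ν V R F G‖ₑ ≤ ∫⁻ t, ∫⁻ s in timeSlice R t,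
      ‖inner ℂ (synth ν V t fun x => G (t, x)) (synth ν V s fun x => F (s, x))‖ₑ :=
  (hV.enorm_retardedForm_le hF hG hR).trans
    (lintegral_mono fun _ => hV.enorm_inner_timeSynth_le hF _ _)

theorem enorm_timeSynth_sq_le (hF : SpaceTimeIntegrable ν F) (J : Set ℝ) :
    ‖timeSynth ν V J F‖ₑ ^ 2 ≤ ∫⁻ t in J, ∫⁻ s in J,
      ‖inner ℂ (synth ν V t fun x => F (t, x)) (synth ν V s fun x => F (s, x))‖ₑ := by
  rw [← enorm_inner_self]
  refine (hV.enorm_inner_timeSynth_le hF _ J).trans (lintegral_mono fun t => ?_)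
  dsimp only
  rw [enorm_inner_comm]
  exact hV.enorm_inner_timeSynth_le hF _ J

theorem retardedForm_prod_self (hF : SpaceTimeIntegrable ν F) (hJ : MeasurableSet J) :
    retardedForm ν V (J ×ˢ J) F F = inner ℂ (timeSynth ν V J F) (timeSynth ν V J F) := by
  rw [hV.retardedForm_eq_integral_inner hF hF (hJ.prod hJ)]
  have hA := hV.timeSynth_eq hF J
  set A := timeSynth ν V J F
  have hi := ((hV.integrable_smul_spaceTime hF).integral_prod_left).integrableOn (s := J)
  have h2 : inner ℂ A A = ∫ t in J, inner ℂ A (synth ν V t fun x => F (t, x)) := by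
    rw [integral_inner (by exact hi), ← hA]
  rw [← inner_conj_symm A A]
  rw [h2, ← integral_conj, ← integral_indicator hJ]
  refine integral_congr_ae (ae_of_all _ fun t => ?_)
  by_cases ht : t ∈ J
  · have : timeSlice (J ×ˢ J) t = J := by ext; simp [timeSlice, ht]
    simp [this, ht, A]
  · have : timeSlice (J ×ˢ J) t = ∅ := by ext; simp [timeSlice, ht]
    simp [this, ht, timeSynth]

omit [SigmaFinite ν] [CompleteSpace H] in
theorem enorm_retardedForm_le_tsum (hF : SpaceTimeIntegrable ν F)
    (hG : SpaceTimeIntegrable ν G) (hR : MeasurableSet R) {S T : ℤ → Set (ℝ × X)}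
    (hS : ∀ k, MeasurableSet (S k)) (hT : ∀ k, MeasurableSet (T k))
    (hSd : Pairwise (Function.onFun Disjoint S)) (hTd : Pairwise (Function.onFun Disjoint T))
    (hS0 : ∀ᵐ z ∂(volume.prod ν), F z ≠ 0 → z ∈ ⋃ k, S k)
    (hT0 : ∀ᵐ z ∂(volume.prod ν), G z ≠ 0 → z ∈ ⋃ k, T k) :
    ‖retardedForm ν V R F G‖ₑ ≤
      ∑' k, ∑' l, ‖retardedForm ν V R ((S k).indicator F) ((T l).indicator G)‖ₑ := by
  have key := hasSum_setIntegral_of_cover (ι := ℤ × ℤ)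
    (s := fun i => T i.2 ×ˢ S i.1) (hV.integrable_retardedKernel hF hG hR)
    (fun i => (hT i.2).prod (hS i.1)) ?_ ?_
  · rw [← ENNReal.tsum_prod (f := fun k l =>
      ‖retardedForm ν V R ((S k).indicator F) ((T l).indicator G)‖ₑ), retardedForm, ← key.tsum_eq]
    refine enorm_tsum_le_tsum_enorm.trans_eq (tsum_congr fun i => ?_)
    rw [retardedForm, ← integral_indicator ((hT i.2).prod (hS i.1))]
    congr 2 with p
    by_cases h1 : p.1 ∈ T i.2 <;> by_cases h2 : p.2 ∈ S i.1 <;>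
      simp [retardedKernel, Set.indicator, h1, h2]
  · intro i j hij
    by_cases h : i.1 = j.1
    · exact Set.disjoint_prod.2 (Or.inl (hTd fun h' => hij (Prod.ext h h')))
    · exact Set.disjoint_prod.2 (Or.inr (hSd h))
  · filter_upwards [Measure.quasiMeasurePreserving_fst.ae hT0,
      Measure.quasiMeasurePreserving_snd.ae hS0] with p h1 h2 hp
    have hG0 : G p.1 ≠ 0 := fun h => hp (by simp [retardedKernel, h])
    have hF0 : F p.2 ≠ 0 := fun h => hp (by simp [retardedKernel, h])
    obtain ⟨l, hl⟩ := Set.mem_iUnion.1 (h1 hG0)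
    obtain ⟨k, hk⟩ := Set.mem_iUnion.1 (h2 hF0)
    exact Set.mem_iUnion.2 ⟨(k, l), hl, hk⟩

end DispersiveFamily

end SpaceTime

section Diagonal

/-- The range of inverse time exponents `θ` in `σ`-admissible pairs. -/
structure AdmissibleTime (σ θ : ℝ) : Prop where
  nonneg : 0 ≤ θ
  le_half : θ ≤ 1 / 2
  le_rate : θ ≤ σ / 2
  endpoint : θ = 1 / 2 → 1 < σ

variable {X : Type*} [MeasurableSpace X]

/-- The mixed norm of the input space with inverse time exponent `1 - θ`. -/
def inputNorm (σ θ : ℝ) (ν : Measure X) (F : ℝ × X → ℂ) : ℝ≥0∞ :=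
  (∫⁻ t, eLpNorm (fun x => F (t, x)) (ENNReal.ofReal (inputExponent σ θ)) ν ^ (1 / (1 - θ))) ^
    (1 - θ)

variable {H : Type*} [NormedAddCommGroup H] [InnerProductSpace ℂ H]
  {ν : Measure X} [SigmaFinite ν] {V : ℝ × X → H} {σ θ : ℝ} {C : ℝ≥0∞} {F G : ℝ × X → ℂ}

theorem measurable_eLpNorm_slice (hF : Measurable F) {p : ℝ≥0∞} (hp0 : p ≠ 0) (hp : p ≠ ∞) :
    Measurable fun t => eLpNorm (fun x => F (t, x)) p ν := by
  simp_rw [eLpNorm_eq_lintegral_rpow_enorm_toReal hp0 hp]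
  exact (Measurable.lintegral_prod_right'
    (f := fun z : ℝ × X => ‖F z‖ₑ ^ p.toReal) (by fun_prop)).pow_const _

theorem inputExponent_pos (hσ : 0 < σ) (hθ : 0 ≤ θ) : 0 < inputExponent σ θ := by
  rw [inputExponent]; positivity

theorem ae_eLpNorm_slice_ne_top (hσ : 0 < σ) (h0 : 0 ≤ θ) (h1 : θ < 1) (hF : Measurable F)
    (hM : inputNorm σ θ ν F ≠ ∞) :
    ∀ᵐ t, eLpNorm (fun x => F (t, x)) (ENNReal.ofReal (inputExponent σ θ)) ν ≠ ∞ := by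
  have hm := measurable_eLpNorm_slice (ν := ν) hF
    (ENNReal.ofReal_pos.2 (inputExponent_pos hσ h0)).ne' ENNReal.ofReal_ne_top
  have h : ∫⁻ t, eLpNorm (fun x => F (t, x)) (ENNReal.ofReal (inputExponent σ θ)) ν ^
      (1 / (1 - θ)) ≠ ∞ := fun h => hM (by
    rw [inputNorm, h, ENNReal.top_rpow_of_pos (by linarith)])
  filter_upwards [ae_lt_top (hm.pow_const _) h] with t ht ht'
  rw [ht', ENNReal.top_rpow_of_pos (by simp; linarith)] at ht
  exact lt_irrefl _ ht

theorem sq_rpow_half (N : ℝ≥0∞) : (N ^ 2) ^ (1 / 2 : ℝ) = N := by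
  rw [← ENNReal.rpow_two, ← ENNReal.rpow_mul]; norm_num

theorem rpow_half_sq (N : ℝ≥0∞) : (N ^ (1 / 2 : ℝ)) ^ 2 = N := by
  rw [← ENNReal.rpow_two, ← ENNReal.rpow_mul]; norm_num

theorem enorm_retardedForm_le_of_zero [CompleteSpace H] (hV : DispersiveFamily σ C ν V)
    (hF : SpaceTimeIntegrable ν F) (hG : SpaceTimeIntegrable ν G) {R : Set (ℝ × ℝ)}
    (hR : MeasurableSet R) :
    ‖retardedForm ν V R F G‖ₑ ≤ C ^ 2 * (inputNorm σ 0 ν F * inputNorm σ 0 ν G) := by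
  have e : ENNReal.ofReal (inputExponent σ 0) = 2 := by simp [inputExponent]
  have hmF := measurable_eLpNorm_slice (ν := ν) hF.measurable two_ne_zero ENNReal.ofNat_ne_top
  have hmG := measurable_eLpNorm_slice (ν := ν) hG.measurable two_ne_zero ENNReal.ofNat_ne_top
  simp only [inputNorm, e, sub_zero, div_one, ENNReal.rpow_one]
  refine (hV.enorm_retardedForm_le_lintegral hF hG hR).trans ?_
  calc _ ≤ ∫⁻ t, ∫⁻ s, C ^ 2 * (eLpNorm (fun x => F (s, x)) 2 ν *
        eLpNorm (fun x => G (t, x)) 2 ν) := lintegral_mono fun t =>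
          (lintegral_mono fun s => hV.enorm_inner_synth_le_L2 (hF.slice s) (hG.slice t)).trans
            (setLIntegral_le_lintegral _ _)
    _ = _ := by
        simp_rw [lintegral_const_mul (C ^ 2) (hmF.mul_const _), lintegral_mul_const _ hmF]
        rw [lintegral_const_mul _ (by fun_prop), lintegral_const_mul _ hmG]

theorem exists_enorm_retardedForm_le_of_lt [CompleteSpace H] (hσ : 0 < σ) (hC : C ≠ ∞)
    (ν : Measure X) [SigmaFinite ν] (h0 : 0 < θ) (h1 : θ < 1 / 2) (h2 : θ ≤ σ / 2) :
    ∃ K : ℝ≥0∞, K ≠ ∞ ∧ ∀ V : ℝ × X → H, DispersiveFamily σ C ν V → ∀ F G : ℝ × X → ℂ,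
      SpaceTimeIntegrable ν F → SpaceTimeIntegrable ν G → inputNorm σ θ ν F ≠ ∞ →
      inputNorm σ θ ν G ≠ ∞ → ∀ R : Set (ℝ × ℝ), MeasurableSet R →
      ‖retardedForm ν V R F G‖ₑ ≤ K * (inputNorm σ θ ν F * inputNorm σ θ ν G) := by
  obtain ⟨K, hK, hdisp⟩ := exists_enorm_inner_synth_le (H := H) σ hσ hC ν h0 h2
  obtain ⟨L, hL, hHLS⟩ := exists_hardyLittlewoodSobolev h0 h1
  refine ⟨K * L, by finiteness, fun V hV F G hF hG hMF hMG R hR => ?_⟩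
  have hp0 := (ENNReal.ofReal_pos.2 (inputExponent_pos hσ h0.le)).ne'
  have hmF := measurable_eLpNorm_slice (ν := ν) hF.measurable hp0 ENNReal.ofReal_ne_top
  have hmG := measurable_eLpNorm_slice (ν := ν) hG.measurable hp0 ENNReal.ofReal_ne_top
  refine (hV.enorm_retardedForm_le_lintegral hF hG hR).trans ?_
  calc _ ≤ ∫⁻ t, ∫⁻ s, K * (ENNReal.ofReal (|t - s| ^ (-(2 * θ))) *
        (eLpNorm (fun x => F (s, x)) (ENNReal.ofReal (inputExponent σ θ)) ν *
          eLpNorm (fun x => G (t, x)) (ENNReal.ofReal (inputExponent σ θ)) ν)) := by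
        refine lintegral_mono_ae ?_
        filter_upwards [ae_eLpNorm_slice_ne_top hσ h0.le (by linarith) hG.measurable hMG]
          with t ht
        refine (setLIntegral_le_lintegral _ _).trans (lintegral_mono_ae ?_)
        filter_upwards [ae_eLpNorm_slice_ne_top hσ h0.le (by linarith) hF.measurable hMF,
          Measure.ae_ne volume t] with s hs hst
        rw [← mul_assoc]
        exact hdisp V hV _ _ t s hst.symm (hF.measurable.comp measurable_prodMk_left)
          (hG.measurable.comp measurable_prodMk_left) (hF.slice s) (hG.slice t) hs ht
    _ = K * ∫⁻ t, ∫⁻ s, ENNReal.ofReal (|t - s| ^ (-(2 * θ))) *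
        (eLpNorm (fun x => F (s, x)) (ENNReal.ofReal (inputExponent σ θ)) ν *
          eLpNorm (fun x => G (t, x)) (ENNReal.ofReal (inputExponent σ θ)) ν) := by
        simp_rw [lintegral_const_mul' K _ hK]
    _ ≤ _ := by
        rw [mul_assoc]
        gcongr
        exact hHLS _ _ hmF hmG

end Diagonal

section Endpoint

variable {X : Type*} [MeasurableSpace X] {H : Type*} [NormedAddCommGroup H]
  [InnerProductSpace ℂ H]

/-- A space-time function with the `L²` and `L¹` bounds of a piece of height `2 ^ k` of a function
in `L^p`, where `α = 1 - p / 2` and `β = p - 1`, and with size `c t` at time `t`. -/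
structure IsDyadicPiece (ν : Measure X) (α β : ℝ) (k : ℤ) (f : ℝ × X → ℂ) (c : ℝ → ℝ≥0∞) :
    Prop where
  integrable : SpaceTimeIntegrable ν f
  measurable : Measurable c
  two_le : ∀ t, eLpNorm (fun x => f (t, x)) 2 ν ≤ 2 * 2 ^ (α * k) * c t
  one_le : ∀ t, eLpNorm (fun x => f (t, x)) 1 ν ≤ 2 ^ (-(β * k)) * c t

variable {ν : Measure X} [SigmaFinite ν] {V : ℝ × X → H} {σ α β : ℝ} {C : ℝ≥0∞}
  {f g : ℝ × X → ℂ} {c d : ℝ → ℝ≥0∞} {k l : ℤ} {R : Set (ℝ × ℝ)} {J : Set ℝ}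

theorem two_rpow_eq_ofReal (y : ℝ) : (2 : ℝ≥0∞) ^ y = ENNReal.ofReal (2 ^ y) := by
  rw [← ENNReal.ofReal_rpow_of_pos (by norm_num)]; simp

/-- The constant of the truncated kernel estimate. -/
def kernelConst (σ : ℝ) (C : ℝ≥0∞) : ℝ≥0∞ := 8 * C ^ 2 + C * ENNReal.ofReal (2 / (σ - 1))

theorem lintegral_min_le (hσ : 1 < σ) (hαβ : β = α * (σ - 1)) (k : ℤ) :
    ∫⁻ τ : ℝ, min (4 * C ^ 2 * 2 ^ (2 * (α * k)))
      (C * ENNReal.ofReal (|τ| ^ (-σ)) * 2 ^ (-(2 * (β * k)))) ≤ kernelConst σ C := by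
  set ρ : ℝ := 2 ^ (-(2 * (α * k))) with hρ
  have hρ0 : 0 < ρ := by positivity
  have hms : MeasurableSet {τ : ℝ | |τ| < ρ} := measurableSet_lt (by fun_prop) (by fun_prop)
  rw [← lintegral_add_compl _ hms, kernelConst]
  refine add_le_add ?_ ?_
  · refine (setLIntegral_mono measurable_const fun τ _ => min_le_left _ _).trans ?_
    have : {τ : ℝ | |τ| < ρ} = Set.Ioo (-ρ) ρ := by ext; simp [abs_lt]
    rw [lintegral_const, Measure.restrict_apply_univ, this, Real.volume_Ioo,
      show ρ - -ρ = 2 * ρ by ring, ENNReal.ofReal_mul (by norm_num), hρ, ← two_rpow_eq_ofReal]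
    calc _ = (8 * C ^ 2) * (2 ^ (2 * (α * k)) * 2 ^ (-(2 * (α * k)))) := by
          rw [show ENNReal.ofReal 2 = 2 by simp]; ring
      _ = _ := by rw [two_rpow_mul]; simp
      _ ≤ _ := le_rfl
  · refine (setLIntegral_mono (by fun_prop) fun τ _ => min_le_right _ _).trans ?_
    have hc : {τ : ℝ | |τ| < ρ}ᶜ = {τ : ℝ | ρ ≤ |τ|} := by ext; simp
    rw [hc, lintegral_mul_const _ (by fun_prop), lintegral_const_mul _ (by fun_prop), mul_assoc]
    gcongr
    refine (mul_le_mul_left (lintegral_le_abs_rpow hσ hρ0) _).trans_eq ?_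
    rw [ENNReal.ofReal_mul (div_nonneg (by norm_num) (by linarith)), hρ,
      ← Real.rpow_mul (by norm_num), ← two_rpow_eq_ofReal, mul_assoc, two_rpow_mul, hαβ]
    ring_nf
    simp

namespace DispersiveFamily

variable [CompleteSpace H] (hV : DispersiveFamily σ C ν V)
include hV

omit [SigmaFinite ν] in
theorem enorm_inner_synth_le_min (hf : IsDyadicPiece ν α β k f c) {t s : ℝ} (hts : t ≠ s) :
    ‖inner ℂ (synth ν V t fun x => f (t, x)) (synth ν V s fun x => f (s, x))‖ₑ ≤
      min (4 * C ^ 2 * 2 ^ (2 * (α * k)))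
        (C * ENNReal.ofReal (|t - s| ^ (-σ)) * 2 ^ (-(2 * (β * k)))) * (c s * c t) := by
  have b1 := (hV.enorm_inner_synth_le_L2 (t := t) (s := s) (hf.integrable.slice s) (hf.integrable.slice t)).trans
    (mul_le_mul_right (mul_le_mul' (hf.two_le s) (hf.two_le t)) _)
  have b2 := (hV.enorm_inner_synth_le_L1 hts (hf.integrable.slice s)
    (hf.integrable.slice t)).trans (mul_le_mul_right (mul_le_mul' (hf.one_le s) (hf.one_le t)) _)
  rcases min_choice (4 * C ^ 2 * 2 ^ (2 * (α * k)))
    (C * ENNReal.ofReal (|t - s| ^ (-σ)) * 2 ^ (-(2 * (β * k)))) with h | h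
  · rw [h, two_mul (α * k), ← two_rpow_mul]
    refine b1.trans_eq ?_
    ring
  · rw [h, two_mul (β * k), neg_add, ← two_rpow_mul]
    refine b2.trans_eq ?_
    ring

theorem enorm_timeSynth_le_of_isDyadicPiece (hσ : 1 < σ) (hαβ : β = α * (σ - 1))
    (hf : IsDyadicPiece ν α β k f c) (hJ : MeasurableSet J) :
    ‖timeSynth ν V J f‖ₑ ≤
      kernelConst σ C ^ (1 / 2 : ℝ) * (∫⁻ s in J, c s ^ 2) ^ (1 / 2 : ℝ) := by
  have hc := hf.measurable
  rw [← ENNReal.mul_rpow_of_nonneg _ _ (by norm_num), ← sq_rpow_half ‖timeSynth ν V J f‖ₑ]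
  refine ENNReal.rpow_le_rpow ((hV.enorm_timeSynth_sq_le hf.integrable J).trans ?_) (by norm_num)
  have hcJ : ∫⁻ s, J.indicator c s ^ 2 = ∫⁻ s in J, c s ^ 2 := by
    rw [← lintegral_indicator hJ]
    refine lintegral_congr fun s => ?_
    by_cases h : s ∈ J <;> simp [h]
  set κ : ℝ → ℝ≥0∞ := fun τ => min (4 * C ^ 2 * 2 ^ (2 * (α * k)))
      (C * ENNReal.ofReal (|τ| ^ (-σ)) * 2 ^ (-(2 * (β * k)))) with hκ
  calc _ ≤ ∫⁻ t, ∫⁻ s, κ (t - s) * (J.indicator c s * J.indicator c t) := by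
        rw [← lintegral_indicator hJ]
        refine lintegral_mono fun t => ?_
        by_cases ht : t ∈ J
        · rw [Set.indicator_of_mem ht, ← lintegral_indicator hJ]
          refine lintegral_mono_ae ?_
          filter_upwards [Measure.ae_ne volume t] with s hs
          by_cases hs' : s ∈ J
          · simp only [Set.indicator_of_mem hs', Set.indicator_of_mem ht]
            exact hV.enorm_inner_synth_le_min hf hs.symm
          · simp [hs']
        · simp [ht]
    _ ≤ (∫⁻ τ, κ τ) * ((∫⁻ t, J.indicator c t ^ 2) ^ (1 / 2 : ℝ) *
          (∫⁻ t, J.indicator c t ^ 2) ^ (1 / 2 : ℝ)) :=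
        lintegral_conv_le _ (by fun_prop) (hc.indicator hJ) (hc.indicator hJ)
    _ ≤ _ := by
        rw [hcJ, ← sq, rpow_half_sq]
        gcongr
        exact lintegral_min_le hσ hαβ k

theorem enorm_retardedForm_near_le (hσ : 1 < σ) (hαβ : β = α * (σ - 1))
    (hf : IsDyadicPiece ν α β k f c) (hg : IsDyadicPiece ν α β l g d) (hR : MeasurableSet R)
    {ρ : ℝ} (hρ : ∀ p ∈ R, |p.2 - p.1| < ρ) :
    ‖retardedForm ν V R f g‖ₑ ≤
      C * 4 * kernelConst σ C ^ (1 / 2 : ℝ) * (2 ^ (α * l) * ENNReal.ofReal ρ ^ (1 / 2 : ℝ)) *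
        ((∫⁻ s, c s ^ 2) ^ (1 / 2 : ℝ) * (∫⁻ t, d t ^ 2) ^ (1 / 2 : ℝ)) := by
  have hc := hf.measurable
  have hd := hg.measurable
  set κ : ℝ → ℝ≥0∞ := {τ : ℝ | |τ| < ρ}.indicator 1 with hκ
  have hms : MeasurableSet {τ : ℝ | |τ| < ρ} := measurableSet_lt (by fun_prop) (by fun_prop)
  have hκm : Measurable κ := measurable_one.indicator hms
  have hm : Measurable fun t => ∫⁻ s, κ (t - s) * c s ^ 2 :=
    Measurable.lintegral_prod_right' (f := fun p : ℝ × ℝ => κ (p.1 - p.2) * c p.2 ^ 2)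
      (by fun_prop)
  have hslice : ∀ t, ∫⁻ s in timeSlice R t, c s ^ 2 ≤ ∫⁻ s, κ (t - s) * c s ^ 2 := fun t => by
    rw [← lintegral_indicator (measurableSet_timeSlice hR t)]
    refine lintegral_mono fun s => ?_
    by_cases h : s ∈ timeSlice R t
    · have : |t - s| < ρ := hρ _ h
      simp [h, hκ, this]
    · simp [h]
  have htot : ∫⁻ t, ∫⁻ s, κ (t - s) * c s ^ 2 ≤ 4 * ENNReal.ofReal ρ * ∫⁻ s, c s ^ 2 := by
    rw [lintegral_lintegral_swap (by fun_prop)]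
    have : ∀ s, ∫⁻ t, κ (t - s) * c s ^ 2 = 2 * ENNReal.ofReal ρ * c s ^ 2 := fun s => by
      rw [lintegral_mul_const _ (by fun_prop), lintegral_sub_right_eq_self, hκ,
        lintegral_indicator_one hms]
      have : {τ : ℝ | |τ| < ρ} = Set.Ioo (-ρ) ρ := by ext; simp [abs_lt]
      rw [this, Real.volume_Ioo, show ρ - -ρ = 2 * ρ by ring, ENNReal.ofReal_mul (by norm_num)]
      simp
    simp_rw [this]
    rw [lintegral_const_mul _ (by fun_prop)]
    gcongr
    norm_num
  calc _ ≤ ∫⁻ t, C * 2 * 2 ^ (α * l) * kernelConst σ C ^ (1 / 2 : ℝ) *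
        (d t * (∫⁻ s, κ (t - s) * c s ^ 2) ^ (1 / 2 : ℝ)) := by
        refine (hV.enorm_retardedForm_le hf.integrable hg.integrable hR).trans
          (lintegral_mono fun t => (enorm_inner_le _ _).trans ?_)
        calc _ ≤ (C * (2 * 2 ^ (α * l) * d t)) * (kernelConst σ C ^ (1 / 2 : ℝ) *
              (∫⁻ s, κ (t - s) * c s ^ 2) ^ (1 / 2 : ℝ)) := by
              refine mul_le_mul' ((hV.energy t _ (hg.integrable.slice t)).trans
                (mul_le_mul_right (hg.two_le t) _))
                ((hV.enorm_timeSynth_le_of_isDyadicPiece hσ hαβ hf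
                  (measurableSet_timeSlice hR t)).trans ?_)
              exact mul_le_mul_right (ENNReal.rpow_le_rpow (hslice t) (by norm_num)) _
          _ = _ := by ring
    _ ≤ C * 2 * 2 ^ (α * l) * kernelConst σ C ^ (1 / 2 : ℝ) * ((∫⁻ t, d t ^ 2) ^ (1 / 2 : ℝ) *
          (4 * ENNReal.ofReal ρ * ∫⁻ s, c s ^ 2) ^ (1 / 2 : ℝ)) := by
        rw [lintegral_const_mul _ (by exact hd.mul (hm.pow_const _))]
        gcongr
        refine (lintegral_mul_le_L2_mul_L2 _ hd.aemeasurable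
          (hm.pow_const _).aemeasurable).trans ?_
        simp_rw [rpow_half_sq]
        gcongr
    _ = _ := by
        rw [ENNReal.mul_rpow_of_nonneg _ _ (by norm_num),
          ENNReal.mul_rpow_of_nonneg _ _ (by norm_num),
          show (4 : ℝ≥0∞) = 2 ^ 2 by norm_num, sq_rpow_half]
        ring

theorem enorm_retardedForm_far_le (hσ : 1 < σ) (hf : IsDyadicPiece ν α β k f c)
    (hg : IsDyadicPiece ν α β l g d) (hR : MeasurableSet R)
    {ρ : ℝ} (hρ0 : 0 < ρ) (hρ : ∀ p ∈ R, ρ ≤ |p.2 - p.1|) :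
    ‖retardedForm ν V R f g‖ₑ ≤
      C * ENNReal.ofReal (2 / (σ - 1)) * (ENNReal.ofReal (ρ ^ (1 - σ)) *
        (2 ^ (-(β * k)) * 2 ^ (-(β * l)))) *
        ((∫⁻ s, c s ^ 2) ^ (1 / 2 : ℝ) * (∫⁻ t, d t ^ 2) ^ (1 / 2 : ℝ)) := by
  have hms : MeasurableSet {τ : ℝ | ρ ≤ |τ|} := measurableSet_le (by fun_prop) (by fun_prop)
  set κ : ℝ → ℝ≥0∞ := {τ : ℝ | ρ ≤ |τ|}.indicator fun τ =>
    C * (2 ^ (-(β * k)) * 2 ^ (-(β * l))) * ENNReal.ofReal (|τ| ^ (-σ)) with hκ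
  have hκm : Measurable κ := Measurable.indicator (by fun_prop) hms
  calc _ ≤ ∫⁻ t, ∫⁻ s, κ (t - s) * (c s * d t) := by
        refine (hV.enorm_retardedForm_le_lintegral hf.integrable hg.integrable hR).trans
          (lintegral_mono fun t => ?_)
        dsimp only
        rw [← lintegral_indicator (measurableSet_timeSlice hR t)]
        refine lintegral_mono fun s => ?_
        by_cases h : s ∈ timeSlice R t
        · have h1 : ρ ≤ |t - s| := hρ _ h
          have hts : t ≠ s := fun h' => by simp [h'] at h1; linarith
          rw [Set.indicator_of_mem h, hκ, Set.indicator_of_mem (by exact h1)]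
          refine (hV.enorm_inner_synth_le_L1 hts (hf.integrable.slice s)
            (hg.integrable.slice t)).trans
            ((mul_le_mul_right (mul_le_mul' (hf.one_le s) (hg.one_le t)) _).trans_eq (by ring))
        · simp [h]
    _ ≤ (∫⁻ τ, κ τ) * ((∫⁻ s, c s ^ 2) ^ (1 / 2 : ℝ) * (∫⁻ t, d t ^ 2) ^ (1 / 2 : ℝ)) :=
        lintegral_conv_le _ hκm hf.measurable hg.measurable
    _ ≤ _ := by
        gcongr
        rw [hκ, lintegral_indicator hms, lintegral_const_mul _ (by fun_prop)]
        refine (mul_le_mul_right (lintegral_le_abs_rpow hσ hρ0) _).trans_eq ?_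
        rw [ENNReal.ofReal_mul (div_nonneg (by norm_num) (by linarith))]
        ring

omit [CompleteSpace H] [SigmaFinite ν] in
theorem enorm_retardedForm_le_inter_add {F G : ℝ × X → ℂ} (hF : SpaceTimeIntegrable ν F)
    (hG : SpaceTimeIntegrable ν G) (hR : MeasurableSet R) {S : Set (ℝ × ℝ)}
    (hS : MeasurableSet S) :
    ‖retardedForm ν V R F G‖ₑ ≤
      ‖retardedForm ν V (R ∩ S) F G‖ₑ + ‖retardedForm ν V (R ∩ Sᶜ) F G‖ₑ := by
  have e : retardedForm ν V R F G =
      retardedForm ν V (R ∩ S) F G + retardedForm ν V (R ∩ Sᶜ) F G := by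
    rw [retardedForm, retardedForm, retardedForm,
      ← integral_add (hV.integrable_retardedKernel hF hG (hR.inter hS))
        (hV.integrable_retardedKernel hF hG (hR.inter hS.compl))]
    congr 1 with p
    by_cases h1 : (p.2.1, p.1.1) ∈ R <;> by_cases h2 : (p.2.1, p.1.1) ∈ S <;>
      simp [retardedKernel, Set.indicator, h1, h2]
  rw [e]
  exact enorm_add_le _ _

theorem enorm_retardedForm_piece_le_of_le (hσ : 1 < σ) (hαβ : β = α * (σ - 1))
    (hf : IsDyadicPiece ν α β k f c) (hg : IsDyadicPiece ν α β l g d) (hR : MeasurableSet R)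
    (hlk : l ≤ k) :
    ‖retardedForm ν V R f g‖ₑ ≤
      (C * 4 * kernelConst σ C ^ (1 / 2 : ℝ) + C * ENNReal.ofReal (2 / (σ - 1))) *
        2 ^ (-(min (α / 4) (β / 2) * |((k - l : ℤ) : ℝ)|)) *
        ((∫⁻ s, c s ^ 2) ^ (1 / 2 : ℝ) * (∫⁻ t, d t ^ 2) ^ (1 / 2 : ℝ)) := by
  set η := min (α / 4) (β / 2) with hη
  set D : ℝ := ((k - l : ℤ) : ℝ) with hD
  have hD0 : 0 ≤ D := by rw [hD]; exact_mod_cast sub_nonneg.2 hlk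
  have hk : (k : ℝ) = l + D := by rw [hD]; push_cast; ring
  set ρ : ℝ := 2 ^ (-(2 * (α * l)) - α * D / 2) with hρ
  have hρ0 : 0 < ρ := by positivity
  set S : Set (ℝ × ℝ) := {p | |p.2 - p.1| < ρ}
  have hS : MeasurableSet S := measurableSet_lt (by fun_prop) (by fun_prop)
  have h1 : (2 : ℝ≥0∞) ^ (α * l) * ENNReal.ofReal ρ ^ (1 / 2 : ℝ) ≤ 2 ^ (-(η * |D|)) := by
    rw [hρ, ← two_rpow_eq_ofReal, ← ENNReal.rpow_mul, two_rpow_mul, abs_of_nonneg hD0]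
    refine ENNReal.rpow_le_rpow_of_exponent_le (by norm_num) ?_
    have := mul_le_mul_of_nonneg_right (min_le_left (α / 4) (β / 2)) hD0
    rw [← hη] at this
    linarith
  have h2 : ENNReal.ofReal (ρ ^ (1 - σ)) * (2 ^ (-(β * k)) * 2 ^ (-(β * l))) ≤
      (2 : ℝ≥0∞) ^ (-(η * |D|)) := by
    rw [hρ, ← Real.rpow_mul (by norm_num), ← two_rpow_eq_ofReal, two_rpow_mul, two_rpow_mul,
      abs_of_nonneg hD0, hk]
    refine ENNReal.rpow_le_rpow_of_exponent_le (by norm_num) ?_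
    have := mul_le_mul_of_nonneg_right (min_le_right (α / 4) (β / 2)) hD0
    rw [← hη] at this
    have e : (-(2 * (α * l)) - α * D / 2) * (1 - σ) + (-(β * (l + D)) + -(β * l)) =
        -(β / 2 * D) := by rw [hαβ]; ring
    rw [e]
    linarith
  refine (hV.enorm_retardedForm_le_inter_add hf.integrable hg.integrable hR hS).trans ?_
  rw [add_mul, add_mul]
  refine add_le_add ((hV.enorm_retardedForm_near_le hσ hαβ hf hg (hR.inter hS)
    fun p hp => hp.2).trans ?_) ((hV.enorm_retardedForm_far_le hσ hf hg (hR.inter hS.compl) hρ0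
    fun p hp => not_lt.1 hp.2).trans ?_)
  · gcongr
  · gcongr

theorem enorm_retardedForm_piece_le (hσ : 1 < σ) (hαβ : β = α * (σ - 1))
    (hf : IsDyadicPiece ν α β k f c) (hg : IsDyadicPiece ν α β l g d) (hR : MeasurableSet R) :
    ‖retardedForm ν V R f g‖ₑ ≤
      (C * 4 * kernelConst σ C ^ (1 / 2 : ℝ) + C * ENNReal.ofReal (2 / (σ - 1))) *
        2 ^ (-(min (α / 4) (β / 2) * |((k - l : ℤ) : ℝ)|)) *
        ((∫⁻ s, c s ^ 2) ^ (1 / 2 : ℝ) * (∫⁻ t, d t ^ 2) ^ (1 / 2 : ℝ)) := by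
  rcases le_total l k with h | h
  · exact hV.enorm_retardedForm_piece_le_of_le hσ hαβ hf hg hR h
  · rw [enorm_retardedForm_comm]
    refine (hV.enorm_retardedForm_piece_le_of_le hσ hαβ hg hf (measurable_swap hR) h).trans_eq ?_
    have : |((l - k : ℤ) : ℝ)| = |((k - l : ℤ) : ℝ)| := by push_cast; exact abs_sub_comm _ _
    rw [this, mul_comm ((∫⁻ s, d s ^ 2) ^ (1 / 2 : ℝ))]

end DispersiveFamily

theorem slice_indicator {Y Z M : Type*} [Zero M] (S : Set (Y × Z)) (f : Y × Z → M) (y : Y) :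
    (fun z => S.indicator f (y, z)) = (Prod.mk y ⁻¹' S).indicator fun z => f (y, z) :=
  funext fun _ => (Set.indicator_comp_right (Prod.mk y)).symm

theorem isDyadicPiece_indicator_of_slice {F : ℝ × X → ℂ} (hF : SpaceTimeIntegrable ν F) {p : ℝ}
    (hp1 : 1 < p) (hp2 : p < 2) (k : ℤ) {S : Set (ℝ × X)} (hS : MeasurableSet S)
    (hSt : ∀ t, Prod.mk t ⁻¹' S =
      levelSet (eLpNorm (fun x => F (t, x)) (ENNReal.ofReal p) ν) (fun x => F (t, x)) k) :
    IsDyadicPiece ν (1 - p / 2) (p - 1) k (S.indicator F)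
      (fun t => levelCoeff p (eLpNorm (fun x => F (t, x)) (ENNReal.ofReal p) ν) ν
        (fun x => F (t, x)) k) := by
  have hN := measurable_eLpNorm_slice (ν := ν) hF.measurable
    (ENNReal.ofReal_pos.2 (by linarith : 0 < p)).ne' ENNReal.ofReal_ne_top
  have hFe := hF.measurable.enorm
  have hFt : ∀ t, Measurable fun x => F (t, x) := fun t =>
    hF.measurable.comp measurable_prodMk_left
  refine ⟨hF.indicator hS, ?_, fun t => ?_, fun t => ?_⟩
  · have h := (Measurable.lintegral_prod_right' (ν := ν) ((hFe.pow_const p).indicator hS)).pow_const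
      (1 / 2 : ℝ)
    simp_rw [slice_indicator, hSt] at h
    exact (hN.pow_const _).mul h
  · rw [slice_indicator, hSt]
    exact eLpNorm_two_indicator_levelSet_le (hFt t) hp1 hp2 _ k
  · rw [slice_indicator, hSt]
    exact eLpNorm_one_indicator_levelSet_le (hFt t) hp1 k

theorem isDyadicPiece_indicator {F : ℝ × X → ℂ} (hF : SpaceTimeIntegrable ν F) {p : ℝ}
    (hp1 : 1 < p) (hp2 : p < 2) (k : ℤ) :
    IsDyadicPiece ν (1 - p / 2) (p - 1) k
      ({z : ℝ × X | 2 ^ (k : ℝ) * eLpNorm (fun x => F (z.1, x)) (ENNReal.ofReal p) ν ≤ ‖F z‖ₑ ∧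
        ‖F z‖ₑ < 2 ^ ((k : ℝ) + 1) * eLpNorm (fun x => F (z.1, x)) (ENNReal.ofReal p) ν}.indicator
          F)
      (fun t => levelCoeff p (eLpNorm (fun x => F (t, x)) (ENNReal.ofReal p) ν) ν
        (fun x => F (t, x)) k) := by
  have hN := measurable_eLpNorm_slice (ν := ν) hF.measurable
    (ENNReal.ofReal_pos.2 (by linarith : 0 < p)).ne' ENNReal.ofReal_ne_top
  have hFe := hF.measurable.enorm
  exact isDyadicPiece_indicator_of_slice hF hp1 hp2 k
    ((measurableSet_le ((hN.comp measurable_fst).const_mul _) hFe).inter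
      (measurableSet_lt hFe ((hN.comp measurable_fst).const_mul _))) fun t => rfl

/-- The diagonal endpoint estimate, with arbitrary truncation in time. -/
theorem exists_enorm_retardedForm_le_of_half [CompleteSpace H] (hσ : 1 < σ) (hC : C ≠ ∞)
    (ν : Measure X) [SigmaFinite ν] :
    ∃ K : ℝ≥0∞, K ≠ ∞ ∧ ∀ V : ℝ × X → H, DispersiveFamily σ C ν V → ∀ F G : ℝ × X → ℂ,
      SpaceTimeIntegrable ν F → SpaceTimeIntegrable ν G → inputNorm σ (1 / 2) ν F ≠ ∞ →
      inputNorm σ (1 / 2) ν G ≠ ∞ → ∀ R : Set (ℝ × ℝ), MeasurableSet R →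
      ‖retardedForm ν V R F G‖ₑ ≤ K * (inputNorm σ (1 / 2) ν F * inputNorm σ (1 / 2) ν G) := by
  set p := inputExponent σ (1 / 2) with hp
  have hpe : p = 2 * σ / (σ + 1) := by rw [hp, inputExponent]; field_simp
  have hp1 : 1 < p := by rw [hpe, lt_div_iff₀ (by linarith)]; linarith
  have hp2 : p < 2 := by rw [hpe, div_lt_iff₀ (by linarith)]; linarith
  have hα : 0 < 1 - p / 2 := by linarith
  have hαβ : p - 1 = (1 - p / 2) * (σ - 1) := by
    rw [hpe]; have : σ + 1 ≠ 0 := by linarith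
    field_simp; ring
  set η := min ((1 - p / 2) / 4) ((p - 1) / 2) with hη
  have hη0 : 0 < η := lt_min (by linarith) (by linarith)
  set P := C * 4 * kernelConst σ C ^ (1 / 2 : ℝ) + C * ENNReal.ofReal (2 / (σ - 1)) with hP
  have hPtop : P ≠ ∞ := by
    have : kernelConst σ C ≠ ∞ := by rw [kernelConst]; finiteness
    rw [hP]; finiteness
  set E := ∑' n : ℤ, (2 : ℝ≥0∞) ^ (-(η * |(n : ℝ)|)) with hE
  have hEtop : E ≠ ∞ := tsum_two_rpow_neg_abs_ne_top hη0
  refine ⟨P * E, by finiteness, fun V hV F G hF hG hMF hMG R hR => ?_⟩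
  set S : (ℝ × X → ℂ) → ℤ → Set (ℝ × X) := fun F k =>
    {z : ℝ × X | 2 ^ (k : ℝ) * eLpNorm (fun x => F (z.1, x)) (ENNReal.ofReal p) ν ≤ ‖F z‖ₑ ∧
      ‖F z‖ₑ < 2 ^ ((k : ℝ) + 1) * eLpNorm (fun x => F (z.1, x)) (ENNReal.ofReal p) ν} with hS
  set c : (ℝ × X → ℂ) → ℤ → ℝ → ℝ≥0∞ := fun F k t =>
    levelCoeff p (eLpNorm (fun x => F (t, x)) (ENNReal.ofReal p) ν) ν (fun x => F (t, x)) k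
  have hNm : ∀ {F : ℝ × X → ℂ}, SpaceTimeIntegrable ν F →
      Measurable fun t => eLpNorm (fun x => F (t, x)) (ENNReal.ofReal p) ν := fun hF =>
    measurable_eLpNorm_slice hF.measurable
      (ENNReal.ofReal_pos.2 (by linarith : 0 < p)).ne' ENNReal.ofReal_ne_top
  have hpiece : ∀ {F : ℝ × X → ℂ}, SpaceTimeIntegrable ν F → ∀ k,
      IsDyadicPiece ν (1 - p / 2) (p - 1) k ((S F k).indicator F) (c F k) :=
    fun hF k => isDyadicPiece_indicator hF hp1 hp2 k
  have hSm : ∀ {F : ℝ × X → ℂ}, SpaceTimeIntegrable ν F → ∀ k, MeasurableSet (S F k) :=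
    fun hF k => (measurableSet_le (((hNm hF).comp measurable_fst).const_mul _)
      hF.measurable.enorm).inter
      (measurableSet_lt hF.measurable.enorm (((hNm hF).comp measurable_fst).const_mul _))
  have hSd : ∀ F, Pairwise (Function.onFun Disjoint (S F)) := fun F =>
    pairwise_disjoint_of_dyadic (fun z : ℝ × X =>
      eLpNorm (fun x => F (z.1, x)) (ENNReal.ofReal p) ν) fun z => ‖F z‖ₑ
  have hcover : ∀ {F : ℝ × X → ℂ}, SpaceTimeIntegrable ν F → inputNorm σ (1 / 2) ν F ≠ ∞ →
      ∀ᵐ z ∂(volume.prod ν), F z ≠ 0 → z ∈ ⋃ k, S F k := fun {F} hF hM => by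
    refine (Measure.ae_prod_iff_ae_ae ?_).2 ?_
    · have e : {z : ℝ × X | F z ≠ 0 → z ∈ ⋃ k, S F k} = {z | F z = 0} ∪ ⋃ k, S F k := by
        ext z; simp [imp_iff_not_or]
      rw [e]
      exact (hF.measurable (measurableSet_singleton 0)).union
        (MeasurableSet.iUnion (hSm hF))
    · filter_upwards [ae_eLpNorm_slice_ne_top (by linarith) (by norm_num) (by norm_num)
        hF.measurable hM] with t ht
      have := ae_mem_iUnion_levelSet (hF.measurable.comp (measurable_prodMk_left (x := t))) hp1 ht
      filter_upwards [this] with x hx h0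
      obtain ⟨k, hk⟩ := Set.mem_iUnion.1 (hx h0)
      exact Set.mem_iUnion.2 ⟨k, hk⟩
  have hsum : ∀ {F : ℝ × X → ℂ}, SpaceTimeIntegrable ν F →
      (∑' k, ((∫⁻ t, c F k t ^ 2) ^ (1 / 2 : ℝ)) ^ 2) ^ (1 / 2 : ℝ) ≤
        inputNorm σ (1 / 2) ν F := fun {F} hF => by
    simp_rw [rpow_half_sq]
    rw [← lintegral_tsum fun k => ((hpiece hF k).measurable.pow_const 2).aemeasurable, inputNorm]
    have e1 : (1 : ℝ) - 1 / 2 = 1 / 2 := by norm_num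
    have e2 : (1 : ℝ) / (1 / 2) = 2 := by norm_num
    rw [e1, e2]
    gcongr with t
    rw [ENNReal.rpow_two]
    exact tsum_levelCoeff_sq_le (hF.measurable.comp measurable_prodMk_left) hp1 hp2
  calc ‖retardedForm ν V R F G‖ₑ
      ≤ ∑' k, ∑' l, ‖retardedForm ν V R ((S F k).indicator F) ((S G l).indicator G)‖ₑ :=
        hV.enorm_retardedForm_le_tsum hF hG hR (hSm hF) (hSm hG) (hSd F) (hSd G)
          (hcover hF hMF) (hcover hG hMG)
    _ ≤ ∑' k, ∑' l, P * (2 ^ (-(η * |((k - l : ℤ) : ℝ)|)) *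
          ((∫⁻ s, c F k s ^ 2) ^ (1 / 2 : ℝ) * (∫⁻ t, c G l t ^ 2) ^ (1 / 2 : ℝ))) := by
        gcongr with k l
        rw [← mul_assoc]
        exact hV.enorm_retardedForm_piece_le hσ hαβ (hpiece hF k) (hpiece hG l) hR
    _ = P * ∑' k, ∑' l, 2 ^ (-(η * |((k - l : ℤ) : ℝ)|)) *
          ((∫⁻ s, c F k s ^ 2) ^ (1 / 2 : ℝ) * (∫⁻ t, c G l t ^ 2) ^ (1 / 2 : ℝ)) := by
        simp_rw [ENNReal.tsum_mul_left]
    _ ≤ P * (E * (inputNorm σ (1 / 2) ν F * inputNorm σ (1 / 2) ν G)) := by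
        gcongr
        refine (tsum_conv_le (K := fun n : ℤ => 2 ^ (-(η * |(n : ℝ)|)))).trans ?_
        gcongr
        · exact hsum hF
        · exact hsum hG
    _ = _ := by ring

end Endpoint

/-- The diagonal estimates. -/
theorem exists_enorm_retardedForm_le {X : Type*} [MeasurableSpace X] {H : Type*}
    [NormedAddCommGroup H] [InnerProductSpace ℂ H] [CompleteSpace H] {σ θ : ℝ} (hσ : 0 < σ)
    {C : ℝ≥0∞} (hC : C ≠ ∞) (ν : Measure X) [SigmaFinite ν] (hθ : AdmissibleTime σ θ) :
    ∃ K : ℝ≥0∞, K ≠ ∞ ∧ ∀ V : ℝ × X → H, DispersiveFamily σ C ν V → ∀ F G : ℝ × X → ℂ,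
      SpaceTimeIntegrable ν F → SpaceTimeIntegrable ν G → inputNorm σ θ ν F ≠ ∞ →
      inputNorm σ θ ν G ≠ ∞ → ∀ R : Set (ℝ × ℝ), MeasurableSet R →
      ‖retardedForm ν V R F G‖ₑ ≤ K * (inputNorm σ θ ν F * inputNorm σ θ ν G) := by
  rcases hθ.le_half.eq_or_lt with rfl | h1
  · exact exists_enorm_retardedForm_le_of_half (hθ.endpoint rfl) hC ν
  rcases hθ.nonneg.eq_or_lt with rfl | h0
  · exact ⟨C ^ 2, by finiteness, fun V hV F G hF hG _ _ R hR =>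
      enorm_retardedForm_le_of_zero hV hF hG hR⟩
  · exact exists_enorm_retardedForm_le_of_lt hσ hC ν h0 h1 hθ.le_rate

section Duality

variable {X : Type*} [MeasurableSpace X] {ν : Measure X} [SigmaFinite ν] {v : ℝ × X → ℂ}

theorem measurable_eLpNorm_slice_top (hv : Measurable v) :
    Measurable fun t => eLpNorm (fun x => v (t, x)) ∞ ν := by
  refine measurable_of_Ioi fun a => ?_
  have : (fun t => eLpNorm (fun x => v (t, x)) ∞ ν) ⁻¹' Set.Ioi a =
      {t | 0 < ν (Prod.mk t ⁻¹' {z | a < ‖v z‖ₑ})} := by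
    ext t
    simp only [Set.mem_preimage, Set.mem_Ioi, eLpNorm_exponent_top, eLpNormEssSup, pos_iff_ne_zero,
      Set.mem_ofPred_eq]
    rw [← not_le, not_iff_not]
    constructor
    · intro h
      have := ae_le_eLpNormEssSup (f := fun x => v (t, x)) (μ := ν)
      refine measure_mono_null (fun x hx => ?_) (ae_iff.1 this)
      exact not_le.2 (h.trans_lt hx)
    · intro h
      refine essSup_le_of_ae_le a ?_
      rw [EventuallyLE, ae_iff]
      simpa using h
  rw [this]
  exact measurable_measure_prodMk_left (measurableSet_lt measurable_const hv.enorm)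
    measurableSet_Ioi

theorem measurable_eLpNorm_slice' (hv : Measurable v) {p : ℝ≥0∞} (hp : p ≠ 0) :
    Measurable fun t => eLpNorm (fun x => v (t, x)) p ν := by
  rcases eq_or_ne p ∞ with rfl | h
  · exact measurable_eLpNorm_slice_top hv
  · exact measurable_eLpNorm_slice hv hp h

theorem exists_norming_top (hv : Measurable v) {η : ℝ≥0∞} (hη : η < 1)
    (hN : ∀ t, eLpNorm (fun x => v (t, x)) ∞ ν ≠ ∞) {S : Set X} (hνS : ν S ≠ ∞)
    (hvS : ∀ t, ∀ x ∉ S, v (t, x) = 0) :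
    ∃ h : ℝ × X → NNReal, Measurable h ∧
      (∀ t, eLpNorm (fun x => ((h (t, x) : ℝ) : ℂ) * v (t, x)) 1 ν ≤ 1) ∧
      ∀ t, η * eLpNorm (fun x => v (t, x)) ∞ ν ≤ ∫⁻ x, h (t, x) * ‖v (t, x)‖ₑ ^ 2 ∂ν := by
  set N : ℝ → ℝ≥0∞ := fun t => eLpNorm (fun x => v (t, x)) ∞ ν with hNdef
  have hNm : Measurable N := measurable_eLpNorm_slice_top hv
  set S' : Set (ℝ × X) := {z | η * N z.1 < ‖v z‖ₑ} with hS'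
  have hS'm : MeasurableSet S' :=
    measurableSet_lt ((hNm.comp measurable_fst).const_mul _) hv.enorm
  set m : ℝ → ℝ≥0∞ := fun t => ν (Prod.mk t ⁻¹' S') with hm
  have hmm : Measurable m := measurable_measure_prodMk_left hS'm
  have hmtop : ∀ t, m t ≠ ∞ := fun t => by
    refine ne_top_of_le_ne_top hνS (measure_mono fun x hx => ?_)
    by_contra hxS
    have : η * N t < ‖v (t, x)‖ₑ := hx
    simp [hvS t x hxS] at this
  have hmpos : ∀ t, N t ≠ 0 → m t ≠ 0 := fun t ht h0 => by
    have h1 : N t ≤ η * N t := by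
      conv_lhs => rw [hNdef]
      simp only [eLpNorm_exponent_top, eLpNormEssSup]
      refine essSup_le_of_ae_le _ ?_
      rw [EventuallyLE, ae_iff]
      simpa [hm, hS'] using h0
    have := ENNReal.mul_lt_mul_left ht (hN t) hη
    rw [one_mul] at this
    exact absurd h1 (not_le.2 this)
  set h : ℝ × X → NNReal := S'.indicator fun z => ‖v z‖₊⁻¹ * (m z.1).toNNReal⁻¹ with hh
  have hvt : ∀ t, Measurable fun x => v (t, x) := fun t => hv.comp measurable_prodMk_left
  set c : ℝ → ℝ≥0∞ := fun t => ((m t).toNNReal⁻¹ : NNReal) with hc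
  have hcm : ∀ t, m t ≠ 0 → c t * m t = 1 := fun t h0 => by
    have h1 : (m t).toNNReal ≠ 0 := (ENNReal.toNNReal_pos h0 (hmtop t)).ne'
    conv_lhs => rw [← ENNReal.coe_toNNReal (hmtop t)]
    simp only [hc]
    rw [← ENNReal.coe_mul, inv_mul_cancel₀ h1, ENNReal.coe_one]
  have key : ∀ t x, (h (t, x) : ℝ≥0∞) * ‖v (t, x)‖ₑ =
      (Prod.mk t ⁻¹' S').indicator (fun _ => c t) x := fun t x => by
    by_cases hx : (t, x) ∈ S'
    · have hx0 : ‖v (t, x)‖₊ ≠ 0 := fun h0 => by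
        have : η * N t < ‖v (t, x)‖ₑ := hx
        simp [nnnorm_eq_zero.1 h0] at this
      rw [hh, Set.indicator_of_mem hx, Set.indicator_of_mem (by exact hx), enorm_eq_nnnorm,
        ← ENNReal.coe_mul, hc]
      congr 1
      field_simp
    · rw [hh, Set.indicator_of_notMem hx, Set.indicator_of_notMem (by exact hx)]
      simp
  have hSt : ∀ t, MeasurableSet (Prod.mk t ⁻¹' S') := fun t => measurable_prodMk_left hS'm
  refine ⟨h, ?_, fun t => ?_, fun t => ?_⟩
  · exact (hv.nnnorm.inv.mul (hmm.comp measurable_fst).ennreal_toNNReal.inv).indicator hS'm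
  · have e : ∀ x, ‖((h (t, x) : ℝ) : ℂ) * v (t, x)‖ₑ =
        (Prod.mk t ⁻¹' S').indicator (fun _ => c t) x := fun x => by
      rw [enorm_mul, ← key]; congr 1; simp [enorm_eq_nnnorm]
    rw [eLpNorm_one_eq_lintegral_enorm, lintegral_congr e, lintegral_indicator_const (hSt t)]
    rcases eq_or_ne (m t) 0 with h0 | h0
    · simp only [hm] at h0; simp [h0]
    · exact (hcm t h0).le
  · rcases eq_or_ne (N t) 0 with h0 | h0
    · simp only [hNdef] at h0; simp [h0]
    · calc η * N t = ∫⁻ x, (Prod.mk t ⁻¹' S').indicator (fun _ => c t * (η * N t)) x ∂ν := by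
            rw [lintegral_indicator_const (hSt t), mul_right_comm]
            change _ = c t * m t * _
            rw [hcm t (hmpos t h0), one_mul]
        _ ≤ _ := by
            refine lintegral_mono fun x => ?_
            rw [pow_two, ← mul_assoc (h (t, x) : ℝ≥0∞), key]
            by_cases hx : x ∈ Prod.mk t ⁻¹' S'
            · rw [Set.indicator_of_mem hx, Set.indicator_of_mem hx]
              gcongr
              exact hx.le
            · simp [Set.indicator_of_notMem hx]

/-- Joint norming functions for a family of functions with finite `L^r` norms, `2 ≤ r < ∞`. -/
theorem exists_norming_of_ne_top (hv : Measurable v) {r p : ℝ} (hr : 2 ≤ r)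
    (hp : p = r / (r - 1)) (hN : ∀ t, eLpNorm (fun x => v (t, x)) (ENNReal.ofReal r) ν ≠ ∞) :
    ∃ h : ℝ × X → NNReal, Measurable h ∧
      (∀ t, eLpNorm (fun x => ((h (t, x) : ℝ) : ℂ) * v (t, x)) (ENNReal.ofReal p) ν ≤ 1) ∧
      ∀ t, eLpNorm (fun x => v (t, x)) (ENNReal.ofReal r) ν ≤
        ∫⁻ x, h (t, x) * ‖v (t, x)‖ₑ ^ 2 ∂ν := by
  have hr0 : 0 < ENNReal.ofReal r := ENNReal.ofReal_pos.2 (by linarith)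
  have hr1 : 0 < r - 1 := by linarith
  have hp0 : 0 < p := by rw [hp]; positivity
  set N : ℝ → ℝ≥0∞ := fun t => eLpNorm (fun x => v (t, x)) (ENNReal.ofReal r) ν with hNdef
  have hNm : Measurable N := measurable_eLpNorm_slice hv hr0.ne' ENNReal.ofReal_ne_top
  have hNr : ∀ t, ∫⁻ x, ‖v (t, x)‖ₑ ^ r ∂ν = N t ^ r := fun t => by
    rw [hNdef]
    simp only
    rw [eLpNorm_eq_lintegral_rpow_enorm_toReal hr0.ne' ENNReal.ofReal_ne_top,
      ENNReal.toReal_ofReal (by linarith), ← ENNReal.rpow_mul, one_div,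
      inv_mul_cancel₀ (by linarith), ENNReal.rpow_one]
  set c : ℝ → ℝ≥0∞ := fun t => ((N t).toNNReal ^ (1 - r) : NNReal) with hc
  have hcN : ∀ t, N t ≠ 0 → c t = N t ^ (1 - r) := fun t h0 => by
    rw [hc]
    simp only
    rw [ENNReal.coe_rpow_of_ne_zero (ENNReal.toNNReal_pos h0 (hN t)).ne',
      ENNReal.coe_toNNReal (hN t)]
  have hc0 : ∀ t, N t = 0 → c t = 0 := fun t h0 => by
    simp only [hc, h0, ENNReal.toNNReal_zero]
    rw [NNReal.zero_rpow (by linarith), ENNReal.coe_zero]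
  set h : ℝ × X → NNReal := fun z => (N z.1).toNNReal ^ (1 - r) * ‖v z‖₊ ^ (r - 2) with hh
  have key : ∀ t x, (h (t, x) : ℝ≥0∞) = c t * ‖v (t, x)‖ₑ ^ (r - 2) := fun t x => by
    rw [hh]
    simp only
    rw [ENNReal.coe_mul, ENNReal.coe_rpow_of_nonneg ‖v (t, x)‖₊ (by linarith : 0 ≤ r - 2),
      enorm_eq_nnnorm]
  refine ⟨h, ?_, fun t => ?_, fun t => ?_⟩
  · exact ((hNm.comp measurable_fst).ennreal_toNNReal.pow_const _).mul (hv.nnnorm.pow_const _)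
  · have e : ∀ x, ‖((h (t, x) : ℝ) : ℂ) * v (t, x)‖ₑ ^ p = c t ^ p * ‖v (t, x)‖ₑ ^ r := fun x => by
      have : ‖((h (t, x) : ℝ) : ℂ)‖ₑ = h (t, x) := by simp [enorm_eq_nnnorm]
      rw [enorm_mul, this, key, mul_assoc]
      conv_lhs => rw [← ENNReal.rpow_one (x := ‖v (t, x)‖ₑ), ← ENNReal.rpow_mul, one_mul,
        ← ENNReal.rpow_add_of_nonneg _ _ (by linarith) (by linarith)]
      rw [ENNReal.mul_rpow_of_nonneg _ _ hp0.le, ← ENNReal.rpow_mul]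
      congr 2
      rw [hp]; field_simp; ring
    rw [eLpNorm_eq_lintegral_rpow_enorm_toReal (ENNReal.ofReal_pos.2 hp0).ne'
      ENNReal.ofReal_ne_top, ENNReal.toReal_ofReal hp0.le, lintegral_congr e,
      lintegral_const_mul' _ _ (by simp only [hc]; finiteness), hNr]
    rcases eq_or_ne (N t) 0 with h0 | h0
    · rw [hc0 t h0, ENNReal.zero_rpow_of_pos hp0, zero_mul, ENNReal.zero_rpow_of_pos (by positivity)]
      simp
    · rw [hcN t h0, ← ENNReal.rpow_mul, ← ENNReal.rpow_add _ _ h0 (hN t)]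
      have : (1 - r) * p + r = 0 := by rw [hp]; field_simp; ring
      rw [this]; simp
  · have e : ∀ x, (h (t, x) : ℝ≥0∞) * ‖v (t, x)‖ₑ ^ 2 = c t * ‖v (t, x)‖ₑ ^ r := fun x => by
      rw [key, mul_assoc, ← ENNReal.rpow_two, ← ENNReal.rpow_add_of_nonneg _ _ (by linarith)
        (by norm_num)]
      norm_num
    rw [lintegral_congr e, lintegral_const_mul' _ _ (by simp only [hc]; finiteness), hNr]
    rcases eq_or_ne (N t) 0 with h0 | h0
    · change N t ≤ _; rw [h0]; exact zero_le
    · rw [hcN t h0, ← ENNReal.rpow_add _ _ h0 (hN t)]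
      simp [hNdef]

/-- The output Lebesgue exponent attached to the inverse time exponent `θ`. -/
def outputExponent (σ θ : ℝ) : ℝ≥0∞ := (ENNReal.ofReal (1 / 2 - θ / σ))⁻¹

variable {σ θ : ℝ}

theorem outputExponent_ne_zero : outputExponent σ θ ≠ 0 := by
  rw [outputExponent, ENNReal.inv_ne_zero]; exact ENNReal.ofReal_ne_top

theorem one_le_inputExponent (hσ : 0 < σ) (h0 : 0 ≤ θ) (h1 : θ ≤ σ / 2) :
    1 ≤ ENNReal.ofReal (inputExponent σ θ) := by
  rw [ENNReal.one_le_ofReal, inputExponent]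
  have : θ / σ ≤ 1 / 2 := by rw [div_le_iff₀ hσ]; linarith
  exact (one_le_inv₀ (by positivity)).2 (by linarith)

theorem exists_norming (hσ : 0 < σ) (h0 : 0 ≤ θ) (h1 : θ ≤ σ / 2) (hv : Measurable v) {η : ℝ≥0∞}
    (hη : η < 1) (hN : ∀ t, eLpNorm (fun x => v (t, x)) (outputExponent σ θ) ν ≠ ∞)
    {S : Set X} (hνS : ν S ≠ ∞) (hvS : ∀ t, ∀ x ∉ S, v (t, x) = 0) :
    ∃ h : ℝ × X → NNReal, Measurable h ∧
      (∀ t, eLpNorm (fun x => ((h (t, x) : ℝ) : ℂ) * v (t, x))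
        (ENNReal.ofReal (inputExponent σ θ)) ν ≤ 1) ∧
      ∀ t, η * eLpNorm (fun x => v (t, x)) (outputExponent σ θ) ν ≤
        ∫⁻ x, h (t, x) * ‖v (t, x)‖ₑ ^ 2 ∂ν := by
  rcases h1.eq_or_lt with rfl | h1
  · have e1 : outputExponent σ (σ / 2) = ∞ := by
      rw [outputExponent, div_right_comm, div_self hσ.ne']; simp
    have e2 : inputExponent σ (σ / 2) = 1 := by
      rw [inputExponent, div_right_comm, div_self hσ.ne']; norm_num
    rw [e1] at hN ⊢
    rw [e2, ENNReal.ofReal_one]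
    exact exists_norming_top hv hη hN hνS hvS
  · have h2 : θ / σ < 1 / 2 := by rw [div_lt_iff₀ hσ]; linarith
    have h3 : 0 ≤ θ / σ := by positivity
    have h4 : 0 < 1 / 2 - θ / σ := by linarith
    have e1 : outputExponent σ θ = ENNReal.ofReal (1 / 2 - θ / σ)⁻¹ := by
      rw [outputExponent, ENNReal.ofReal_inv_of_pos h4]
    rw [e1] at hN ⊢
    obtain ⟨h, hm, hb, hl⟩ := exists_norming_of_ne_top (ν := ν) hv (r := (1 / 2 - θ / σ)⁻¹)
      (p := inputExponent σ θ) (by rw [le_inv_comm₀ (by norm_num) h4]; linarith)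
      (by rw [inputExponent]
          generalize θ / σ = a at *
          have : 1 / 2 + a ≠ 0 := by linarith
          have : 1 - 2 * a ≠ 0 := by linarith
          have : (1 / 2 - a)⁻¹ - 1 = (1 / 2 + a) / (1 / 2 - a) := by field_simp; ring
          rw [this]; field_simp) hN
    exact ⟨h, hm, hb, fun t => (mul_le_of_le_one_left (by simp) hη.le).trans (hl t)⟩

theorem enorm_integral_ofReal {Y : Type*} [MeasurableSpace Y] {μ : Measure Y} {g : Y → NNReal}
    (hg : Integrable (fun y => ((g y : ℝ) : ℂ)) μ) :
    ‖∫ y, ((g y : ℝ) : ℂ) ∂μ‖ₑ = ∫⁻ y, g y ∂μ := by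
  have hg' : Integrable (fun y => (g y : ℝ)) μ := by simpa using hg.re
  rw [integral_complex_ofReal, ← ofReal_norm, Complex.norm_real, Real.norm_of_nonneg
    (integral_nonneg fun _ => NNReal.coe_nonneg _),
    ofReal_integral_eq_lintegral_ofReal hg' (ae_of_all _ fun _ => NNReal.coe_nonneg _)]
  simp

variable {u : ℝ × X → ℂ} {A : ℝ≥0∞}

theorem lintegral_eLpNorm_indicator_le (hσ : 0 < σ) (hθ0 : 0 < θ) (hθ1 : θ < 1)
    (hθσ : θ ≤ σ / 2) (hu : Measurable u) {B : ℝ} (hB : ∀ z, ‖u z‖ ≤ B)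
    (hdual : ∀ G, SpaceTimeIntegrable ν G → inputNorm σ θ ν G ≠ ∞ →
      ‖∫ z, starRingEnd ℂ (G z) * u z ∂(volume.prod ν)‖ₑ ≤ A * inputNorm σ θ ν G)
    {T : Set ℝ} (hT : MeasurableSet T) (hTv : volume T ≠ ∞) {S : Set X} (hS : MeasurableSet S)
    (hνS : ν S ≠ ∞) :
    (∫⁻ t, eLpNorm (fun x => (T ×ˢ S).indicator u (t, x)) (outputExponent σ θ) ν ^ (1 / θ)) ^ θ ≤
      A := by
  set v := (T ×ˢ S).indicator u with hv
  set r := outputExponent σ θ with hr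
  set N : ℝ → ℝ≥0∞ := fun t => eLpNorm (fun x => v (t, x)) r ν with hN
  have hvm : Measurable v := hu.indicator (hT.prod hS)
  have hNm : Measurable N := measurable_eLpNorm_slice' hvm outputExponent_ne_zero
  have hvt : ∀ t, Measurable fun x => v (t, x) := fun t => hvm.comp measurable_prodMk_left
  have hB0 : ∀ z, ‖v z‖ ≤ B := fun z => (norm_indicator_le_norm_self _ _).trans (hB z)
  have hvS : ∀ t, ∀ x ∉ S, v (t, x) = 0 := fun t x hx => by simp [hv, hx]
  have hvT : ∀ t ∉ T, ∀ x, v (t, x) = 0 := fun t ht x => by simp [hv, ht]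
  have restr : ∀ (f : X → ℂ) (s : ℝ≥0∞), (∀ x ∉ S, f x = 0) →
      eLpNorm f s ν = eLpNorm f s (ν.restrict S) := fun f s hf => by
    rw [← eLpNorm_indicator_eq_eLpNorm_restrict hS, Set.indicator_eq_self.2]
    exact fun x hx => by_contra fun h => hx (hf x h)
  set D : ℝ≥0∞ := ν S ^ r.toReal⁻¹ * ENNReal.ofReal B with hD
  have hDtop : D ≠ ∞ := by finiteness
  have hND : ∀ t, N t ≤ T.indicator (fun _ => D) t := fun t => by
    by_cases ht : t ∈ T
    · rw [Set.indicator_of_mem ht, hN]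
      simp only
      rw [restr _ _ (hvS t)]
      refine (eLpNorm_le_of_ae_bound (ae_of_all _ fun x => hB0 (t, x))).trans_eq ?_
      rw [Measure.restrict_apply_univ]
    · simp [hN, hvT t ht]
  have hND' : ∀ t, N t ≤ D := fun t => (hND t).trans (Set.indicator_le_self _ _ _)
  have hNtop : ∀ t, N t ≠ ∞ := fun t => ne_top_of_le_ne_top hDtop (hND' t)
  set I := ∫⁻ t, N t ^ (1 / θ) with hI
  have hItop : I ≠ ∞ := by
    refine ne_top_of_le_ne_top (b := D ^ (1 / θ) * volume T) (by finiteness) ?_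
    rw [← lintegral_indicator_const hT]
    refine lintegral_mono fun t => ?_
    refine (ENNReal.rpow_le_rpow (hND t) (by positivity)).trans_eq ?_
    by_cases ht : t ∈ T <;> simp [ht, hθ0]
  have main : ∀ η : ℝ≥0∞, η < 1 → η * I ≤ A * I ^ (1 - θ) := fun η hη => by
    obtain ⟨h, hm, hb, hl⟩ := exists_norming hσ hθ0.le hθσ hvm hη hNtop hνS hvS
    set e := 1 / θ - 1 with he
    have he0 : 0 < e := by rw [he, sub_pos, lt_div_iff₀ hθ0]; linarith
    set c : ℝ → NNReal := fun t => (N t ^ e).toNNReal with hc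
    have hcN : ∀ t, (c t : ℝ≥0∞) = N t ^ e := fun t =>
      ENNReal.coe_toNNReal (ENNReal.rpow_ne_top_of_nonneg he0.le (hNtop t))
    have hcm : Measurable c := (hNm.pow_const _).ennreal_toNNReal
    set G : ℝ × X → ℂ := fun z => ((c z.1 : ℝ) : ℂ) * (((h z : ℝ) : ℂ) * v z) with hG
    have hGm : Measurable G := by
      refine Measurable.mul ?_ (Measurable.mul ?_ hvm)
      · exact Complex.measurable_ofReal.comp (hcm.comp measurable_fst).coe_nnreal_real
      · exact Complex.measurable_ofReal.comp hm.coe_nnreal_real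
    have hGN : ∀ t, eLpNorm (fun x => G (t, x)) (ENNReal.ofReal (inputExponent σ θ)) ν ≤
        N t ^ e := fun t => by
      have : (fun x => G (t, x)) = ((c t : ℝ) : ℂ) • fun x => ((h (t, x) : ℝ) : ℂ) * v (t, x) :=
        rfl
      rw [this, eLpNorm_const_smul]
      have h1 : ‖((c t : ℝ) : ℂ)‖ₑ = N t ^ e := by rw [← hcN]; simp [enorm_eq_nnnorm]
      rw [h1]
      exact mul_le_of_le_one_right (by simp) (hb t)
    have hGS : ∀ t, ∀ x ∉ S, G (t, x) = 0 := fun t x hx => by simp [hG, hvS t x hx]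
    set K : ℝ≥0∞ := ν S ^ (1 / (1 : ℝ≥0∞).toReal -
      1 / (ENNReal.ofReal (inputExponent σ θ)).toReal) with hK
    have hp1 := one_le_inputExponent hσ hθ0.le hθσ
    have hp1' : 1 ≤ inputExponent σ θ := ENNReal.one_le_ofReal.1 hp1
    have hKtop : K ≠ ∞ := by
      refine ENNReal.rpow_ne_top_of_nonneg ?_ hνS
      rw [ENNReal.toReal_ofReal (by linarith), ENNReal.toReal_one, sub_nonneg, div_one,
        div_le_one (by linarith)]
      exact hp1'
    have hG1 : ∀ t, ∫⁻ x, ‖G (t, x)‖ₑ ∂ν ≤ T.indicator (fun _ => D ^ e * K) t := fun t => by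
      have hGt : Measurable fun x => G (t, x) := hGm.comp measurable_prodMk_left
      by_cases ht : t ∈ T
      · rw [Set.indicator_of_mem ht, ← eLpNorm_one_eq_lintegral_enorm, restr _ _ (hGS t)]
        refine (eLpNorm_le_eLpNorm_mul_rpow_measure_univ hp1 hGt.aestronglyMeasurable).trans ?_
        rw [Measure.restrict_apply_univ, ← restr _ _ (hGS t)]
        gcongr
        exact (hGN t).trans (ENNReal.rpow_le_rpow (hND' t) he0.le)
      · simp [hG, hvT t ht]
    have hGst : SpaceTimeIntegrable ν G := by
      refine ⟨hGm, ⟨hGm.aestronglyMeasurable, ?_⟩, fun t =>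
        ⟨(hGm.comp measurable_prodMk_left).aestronglyMeasurable, ?_⟩⟩
      · rw [HasFiniteIntegral, lintegral_prod _ hGm.enorm.aemeasurable]
        refine (lintegral_mono hG1).trans_lt ?_
        rw [lintegral_indicator_const hT]
        exact (by finiteness : D ^ e * K * volume T ≠ ∞).lt_top
      · exact ((hG1 t).trans (Set.indicator_le_self _ _ _)).trans_lt
          (by finiteness : D ^ e * K ≠ ∞).lt_top
    have hGI : inputNorm σ θ ν G ≤ I ^ (1 - θ) := by
      rw [inputNorm, hI]
      refine ENNReal.rpow_le_rpow (lintegral_mono fun t => ?_) (by linarith)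
      refine (ENNReal.rpow_le_rpow (hGN t) (by simp; linarith)).trans_eq ?_
      rw [← ENNReal.rpow_mul]
      congr 1
      have : 1 - θ ≠ 0 := by linarith
      rw [he]; field_simp
    have hGtop : inputNorm σ θ ν G ≠ ∞ := ne_top_of_le_ne_top
      (ENNReal.rpow_ne_top_of_nonneg (by linarith) hItop) hGI
    have hcu : ∀ z, starRingEnd ℂ (G z) * u z = (((c z.1 * h z * ‖v z‖₊ ^ 2 : NNReal) : ℝ) : ℂ) :=
      fun z => by
        have : starRingEnd ℂ (v z) * u z = ((‖v z‖ ^ 2 : ℝ) : ℂ) := by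
          by_cases hz : z ∈ T ×ˢ S
          · rw [hv, Set.indicator_of_mem hz]
            exact_mod_cast RCLike.conj_mul (u z)
          · rw [hv, Set.indicator_of_notMem hz]; simp
        simp only [hG, map_mul, Complex.conj_ofReal, mul_assoc, this]
        push_cast
        ring
    have hint : Integrable (fun z => starRingEnd ℂ (G z) * u z) (volume.prod ν) := by
      refine (hGst.integrable.norm.mul_const B).mono'
        ((continuous_conj.measurable.comp hGm).mul hu).aestronglyMeasurable
        (ae_of_all _ fun z => ?_)
      rw [norm_mul, RCLike.norm_conj]
      gcongr
      exact hB z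
    have hle := (hdual G hGst hGtop).trans (mul_le_mul_right hGI A)
    simp_rw [hcu] at hle hint
    rw [enorm_integral_ofReal hint] at hle
    refine le_trans ?_ hle
    have hmeas : Measurable fun z : ℝ × X => ((c z.1 * h z * ‖v z‖₊ ^ 2 : NNReal) : ℝ≥0∞) :=
      (((hcm.comp measurable_fst).mul hm).mul (hvm.nnnorm.pow_const 2)).coe_nnreal_ennreal
    rw [lintegral_prod _ hmeas.aemeasurable, hI, ← lintegral_const_mul _ (hNm.pow_const _)]
    refine lintegral_mono fun t => ?_
    have e1 : ∫⁻ x, ((c t * h (t, x) * ‖v (t, x)‖₊ ^ 2 : NNReal) : ℝ≥0∞) ∂ν =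
        c t * ∫⁻ x, h (t, x) * ‖v (t, x)‖ₑ ^ 2 ∂ν := by
      rw [← lintegral_const_mul' _ _ ENNReal.coe_ne_top]
      refine lintegral_congr fun x => ?_
      push_cast
      rw [mul_assoc, enorm_eq_nnnorm]
    simp only
    rw [e1]
    refine le_trans ?_ (mul_le_mul_right (hl t) _)
    rw [hcN]
    have e2 : N t ^ (1 / θ) = N t ^ e * N t := by
      conv_rhs => rw [← ENNReal.rpow_one (x := N t), ← ENNReal.rpow_mul, one_mul,
        ← ENNReal.rpow_add_of_nonneg _ _ he0.le zero_le_one]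
      rw [he]; congr 1; ring
    rw [e2]
    exact (by ring : η * (N t ^ e * N t) = N t ^ e * (η * N t)).le
  rcases eq_or_ne I 0 with h0 | h0
  · rw [h0, ENNReal.zero_rpow_of_pos hθ0]; exact zero_le
  refine ENNReal.le_of_forall_lt_one_mul_le fun η hη => ?_
  have h1 := main η hη
  have h2 : I = I ^ θ * I ^ (1 - θ) := by
    rw [← ENNReal.rpow_add _ _ h0 hItop]; simp
  have h3 : I ^ (1 - θ) ≠ 0 := by simp [h0, hItop]
  have h4 : I ^ (1 - θ) ≠ ∞ := ENNReal.rpow_ne_top_of_nonneg (by linarith) hItop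
  conv_lhs at h1 => rw [h2, ← mul_assoc]
  exact (ENNReal.mul_le_mul_iff_left h3 h4).1 h1

/-- Fatou's lemma for mixed norms. -/
theorem lintegral_eLpNorm_rpow_le_of_tendsto {μ : Measure ℝ} {w : ℕ → ℝ × X → ℂ} {r : ℝ≥0∞}
    (hr : r ≠ 0) (hθ : 0 < θ) (hw : ∀ n, Measurable (w n))
    (hlim : ∀ᵐ t ∂μ, ∀ x, Tendsto (fun n => w n (t, x)) atTop (nhds (u (t, x))))
    (hA : ∀ n, (∫⁻ t, eLpNorm (fun x => w n (t, x)) r ν ^ (1 / θ) ∂μ) ^ θ ≤ A) :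
    (∫⁻ t, eLpNorm (fun x => u (t, x)) r ν ^ (1 / θ) ∂μ) ^ θ ≤ A := by
  have hA' : ∀ n, ∫⁻ t, eLpNorm (fun x => w n (t, x)) r ν ^ (1 / θ) ∂μ ≤ A ^ (1 / θ) := fun n => by
    have := ENNReal.rpow_le_rpow (hA n) (by positivity : 0 ≤ 1 / θ)
    rwa [← ENNReal.rpow_mul, mul_one_div_cancel hθ.ne', ENNReal.rpow_one] at this
  suffices h : ∫⁻ t, eLpNorm (fun x => u (t, x)) r ν ^ (1 / θ) ∂μ ≤ A ^ (1 / θ) by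
    have := ENNReal.rpow_le_rpow h hθ.le
    rwa [← ENNReal.rpow_mul, one_div_mul_cancel hθ.ne', ENNReal.rpow_one] at this
  calc ∫⁻ t, eLpNorm (fun x => u (t, x)) r ν ^ (1 / θ) ∂μ
      ≤ ∫⁻ t, liminf (fun n => eLpNorm (fun x => w n (t, x)) r ν ^ (1 / θ)) atTop ∂μ := by
        refine lintegral_mono_ae ?_
        filter_upwards [hlim] with t ht
        have h1 : eLpNorm (fun x => u (t, x)) r ν ≤
            liminf (fun n => eLpNorm (fun x => w n (t, x)) r ν) atTop :=
          Lp.eLpNorm_lim_le_liminf_eLpNorm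
            (fun n => ((hw n).comp measurable_prodMk_left).aestronglyMeasurable) _
            (ae_of_all _ ht)
        refine (ENNReal.rpow_le_rpow h1 (by positivity)).trans_eq ?_
        exact (ENNReal.orderIsoRpow (1 / θ) (by positivity)).liminf_apply
    _ ≤ liminf (fun n => ∫⁻ t, eLpNorm (fun x => w n (t, x)) r ν ^ (1 / θ) ∂μ) atTop :=
        lintegral_liminf_le fun n => (measurable_eLpNorm_slice' (hw n) hr).pow_const _
    _ ≤ liminf (fun _ : ℕ => A ^ (1 / θ)) atTop :=
        liminf_le_liminf (Eventually.of_forall hA')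
    _ = _ := liminf_const _

/-- Duality for the mixed norms of bounded functions. -/
theorem lintegral_eLpNorm_le_of_dual (hσ : 0 < σ) (hθ0 : 0 < θ) (hθ1 : θ < 1)
    (hθσ : θ ≤ σ / 2) (hu : Measurable u) {B : ℝ} (hB : ∀ z, ‖u z‖ ≤ B)
    (hdual : ∀ G, SpaceTimeIntegrable ν G → inputNorm σ θ ν G ≠ ∞ →
      ‖∫ z, starRingEnd ℂ (G z) * u z ∂(volume.prod ν)‖ₑ ≤ A * inputNorm σ θ ν G) :
    (∫⁻ t, eLpNorm (fun x => u (t, x)) (outputExponent σ θ) ν ^ (1 / θ)) ^ θ ≤ A := by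
  have hS : ∀ n : ℕ, MeasurableSet (Set.Icc (-(n : ℝ)) n ×ˢ spanningSets ν n) := fun n =>
    measurableSet_Icc.prod (measurableSet_spanningSets ν n)
  refine lintegral_eLpNorm_rpow_le_of_tendsto
    (w := fun n => (Set.Icc (-(n : ℝ)) n ×ˢ spanningSets ν n).indicator u)
    outputExponent_ne_zero hθ0 (fun n => hu.indicator (hS n)) (ae_of_all _ fun t x => ?_)
    fun n => lintegral_eLpNorm_indicator_le hσ hθ0 hθ1 hθσ hu hB hdual measurableSet_Icc
      (by simp) (measurableSet_spanningSets ν n) (measure_spanningSets_lt_top ν n).ne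
  refine tendsto_const_nhds.congr' ?_
  filter_upwards [eventually_ge_atTop (max ⌈|t|⌉₊ (spanningSetsIndex ν x))] with n hn
  have hmem : ((t, x) : ℝ × X) ∈ Set.Icc (-(n : ℝ)) n ×ˢ spanningSets ν n := by
    refine ⟨abs_le.1 ?_, monotone_spanningSets ν ((le_max_right _ _).trans hn)
      (mem_spanningSetsIndex ν x)⟩
    exact (Nat.le_ceil _).trans (by exact_mod_cast (le_max_left _ _).trans hn)
  exact (Set.indicator_of_mem hmem u).symm

/-- Duality for the `L²` norms of bounded functions at a fixed time. -/
theorem eLpNorm_two_le_of_dual {f : X → ℂ} (hf : Measurable f) {B : ℝ} (hB : ∀ x, ‖f x‖ ≤ B)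
    (hdual : ∀ g, Integrable g ν →
      ‖∫ x, starRingEnd ℂ (g x) * f x ∂ν‖ₑ ≤ A * eLpNorm g 2 ν) :
    eLpNorm f 2 ν ≤ A := by
  have key : ∀ n : ℕ, eLpNorm ((spanningSets ν n).indicator f) 2 ν ≤ A := fun n => by
    have hS := measurableSet_spanningSets ν n
    have hSt := (measure_spanningSets_lt_top ν n).ne
    set g := (spanningSets ν n).indicator f with hg
    have hgm : Measurable g := hf.indicator hS
    have hmem : MemLp g 2 ν := by
      rw [hg, memLp_indicator_iff_restrict hS]
      have : IsFiniteMeasure (ν.restrict (spanningSets ν n)) := ⟨by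
        rw [Measure.restrict_apply_univ]; exact hSt.lt_top⟩
      exact MemLp.of_bound hf.aestronglyMeasurable B (ae_of_all _ hB)
    have hgi : Integrable g ν := by
      rw [hg, integrable_indicator_iff hS]
      exact Measure.integrableOn_of_bounded hSt hf.aestronglyMeasurable (ae_of_all _ hB)
    have hgf : ∀ x, starRingEnd ℂ (g x) * f x = (((‖g x‖₊ ^ 2 : NNReal) : ℝ) : ℂ) := fun x => by
      by_cases hx : x ∈ spanningSets ν n
      · rw [hg, Set.indicator_of_mem hx]
        have := RCLike.conj_mul (f x)
        push_cast
        exact this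
      · rw [hg, Set.indicator_of_notMem hx]; simp
    have h := hdual g hgi
    have hint : Integrable (fun x => (((‖g x‖₊ ^ 2 : NNReal) : ℝ) : ℂ)) ν := by
      have h1 := hmem.integrable_norm_pow (p := 2) two_ne_zero
      have := h1.ofReal (𝕜 := ℂ)
      simpa using this
    simp_rw [hgf] at h
    rw [enorm_integral_ofReal hint] at h
    have e : ∫⁻ x, ((‖g x‖₊ ^ 2 : NNReal) : ℝ≥0∞) ∂ν = eLpNorm g 2 ν * eLpNorm g 2 ν := by
      have := eLpNorm_nnreal_pow_eq_lintegral (f := g) (μ := ν) (p := 2) two_ne_zero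
      simp only [ENNReal.coe_ofNat, NNReal.coe_ofNat, ENNReal.rpow_ofNat] at this
      rw [← pow_two, this]
      simp [enorm_eq_nnnorm]
    rw [e] at h
    rcases eq_or_ne (eLpNorm g 2 ν) 0 with h0 | h0
    · rw [h0]; exact zero_le
    · exact (ENNReal.mul_le_mul_iff_left h0 hmem.eLpNorm_ne_top).1 h
  refine (Lp.eLpNorm_lim_le_liminf_eLpNorm
    (f := fun n : ℕ => (spanningSets ν n).indicator f)
    (fun n => (hf.indicator (measurableSet_spanningSets ν n)).aestronglyMeasurable) f
    (ae_of_all _ fun x => ?_)).trans ?_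
  · refine tendsto_const_nhds.congr' ?_
    filter_upwards [eventually_ge_atTop (spanningSetsIndex ν x)] with n hn
    exact (Set.indicator_of_mem (monotone_spanningSets ν hn (mem_spanningSetsIndex ν x)) f).symm
  · exact (liminf_le_liminf (Eventually.of_forall key)).trans_eq (liminf_const _)

end Duality

section Mixed

variable {X : Type*} [MeasurableSpace X] {ν : Measure X} {σ θ θ' : ℝ}

/-- The mixed norm of the output space with inverse time exponent `θ`. -/
def outputNorm (σ θ : ℝ) (ν : Measure X) (u : ℝ × X → ℂ) : ℝ≥0∞ :=
  if θ = 0 then ⨆ t, eLpNorm (fun x => u (t, x)) (outputExponent σ θ) ν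
  else (∫⁻ t, eLpNorm (fun x => u (t, x)) (outputExponent σ θ) ν ^ (1 / θ)) ^ θ

theorem outputExponent_zero : outputExponent σ 0 = 2 := by
  rw [outputExponent]
  simp

theorem holderTriple_outputExponent (hσ : 0 < σ) (h0 : 0 ≤ θ) (h1 : θ ≤ σ / 2) :
    ENNReal.HolderTriple (ENNReal.ofReal (inputExponent σ θ)) (outputExponent σ θ) 1 := by
  have h2 : θ / σ ≤ 1 / 2 := by rw [div_le_iff₀ hσ]; linarith
  have h3 : 0 ≤ θ / σ := by positivity
  refine ⟨?_⟩
  rw [inputExponent, outputExponent, inv_inv, ← ENNReal.ofReal_inv_of_pos (by positivity), inv_inv,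
    ← ENNReal.ofReal_add (by positivity) (by linarith)]
  norm_num

/-- Hölder's inequality between the input and output norms. -/
theorem enorm_integral_conj_mul_le [SigmaFinite ν] (hσ : 0 < σ) (h0 : 0 ≤ θ) (h1 : θ ≤ σ / 2)
    (h2 : θ < 1) {F w : ℝ × X → ℂ} (hF : Measurable F) (hw : Measurable w) :
    ‖∫ z, starRingEnd ℂ (F z) * w z ∂(volume.prod ν)‖ₑ ≤
      inputNorm σ θ ν F * outputNorm σ θ ν w := by
  have := holderTriple_outputExponent hσ h0 h1
  set f : ℝ → ℝ≥0∞ := fun t => eLpNorm (fun x => F (t, x)) (ENNReal.ofReal (inputExponent σ θ)) ν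
    with hf
  set g : ℝ → ℝ≥0∞ := fun t => eLpNorm (fun x => w (t, x)) (outputExponent σ θ) ν with hg
  have hfm : Measurable f := measurable_eLpNorm_slice hF
    (ENNReal.ofReal_pos.2 (inputExponent_pos hσ h0)).ne' ENNReal.ofReal_ne_top
  have hgm : Measurable g := measurable_eLpNorm_slice' hw outputExponent_ne_zero
  calc ‖∫ z, starRingEnd ℂ (F z) * w z ∂(volume.prod ν)‖ₑ
      ≤ ∫⁻ z, ‖F z‖ₑ * ‖w z‖ₑ ∂(volume.prod ν) := by
        refine (enorm_integral_le_lintegral_enorm _).trans_eq (lintegral_congr fun z => ?_)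
        rw [enorm_mul, RCLike.enorm_conj]
    _ = ∫⁻ t, ∫⁻ x, ‖F (t, x)‖ₑ * ‖w (t, x)‖ₑ ∂ν :=
        lintegral_prod _ (hF.enorm.mul hw.enorm).aemeasurable
    _ ≤ ∫⁻ t, f t * g t := by
        refine lintegral_mono fun t => ?_
        have := eLpNorm_smul_le_mul_eLpNorm (μ := ν) (p := ENNReal.ofReal (inputExponent σ θ))
          (q := outputExponent σ θ) (r := 1) (f := fun x => w (t, x)) (φ := fun x => F (t, x))
          (hw.comp measurable_prodMk_left).aestronglyMeasurable
          (hF.comp measurable_prodMk_left).aestronglyMeasurable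
        rw [eLpNorm_one_eq_lintegral_enorm] at this
        simpa [enorm_mul] using this
    _ ≤ _ := by
        rcases h0.eq_or_lt with rfl | h0
        · rw [inputNorm, outputNorm, if_pos rfl, sub_zero, div_one]
          simp only [ENNReal.rpow_one]
          rw [← lintegral_mul_const _ hfm]
          exact lintegral_mono fun t => mul_le_mul_right (le_iSup g t) _
        · rw [inputNorm, outputNorm, if_neg h0.ne']
          have hc : (1 / (1 - θ)).HolderConjugate (1 / θ) := by
            rw [Real.holderConjugate_iff]
            refine ⟨?_, ?_⟩
            · rw [lt_div_iff₀ (by linarith)]; linarith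
            · simp
          have := ENNReal.lintegral_mul_le_Lp_mul_Lq volume hc hfm.aemeasurable hgm.aemeasurable
          simpa using this

theorem eLpNorm_le_rpow_mul_rpow {p q r : ℝ≥0∞} {φ : ℝ} (h0 : 0 < φ) (h1 : φ < 1)
    (h : ENNReal.ofReal (1 - φ) * p⁻¹ + ENNReal.ofReal φ * q⁻¹ = r⁻¹) {f : X → ℂ}
    (hf : AEStronglyMeasurable f ν) :
    eLpNorm f r ν ≤ eLpNorm f p ν ^ (1 - φ) * eLpNorm f q ν ^ φ := by
  have h0' : ENNReal.ofReal φ ≠ 0 := (ENNReal.ofReal_pos.2 h0).ne'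
  have h1' : ENNReal.ofReal (1 - φ) ≠ 0 := (ENNReal.ofReal_pos.2 (by linarith)).ne'
  have : ENNReal.HolderTriple (p / ENNReal.ofReal (1 - φ)) (q / ENNReal.ofReal φ) r := by
    refine ⟨?_⟩
    rw [ENNReal.inv_div (.inl ENNReal.ofReal_ne_top) (.inl h1'),
      ENNReal.inv_div (.inl ENNReal.ofReal_ne_top) (.inl h0'), div_eq_mul_inv, div_eq_mul_inv, h]
  have hm : ∀ s : ℝ, 0 ≤ s → AEStronglyMeasurable (fun x => ‖f x‖ ^ s) ν := fun s hs =>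
    (Real.continuous_rpow_const hs).comp_aestronglyMeasurable hf.norm
  have key := eLpNorm_smul_le_mul_eLpNorm (μ := ν) (r := r) (p := p / ENNReal.ofReal (1 - φ))
    (q := q / ENNReal.ofReal φ) (hm φ h0.le) (hm (1 - φ) (by linarith))
  rw [eLpNorm_norm_rpow _ (by linarith), eLpNorm_norm_rpow _ h0,
    ENNReal.div_mul_cancel h1' ENNReal.ofReal_ne_top,
    ENNReal.div_mul_cancel h0' ENNReal.ofReal_ne_top] at key
  refine le_trans (le_of_eq ?_) key
  refine eLpNorm_congr_norm_ae (ae_of_all _ fun x => ?_)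
  rw [Pi.smul_apply', smul_eq_mul, ← Real.rpow_add_of_nonneg (norm_nonneg _) (by linarith) h0.le]
  simp

/-- Interpolation of the output norms with the energy norm. -/
theorem outputNorm_le_of_lt [SigmaFinite ν] (hσ : 0 < σ) (h0 : 0 < θ) (h1 : θ < θ')
    (h2 : θ' ≤ σ / 2) {u : ℝ × X → ℂ} (hu : Measurable u) {A : ℝ≥0∞}
    (hA : outputNorm σ 0 ν u ≤ A) (hA' : outputNorm σ θ' ν u ≤ A) :
    outputNorm σ θ ν u ≤ A := by
  have h0' : 0 < θ' := h0.trans h1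
  set φ := θ / θ' with hφ
  have hφ0 : 0 < φ := by positivity
  have hφ1 : φ < 1 := (div_lt_one h0').2 h1
  rw [outputNorm, if_pos rfl, outputExponent_zero] at hA
  rw [outputNorm, if_neg h0'.ne'] at hA'
  rw [outputNorm, if_neg h0.ne']
  have hr : ENNReal.ofReal (1 - φ) * 2⁻¹ + ENNReal.ofReal φ * (outputExponent σ θ')⁻¹ =
      (outputExponent σ θ)⁻¹ := by
    have e : (2 : ℝ≥0∞)⁻¹ = ENNReal.ofReal (1 / 2) := by
      rw [one_div, ENNReal.ofReal_inv_of_pos two_pos]; simp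
    have h3 : θ' / σ ≤ 1 / 2 := by rw [div_le_iff₀ hσ]; linarith
    rw [e, outputExponent, outputExponent, inv_inv, inv_inv, ← ENNReal.ofReal_mul (by linarith),
      ← ENNReal.ofReal_mul hφ0.le, ← ENNReal.ofReal_add (by nlinarith)
        (mul_nonneg hφ0.le (by linarith))]
    congr 1
    rw [hφ]; field_simp; ring
  have hAe : A ^ (1 - φ) * A ^ φ = A := by
    rw [← ENNReal.rpow_add_of_nonneg _ _ (by linarith) hφ0.le]; simp
  rcases eq_or_ne A ∞ with hAt | hAt
  · rw [hAt]; exact le_top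
  have hb : ∀ t, eLpNorm (fun x => u (t, x)) (outputExponent σ θ) ν ^ (1 / θ) ≤
      A ^ ((1 - φ) / θ) * eLpNorm (fun x => u (t, x)) (outputExponent σ θ') ν ^ (1 / θ') :=
    fun t => by
      have := eLpNorm_le_rpow_mul_rpow hφ0 hφ1 hr
        (hu.comp (measurable_prodMk_left (x := t))).aestronglyMeasurable (ν := ν)
      refine (ENNReal.rpow_le_rpow this (by positivity)).trans ?_
      rw [ENNReal.mul_rpow_of_nonneg _ _ (by positivity), ← ENNReal.rpow_mul, ← ENNReal.rpow_mul]
      have e1 : (1 - φ) * (1 / θ) = (1 - φ) / θ := by ring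
      have e2 : φ * (1 / θ) = 1 / θ' := by rw [hφ]; field_simp
      rw [e1, e2]
      refine mul_le_mul' (ENNReal.rpow_le_rpow ((le_iSup _ t).trans hA) ?_) le_rfl
      exact div_nonneg (by linarith) h0.le
  have hb2 := lintegral_mono (μ := volume) hb
  rw [lintegral_const_mul _ ((measurable_eLpNorm_slice' hu outputExponent_ne_zero).pow_const _)]
    at hb2
  refine (ENNReal.rpow_le_rpow hb2 h0.le).trans ?_
  rw [ENNReal.mul_rpow_of_nonneg _ _ h0.le, ← ENNReal.rpow_mul, div_mul_cancel₀ _ h0.ne']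
  conv_rhs => rw [← hAe]
  refine mul_le_mul' le_rfl ?_
  have := ENNReal.rpow_le_rpow hA' hφ0.le
  rw [← ENNReal.rpow_mul, hφ, mul_div_cancel₀ _ h0'.ne'] at this
  exact this

variable {H : Type*} [NormedAddCommGroup H] [InnerProductSpace ℂ H] [CompleteSpace H] {C : ℝ≥0∞}

theorem exists_enorm_timeSynth_le (hσ : 0 < σ) (hC : C ≠ ∞) (ν : Measure X) [SigmaFinite ν]
    (hθ : AdmissibleTime σ θ) :
    ∃ K : ℝ≥0∞, K ≠ ∞ ∧ ∀ V : ℝ × X → H, DispersiveFamily σ C ν V → ∀ F : ℝ × X → ℂ,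
      SpaceTimeIntegrable ν F → inputNorm σ θ ν F ≠ ∞ → ∀ J : Set ℝ, MeasurableSet J →
      ‖timeSynth ν V J F‖ₑ ≤ K * inputNorm σ θ ν F := by
  obtain ⟨K, hK, h⟩ := exists_enorm_retardedForm_le (H := H) hσ hC ν hθ
  refine ⟨K ^ (1 / 2 : ℝ), by finiteness, fun V hV F hF hM J hJ => ?_⟩
  have := h V hV F F hF hF hM hM (J ×ˢ J) (hJ.prod hJ)
  rw [hV.retardedForm_prod_self hF hJ, enorm_inner_self, ← pow_two] at this
  have := ENNReal.rpow_le_rpow this (by norm_num : (0 : ℝ) ≤ 1 / 2)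
  rwa [ENNReal.mul_rpow_of_nonneg _ _ (by norm_num), sq_rpow_half, sq_rpow_half] at this

theorem exists_outputNorm_zero_le (hσ : 0 < σ) (hC : C ≠ ∞) (ν : Measure X) [SigmaFinite ν]
    (hθ : AdmissibleTime σ θ) :
    ∃ K : ℝ≥0∞, K ≠ ∞ ∧ ∀ V : ℝ × X → H, DispersiveFamily σ C ν V → ∀ F : ℝ × X → ℂ,
      SpaceTimeIntegrable ν F → inputNorm σ θ ν F ≠ ∞ → ∀ R : Set (ℝ × ℝ), MeasurableSet R →
      outputNorm σ 0 ν (retarded ν V R F) ≤ K * inputNorm σ θ ν F := by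
  obtain ⟨K, hK, h⟩ := exists_enorm_timeSynth_le (H := H) hσ hC ν hθ
  refine ⟨C * K, by finiteness, fun V hV F hF hM R hR => ?_⟩
  rw [outputNorm, if_pos rfl, outputExponent_zero]
  refine iSup_le fun t => ?_
  obtain ⟨B, hB⟩ := hV.exists_norm_retarded_le hF
  have hm := (hV.stronglyMeasurable_retarded hF hR).measurable
  refine eLpNorm_two_le_of_dual (hm.comp measurable_prodMk_left) (fun x => hB R (t, x))
    fun g hg => ?_
  have e : ∫ x, starRingEnd ℂ (g x) * retarded ν V R F (t, x) ∂ν =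
      inner ℂ (synth ν V t g) (timeSynth ν V (timeSlice R t) F) := by
    rw [synth, ← inner_conj_symm, ← integral_inner (hV.integrable_smul hg), ← integral_conj]
    simp [retarded, inner_smul_right]
  rw [e]
  refine (enorm_inner_le _ _).trans ((mul_le_mul' (hV.energy t g hg)
    (h V hV F hF hM _ (measurableSet_timeSlice hR t))).trans_eq (by ring))

theorem exists_outputNorm_le_self (hσ : 0 < σ) (hC : C ≠ ∞) (ν : Measure X) [SigmaFinite ν]
    (hθ : AdmissibleTime σ θ) :
    ∃ K : ℝ≥0∞, K ≠ ∞ ∧ ∀ V : ℝ × X → H, DispersiveFamily σ C ν V → ∀ F : ℝ × X → ℂ,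
      SpaceTimeIntegrable ν F → inputNorm σ θ ν F ≠ ∞ → ∀ R : Set (ℝ × ℝ), MeasurableSet R →
      outputNorm σ θ ν (retarded ν V R F) ≤ K * inputNorm σ θ ν F := by
  rcases hθ.nonneg.eq_or_lt with rfl | h0
  · exact exists_outputNorm_zero_le hσ hC ν hθ
  obtain ⟨K, hK, h⟩ := exists_enorm_retardedForm_le (H := H) hσ hC ν hθ
  refine ⟨K, hK, fun V hV F hF hM R hR => ?_⟩
  rw [outputNorm, if_neg h0.ne']
  obtain ⟨B, hB⟩ := hV.exists_norm_retarded_le hF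
  refine lintegral_eLpNorm_le_of_dual hσ h0 (by linarith [hθ.le_half]) hθ.le_rate
    (hV.stronglyMeasurable_retarded hF hR).measurable (hB R) fun G hG hMG => ?_
  rw [← hV.retardedForm_eq_integral hF hG hR, mul_assoc]
  exact h V hV F G hF hG hM hMG R hR

theorem exists_outputNorm_le_of_le (hσ : 0 < σ) (hC : C ≠ ∞) (ν : Measure X) [SigmaFinite ν]
    (h0 : 0 ≤ θ) (hle : θ ≤ θ') (hθ' : AdmissibleTime σ θ') :
    ∃ K : ℝ≥0∞, K ≠ ∞ ∧ ∀ V : ℝ × X → H, DispersiveFamily σ C ν V → ∀ F : ℝ × X → ℂ,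
      SpaceTimeIntegrable ν F → inputNorm σ θ' ν F ≠ ∞ → ∀ R : Set (ℝ × ℝ), MeasurableSet R →
      outputNorm σ θ ν (retarded ν V R F) ≤ K * inputNorm σ θ' ν F := by
  rcases h0.eq_or_lt with rfl | h0
  · exact exists_outputNorm_zero_le hσ hC ν hθ'
  rcases hle.eq_or_lt with rfl | hlt
  · exact exists_outputNorm_le_self hσ hC ν hθ'
  obtain ⟨K₀, hK₀, hb₀⟩ := exists_outputNorm_zero_le (H := H) hσ hC ν hθ'
  obtain ⟨K₁, hK₁, hb₁⟩ := exists_outputNorm_le_self (H := H) hσ hC ν hθ'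
  refine ⟨max K₀ K₁, max_ne_top hK₀ hK₁, fun V hV F hF hM R hR => ?_⟩
  refine outputNorm_le_of_lt hσ h0 hlt hθ'.le_rate
    (hV.stronglyMeasurable_retarded hF hR).measurable ((hb₀ V hV F hF hM R hR).trans ?_)
    ((hb₁ V hV F hF hM R hR).trans ?_)
  · gcongr; exact le_max_left _ _
  · gcongr; exact le_max_right _ _

/-- The inhomogeneous Strichartz estimate for dispersive families. -/
theorem exists_outputNorm_le (hσ : 0 < σ) (hC : C ≠ ∞) (ν : Measure X) [SigmaFinite ν]
    (hθ : AdmissibleTime σ θ) (hθ' : AdmissibleTime σ θ') :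
    ∃ K : ℝ≥0∞, K ≠ ∞ ∧ ∀ V : ℝ × X → H, DispersiveFamily σ C ν V → ∀ F : ℝ × X → ℂ,
      SpaceTimeIntegrable ν F → inputNorm σ θ' ν F ≠ ∞ → ∀ R : Set (ℝ × ℝ), MeasurableSet R →
      outputNorm σ θ ν (retarded ν V R F) ≤ K * inputNorm σ θ' ν F := by
  rcases le_or_gt θ θ' with hle | hlt
  · exact exists_outputNorm_le_of_le hσ hC ν hθ.nonneg hle hθ'
  obtain ⟨K, hK, hb⟩ := exists_outputNorm_le_of_le (H := H) hσ hC ν hθ'.nonneg hlt.le hθ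
  have h0 : 0 < θ := hθ'.nonneg.trans_lt hlt
  refine ⟨K, hK, fun V hV F hF hM R hR => ?_⟩
  rw [outputNorm, if_neg h0.ne']
  obtain ⟨B, hB⟩ := hV.exists_norm_retarded_le hF
  refine lintegral_eLpNorm_le_of_dual hσ h0 (by linarith [hθ.le_half]) hθ.le_rate
    (hV.stronglyMeasurable_retarded hF hR).measurable (hB R) fun G hG hMG => ?_
  have hR' : MeasurableSet (Prod.swap ⁻¹' R) := measurable_swap hR
  rw [← hV.retardedForm_eq_integral hF hG hR, enorm_retardedForm_comm,
    hV.retardedForm_eq_integral hG hF hR']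
  refine (enorm_integral_conj_mul_le hσ hθ'.nonneg hθ'.le_rate (by linarith [hθ'.le_half])
    hF.measurable (hV.stronglyMeasurable_retarded hG hR').measurable).trans ?_
  refine (mul_le_mul_right (hb V hV G hG hMG _ hR') _).trans_eq (by ring)

end Mixed

section Gaussian

variable {d : ℕ} {ε : ℝ}

/-- The complex Gaussian rate `ε + i τ`. -/
def gaussRate (ε τ : ℝ) : ℂ := ε + τ * I

theorem re_gaussRate (ε τ : ℝ) : (gaussRate ε τ).re = ε := by simp [gaussRate]

theorem im_gaussRate (ε τ : ℝ) : (gaussRate ε τ).im = τ := by simp [gaussRate]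

/-- The regularized plane wave `ξ ↦ e^{-ε|ξ|²/2} e^{i t |ξ|²} e^{-i x·ξ}`, with `z = (t, x)`. -/
def gaussWave (ε : ℝ) (z : ℝ × Ed d) (ξ : Ed d) : ℂ :=
  cexp (-gaussRate (ε / 2) (-z.1) * ‖ξ‖ ^ 2 + (-I) * (⟪z.2, ξ⟫ : ℝ))

/-- The regularized Schrödinger kernel, up to the factor `(2π)^d`. -/
def gaussKernel (ε : ℝ) (z : ℝ × Ed d) : ℂ :=
  (Real.pi / gaussRate ε z.1) ^ (d / 2 : ℂ) * cexp (I ^ 2 * ‖z.2‖ ^ 2 / (4 * gaussRate ε z.1))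

theorem norm_gaussWave (ε : ℝ) (z : ℝ × Ed d) (ξ : Ed d) :
    ‖gaussWave ε z ξ‖ = Real.exp (-(ε / 2) * ‖ξ‖ ^ 2) := by
  rw [gaussWave, Complex.norm_exp]
  congr 1
  simp [← ofReal_pow, re_gaussRate]

theorem conj_gaussWave_mul (ε : ℝ) (z w : ℝ × Ed d) (ξ : Ed d) :
    starRingEnd ℂ (gaussWave ε z ξ) * gaussWave ε w ξ =
      cexp (-gaussRate ε (z.1 - w.1) * ‖ξ‖ ^ 2 + I * (⟪z.2 - w.2, ξ⟫ : ℝ)) := by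
  rw [gaussWave, gaussWave, ← Complex.exp_conj, ← Complex.exp_add, inner_sub_left]
  congr 1
  simp only [gaussRate, map_add, map_mul, map_neg, map_pow, conj_ofReal, conj_I]
  push_cast
  ring

theorem memLp_gaussWave (hε : 0 < ε) (z : ℝ × Ed d) : MemLp (gaussWave ε z) 2 volume := by
  have hc : Continuous (gaussWave ε z) := by unfold gaussWave; fun_prop
  rw [memLp_two_iff_integrable_sq_norm hc.aestronglyMeasurable]
  have := (GaussianFourier.integrable_cexp_neg_mul_sq_norm_add (V := Ed d) (b := ε) (by simpa) 0
    0).norm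
  refine this.congr (ae_of_all _ fun ξ => ?_)
  simp only [norm_gaussWave, Complex.norm_exp, ← Real.exp_nat_mul]
  congr 1
  simp [← ofReal_pow]
  ring

/-- The regularized plane waves as elements of `L²`. -/
def gaussFamily (hε : 0 < ε) (z : ℝ × Ed d) : Lp ℂ 2 (volume : Measure (Ed d)) :=
  (memLp_gaussWave hε z).toLp

theorem inner_gaussFamily_eq_integral (hε : 0 < ε) (z w : ℝ × Ed d) :
    inner ℂ (gaussFamily hε z) (gaussFamily hε w) =
      ∫ ξ : Ed d, cexp (-gaussRate ε (z.1 - w.1) * ‖ξ‖ ^ 2 + I * (⟪z.2 - w.2, ξ⟫ : ℝ)) := by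
  rw [L2.inner_def]
  refine integral_congr_ae ?_
  filter_upwards [(memLp_gaussWave hε z).coeFn_toLp, (memLp_gaussWave hε w).coeFn_toLp] with ξ h1 h2
  rw [gaussFamily, gaussFamily, h1, h2, ← conj_gaussWave_mul, RCLike.inner_apply, mul_comm]

theorem inner_gaussFamily (hε : 0 < ε) (z w : ℝ × Ed d) :
    inner ℂ (gaussFamily hε z) (gaussFamily hε w) = gaussKernel ε (z - w) := by
  rw [inner_gaussFamily_eq_integral,
    GaussianFourier.integral_cexp_neg_mul_sq_norm_add (by rwa [re_gaussRate])]
  simp [gaussKernel]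

theorem gaussRate_ne_zero (hε : 0 < ε) (τ : ℝ) : gaussRate ε τ ≠ 0 := fun h => by
  have := re_gaussRate ε τ
  rw [h] at this
  simp at this
  linarith

theorem re_pi_div_gaussRate_pos (hε : 0 < ε) (τ : ℝ) : 0 < (Real.pi / gaussRate ε τ).re := by
  have : 0 < normSq (gaussRate ε τ) := normSq_pos.2 (gaussRate_ne_zero hε τ)
  rw [div_re]
  simp only [re_gaussRate, ofReal_re, ofReal_im, zero_mul, zero_div, add_zero]
  have := Real.pi_pos
  positivity

theorem continuous_gaussKernel (hε : 0 < ε) : Continuous (gaussKernel ε : ℝ × Ed d → ℂ) := by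
  have hr : Continuous fun z : ℝ × Ed d => gaussRate ε z.1 := by unfold gaussRate; fun_prop
  unfold gaussKernel
  refine Continuous.mul ?_ ?_
  · refine (continuous_const.div hr fun z => gaussRate_ne_zero hε _).cpow continuous_const
      fun z => Or.inl (re_pi_div_gaussRate_pos hε _)
  · refine Complex.continuous_exp.comp (Continuous.div (by fun_prop) (by fun_prop) fun z => ?_)
    exact mul_ne_zero (by norm_num) (gaussRate_ne_zero hε _)

theorem norm_gaussFamily_sq (hε : 0 < ε) (z : ℝ × Ed d) :
    ‖gaussFamily hε z‖ ^ 2 = (gaussKernel ε (0 : ℝ × Ed d)).re := by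
  have := inner_gaussFamily hε z z
  rw [inner_self_eq_norm_sq_to_K, sub_self] at this
  rw [← this]
  simp [← ofReal_pow]

theorem continuous_gaussFamily (hε : 0 < ε) :
    Continuous (gaussFamily hε : ℝ × Ed d → _) := by
  rw [continuous_iff_continuousAt]
  intro z
  rw [ContinuousAt, tendsto_iff_norm_sub_tendsto_zero]
  have hsq : ∀ w, ‖gaussFamily hε w - gaussFamily hε z‖ ^ 2 =
      2 * (gaussKernel ε (0 : ℝ × Ed d)).re - 2 * (gaussKernel ε (w - z)).re := by
    intro w
    rw [@norm_sub_sq ℂ, norm_gaussFamily_sq, norm_gaussFamily_sq, inner_gaussFamily]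
    simp only [RCLike.re_to_complex]
    ring
  have h1 : Tendsto (fun w => ‖gaussFamily hε w - gaussFamily hε z‖ ^ 2) (nhds z) (nhds 0) := by
    simp_rw [hsq]
    have : Continuous fun w : ℝ × Ed d =>
        2 * (gaussKernel ε (0 : ℝ × Ed d)).re - 2 * (gaussKernel ε (w - z)).re := by
      have := (continuous_gaussKernel (d := d) hε).comp (continuous_sub_right z)
      exact continuous_const.sub (continuous_const.mul (Complex.continuous_re.comp this))
    convert this.tendsto z using 2
    simp
  have h2 := (Real.continuous_sqrt.tendsto 0).comp h1
  simpa [Function.comp_def] using h2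

theorem norm_gaussKernel_le_rpow (hε : 0 < ε) {z : ℝ × Ed d} (hz : z.1 ≠ 0) :
    ‖gaussKernel ε z‖ ≤ Real.pi ^ (d / 2 : ℝ) * |z.1| ^ (-(d / 2 : ℝ)) := by
  have h0 := gaussRate_ne_zero hε z.1
  have hπ := Real.pi_pos
  have h1 : ‖cexp (I ^ 2 * ‖z.2‖ ^ 2 / (4 * gaussRate ε z.1))‖ ≤ 1 := by
    rw [Complex.norm_exp, Real.exp_le_one_iff]
    have e : I ^ 2 * ‖z.2‖ ^ 2 / (4 * gaussRate ε z.1) =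
        ((-(‖z.2‖ ^ 2 / (4 * Real.pi)) : ℝ) : ℂ) * (Real.pi / gaussRate ε z.1) := by
      have : (Real.pi : ℂ) ≠ 0 := by exact_mod_cast hπ.ne'
      push_cast
      rw [I_sq]
      field_simp
    rw [e, re_ofReal_mul]
    have := re_pi_div_gaussRate_pos hε z.1
    have : 0 ≤ ‖z.2‖ ^ 2 / (4 * Real.pi) := by positivity
    nlinarith
  have h2 : ‖(Real.pi / gaussRate ε z.1 : ℂ)‖ ≤ Real.pi * |z.1|⁻¹ := by
    rw [norm_div, Complex.norm_real, Real.norm_of_nonneg hπ.le, div_eq_mul_inv]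
    have : |z.1| ≤ ‖gaussRate ε z.1‖ := by
      simpa [im_gaussRate] using Complex.abs_im_le_norm (gaussRate ε z.1)
    have : 0 < |z.1| := abs_pos.2 hz
    gcongr
  have e : (d / 2 : ℂ) = ((d / 2 : ℝ) : ℂ) := by push_cast; rfl
  rw [gaussKernel, norm_mul, e, Complex.norm_cpow_real]
  calc _ ≤ (Real.pi * |z.1|⁻¹) ^ (d / 2 : ℝ) * 1 := by gcongr
    _ = _ := by rw [mul_one, Real.mul_rpow hπ.le (by positivity), Real.inv_rpow (abs_nonneg _),
      Real.rpow_neg (abs_nonneg _)]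

theorem gaussKernel_zero_time (hε : 0 < ε) (x : Ed d) :
    ‖gaussKernel ε (0, x)‖ = (Real.pi / ε) ^ (d / 2 : ℝ) * Real.exp (-(1 / (4 * ε)) * ‖x‖ ^ 2) := by
  have e : (d / 2 : ℂ) = ((d / 2 : ℝ) : ℂ) := by push_cast; rfl
  have hπ := Real.pi_pos
  rw [gaussKernel, norm_mul, e, Complex.norm_cpow_real, Complex.norm_exp]
  congr 2
  · simp [gaussRate, abs_of_pos hπ, abs_of_pos hε]
  · have e : I ^ 2 * (‖x‖ : ℂ) ^ 2 / (4 * gaussRate ε 0) =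
        ((-(1 / (4 * ε)) * ‖x‖ ^ 2 : ℝ) : ℂ) := by
      rw [gaussRate, I_sq]
      push_cast
      have : (ε : ℂ) ≠ 0 := by exact_mod_cast hε.ne'
      simp
      field_simp
    rw [e, ofReal_re]

theorem lintegral_gaussKernel_zero_time (hε : 0 < ε) :
    ∫⁻ x : Ed d, ‖gaussKernel ε ((0 : ℝ), x)‖ₑ = ENNReal.ofReal ((2 * Real.pi) ^ d) := by
  have hπ := Real.pi_pos
  have hb : 0 < 1 / (4 * ε) := by positivity
  have h1 := GaussianFourier.integral_rexp_neg_mul_sq_norm (V := Ed d) hb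
  have hi : Integrable fun x : Ed d => Real.exp (-(1 / (4 * ε)) * ‖x‖ ^ 2) := by
    by_contra h
    rw [integral_undef h] at h1
    have : 0 < (Real.pi / (1 / (4 * ε))) ^ (Module.finrank ℝ (Ed d) / 2 : ℝ) := by positivity
    linarith
  simp_rw [← ofReal_norm, gaussKernel_zero_time hε]
  rw [← ofReal_integral_eq_lintegral_ofReal (hi.const_mul _)
    (ae_of_all _ fun x => by positivity), integral_const_mul, h1, finrank_euclideanSpace_fin,
    ← Real.mul_rpow (by positivity) (by positivity)]
  congr 1
  have e : Real.pi / ε * (Real.pi / (1 / (4 * ε))) = (2 * Real.pi) ^ (2 : ℝ) := by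
    rw [Real.rpow_two]; field_simp; ring
  rw [e, ← Real.rpow_mul (by positivity), ← Real.rpow_natCast]
  congr 1
  ring

theorem energy_gaussFamily (hε : 0 < ε) (t : ℝ) {f : Ed d → ℂ} (hf : Integrable f) :
    ‖∫ x, f x • gaussFamily hε (t, x)‖ₑ ≤ ENNReal.ofReal ((2 * Real.pi) ^ d) * eLpNorm f 2 := by
  set C := ENNReal.ofReal ((2 * Real.pi) ^ d) with hC
  have hC1 : 1 ≤ C := by
    rw [hC, ENNReal.one_le_ofReal]
    exact one_le_pow₀ (by linarith [Real.pi_gt_three])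
  have hf0 : AEMeasurable (fun x => ‖f x‖ₑ) := hf.aemeasurable.enorm
  set g := hf0.mk _ with hg
  have hfg : (fun x => ‖f x‖ₑ) =ᵐ[volume] g := hf0.ae_eq_mk
  have hN : (∫⁻ x, g x ^ 2) ^ (1 / 2 : ℝ) = eLpNorm f 2 := by
    rw [eLpNorm_eq_lintegral_rpow_enorm_toReal two_ne_zero ENNReal.ofNat_ne_top]
    simp only [ENNReal.toReal_ofNat, ENNReal.rpow_two]
    congr 1
    refine lintegral_congr_ae ?_
    filter_upwards [hfg] with x hx
    rw [hx]
  have hK : Measurable fun x : Ed d => ‖gaussKernel ε ((0 : ℝ), x)‖ₑ :=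
    ((continuous_gaussKernel hε).comp (Continuous.prodMk_right (0 : ℝ))).measurable.enorm
  have hconv := lintegral_conv_le (μ := (volume : Measure (Ed d))) hK hf0.measurable_mk
    hf0.measurable_mk
  rw [lintegral_gaussKernel_zero_time hε, ← hg, hN, ← sq] at hconv
  have hmain : ‖∫ x, f x • gaussFamily hε (t, x)‖ₑ ^ 2 ≤ C * eLpNorm f 2 ^ 2 := by
    rw [← enorm_inner_self]
    refine (enorm_inner_integral_le _ _).trans (le_trans ?_ hconv)
    refine lintegral_mono_ae ?_
    filter_upwards [hfg] with y hy
    rw [inner_smul_right, enorm_mul, enorm_inner_comm, hy]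
    calc g y * ‖inner ℂ (gaussFamily hε (t, y)) (∫ x, f x • gaussFamily hε (t, x))‖ₑ
        ≤ g y * ∫⁻ x, ‖gaussKernel ε ((0 : ℝ), y - x)‖ₑ * g x := by
          gcongr
          refine (enorm_inner_integral_le _ _).trans_eq (lintegral_congr_ae ?_)
          filter_upwards [hfg] with x hx
          rw [inner_smul_right, enorm_mul, hx, inner_gaussFamily, mul_comm]
          simp
      _ = _ := by
          have hm : Measurable fun x => ‖gaussKernel ε ((0 : ℝ), y - x)‖ₑ * g x :=
            (hK.comp (measurable_const.sub measurable_id)).mul hf0.measurable_mk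
          rw [← lintegral_const_mul _ hm]
          exact lintegral_congr fun x => by ring
  have h2 : ‖∫ x, f x • gaussFamily hε (t, x)‖ₑ ^ 2 ≤ (C * eLpNorm f 2) ^ 2 := by
    refine hmain.trans ?_
    rw [mul_pow]
    gcongr
    exact le_self_pow₀ hC1 two_ne_zero
  exact (ENNReal.pow_le_pow_left_iff two_ne_zero).1 h2

/-- The regularized plane waves are dispersive, uniformly in the regularization. -/
theorem dispersiveFamily_gaussFamily (hε : 0 < ε) :
    DispersiveFamily (d / 2) (ENNReal.ofReal ((2 * Real.pi) ^ d)) (volume : Measure (Ed d))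
      (gaussFamily hε) where
  stronglyMeasurable := (continuous_gaussFamily hε).stronglyMeasurable
  bounded := ⟨√(gaussKernel ε (0 : ℝ × Ed d)).re, fun z =>
    Real.le_sqrt_of_sq_le (norm_gaussFamily_sq hε z).le⟩
  energy t _ hf := energy_gaussFamily hε t hf
  decay z w h := by
    have hπ := Real.pi_gt_three
    rw [inner_gaussFamily, ← ofReal_norm, ← ENNReal.ofReal_mul (by positivity)]
    refine ENNReal.ofReal_le_ofReal ((norm_gaussKernel_le_rpow hε (sub_ne_zero.2 h)).trans ?_)
    rw [Prod.fst_sub]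
    gcongr
    calc Real.pi ^ (d / 2 : ℝ) ≤ Real.pi ^ (d : ℝ) :=
          Real.rpow_le_rpow_of_exponent_le (by linarith) (by
            have : (0 : ℝ) ≤ d := d.cast_nonneg
            linarith)
      _ = Real.pi ^ d := Real.rpow_natCast _ _
      _ ≤ (2 * Real.pi) ^ d := by gcongr; linarith

end Gaussian

section Schwartz

variable {d : ℕ}

theorem integrable_one_add_norm_pow (d : ℕ) :
    Integrable fun x : Ed d => ((1 + ‖x‖) ^ (d + 1))⁻¹ := by
  refine (integrable_one_add_norm (E := Ed d) (μ := volume) (r := (d + 1 : ℕ))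
    (by simp)).congr (ae_of_all _ fun x => ?_)
  simp only
  rw [Real.rpow_neg (by positivity), Real.rpow_natCast]

variable (F : SchwartzMap (ℝ × Ed d) ℂ)

theorem contDiff_slice (s : ℝ) {n : ℕ∞} : ContDiff ℝ n fun y => F (s, y) :=
  (F.smooth n).comp (by fun_prop)

theorem norm_iteratedFDeriv_slice_le (n : ℕ) (s : ℝ) (x : Ed d) :
    ‖iteratedFDeriv ℝ n (fun y => F (s, y)) x‖ ≤ ‖iteratedFDeriv ℝ n F (s, x)‖ := by
  have e : (fun y => F (s, y)) =
      (fun z => F ((s, 0) + z)) ∘ ContinuousLinearMap.inr ℝ ℝ (Ed d) := by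
    ext y; simp
  have hF : ContDiff ℝ n fun z => F ((s, 0) + z) := (F.smooth n).comp (by fun_prop)
  rw [e, ContinuousLinearMap.iteratedFDeriv_comp_right _ hF x le_rfl, iteratedFDeriv_comp_add_left]
  refine (ContinuousMultilinearMap.norm_compContinuousLinearMap_le _ _).trans ?_
  simp only [ContinuousLinearMap.inr_apply, Prod.mk_add_mk, add_zero, zero_add]
  refine mul_le_of_le_one_right (norm_nonneg _) (Finset.prod_le_one (fun _ _ => norm_nonneg _)
    fun _ _ => ContinuousLinearMap.norm_inr_le_one ..)

theorem exists_norm_iteratedFDeriv_slice_le (k n : ℕ) : ∃ B : ℝ, ∀ (s : ℝ) (x : Ed d),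
    ‖iteratedFDeriv ℝ n (fun y => F (s, y)) x‖ ≤ B * ((1 + ‖x‖) ^ k)⁻¹ := by
  refine ⟨2 ^ k * (Finset.Iic (k, n)).sup (fun m => SchwartzMap.seminorm ℝ m.1 m.2) F,
    fun s x => ?_⟩
  have h := SchwartzMap.one_add_le_sup_seminorm_apply (𝕜 := ℝ) (m := (k, n)) le_rfl le_rfl F (s, x)
  rw [← div_eq_mul_inv, le_div_iff₀ (by positivity), mul_comm]
  refine le_trans ?_ h
  gcongr
  · exact norm_snd_le (s, x)
  · exact norm_iteratedFDeriv_slice_le F n s x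

theorem exists_norm_slice_le : ∃ B : ℝ, ∀ (s : ℝ) (x : Ed d),
    ‖F (s, x)‖ ≤ B * ((1 + ‖x‖) ^ (d + 1))⁻¹ := by
  simpa using exists_norm_iteratedFDeriv_slice_le F (d + 1) 0

theorem spaceTimeIntegrable_schwartz : SpaceTimeIntegrable volume F where
  measurable := F.continuous.measurable
  integrable := F.integrable
  slice t := by
    obtain ⟨B, hB⟩ := exists_norm_slice_le F
    exact ((integrable_one_add_norm_pow d).const_mul B).mono'
      (F.continuous.comp (Continuous.prodMk_right t)).aestronglyMeasurable (ae_of_all _ (hB t))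

theorem FT_eq_fourier (f : Ed d → ℂ) (ξ : Ed d) :
    FT d f ξ = FourierTransform.fourier f ((2 * Real.pi)⁻¹ • ξ) := by
  rw [FT, Real.fourier_eq']
  refine integral_congr_ae (ae_of_all _ fun x => ?_)
  have : (Real.pi : ℂ) ≠ 0 := by exact_mod_cast Real.pi_ne_zero
  simp only [smul_eq_mul, inner_smul_right]
  congr 2
  push_cast
  field_simp

theorem exists_norm_pow_mul_FT_slice_le (n : ℕ) : ∃ B : ℝ, ∀ (s : ℝ) (ξ : Ed d),
    ‖ξ‖ ^ n * ‖FT d (fun y => F (s, y)) ξ‖ ≤ B := by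
  choose B hB using fun m => exists_norm_iteratedFDeriv_slice_le F (d + 1) m
  have hi : ∀ s m, Integrable fun v : Ed d => ‖iteratedFDeriv ℝ m (fun y => F (s, y)) v‖ :=
    fun s m => (((integrable_one_add_norm_pow d).const_mul (B m)).mono'
      ((contDiff_slice F s (n := m)).continuous_iteratedFDeriv le_rfl).aestronglyMeasurable
      (ae_of_all _ (hB m s))).norm
  refine ⟨(2 * Real.pi) ^ n * (2 ^ n * ∑ m ∈ Finset.range (n + 1),
    ∫ v : Ed d, B m * ((1 + ‖v‖) ^ (d + 1))⁻¹), fun s ξ => ?_⟩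
  have h := Real.pow_mul_norm_iteratedFDeriv_fourier_le (K := 0) (N := n)
    (contDiff_slice F s) (fun k m hk hm => by
      obtain rfl : k = 0 := by simpa using hk
      simpa using hi s m) (k := 0) (n := n) le_rfl le_rfl ((2 * Real.pi)⁻¹ • ξ)
  simp only [norm_iteratedFDeriv_zero, pow_zero, one_mul, zero_add, Finset.range_one,
    Finset.sum_product, Finset.sum_singleton] at h
  rw [FT_eq_fourier]
  have e : ‖ξ‖ ^ n = (2 * Real.pi) ^ n * ‖(2 * Real.pi)⁻¹ • ξ‖ ^ n := by
    have := Real.pi_pos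
    rw [← mul_pow, norm_smul, Real.norm_of_nonneg (by positivity)]
    field_simp
  rw [e, mul_assoc]
  have := Real.pi_pos
  refine mul_le_mul_of_nonneg_left (h.trans ?_) (by positivity)
  gcongr
  · exact Finset.sum_nonneg fun m _ => integral_nonneg fun v => norm_nonneg _
  · norm_num
  · exact hi s _
  · exact (integrable_one_add_norm_pow d).const_mul _
  · exact hB _ s

theorem exists_norm_FT_slice_le : ∃ B : ℝ, ∀ (s : ℝ) (ξ : Ed d),
    ‖FT d (fun y => F (s, y)) ξ‖ ≤ B * ((1 + ‖ξ‖) ^ (d + 1))⁻¹ := by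
  obtain ⟨A, hA⟩ := exists_norm_pow_mul_FT_slice_le F 0
  obtain ⟨B, hB⟩ := exists_norm_pow_mul_FT_slice_le F (d + 1)
  refine ⟨2 ^ d * (A + B), fun s ξ => ?_⟩
  rw [← div_eq_mul_inv, le_div_iff₀ (by positivity)]
  calc _ ≤ ‖FT d (fun y => F (s, y)) ξ‖ * (2 ^ d * (1 ^ (d + 1) + ‖ξ‖ ^ (d + 1))) := by
        gcongr
        exact add_pow_le zero_le_one (norm_nonneg _) (d + 1)
    _ = 2 ^ d * (‖ξ‖ ^ 0 * ‖FT d (fun y => F (s, y)) ξ‖ +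
        ‖ξ‖ ^ (d + 1) * ‖FT d (fun y => F (s, y)) ξ‖) := by ring
    _ ≤ _ := by gcongr <;> apply_assumption

theorem stronglyMeasurable_FT_slice :
    StronglyMeasurable fun p : ℝ × Ed d => FT d (fun y => F (p.1, y)) p.2 := by
  unfold FT
  refine StronglyMeasurable.integral_prod_right' (f := fun p : (ℝ × Ed d) × Ed d =>
    cexp (-I * (⟪p.2, p.1.2⟫ : ℝ)) * F (p.1.1, p.2)) (Continuous.stronglyMeasurable ?_)
  have := F.continuous
  fun_prop

end Schwartz

namespace DispersiveFamily

variable {X : Type*} [MeasurableSpace X] {ν : Measure X} {H : Type*} [NormedAddCommGroup H]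
  [InnerProductSpace ℂ H] [CompleteSpace H] {V : ℝ × X → H} {σ : ℝ} {C : ℝ≥0∞}
  (hV : DispersiveFamily σ C ν V)
include hV

theorem inner_synth (a : H) (s : ℝ) {f : X → ℂ} (hf : Integrable f ν) :
    inner ℂ a (synth ν V s f) = ∫ x, f x * inner ℂ a (V (s, x)) ∂ν := by
  rw [synth, ← integral_inner (hV.integrable_smul hf)]
  simp_rw [inner_smul_right]

theorem inner_timeSynth [SigmaFinite ν] (a : H) (J : Set ℝ) {F : ℝ × X → ℂ}
    (hF : SpaceTimeIntegrable ν F) :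
    inner ℂ a (timeSynth ν V J F) = ∫ s in J, inner ℂ a (synth ν V s fun x => F (s, x)) := by
  have hi : Integrable fun s => synth ν V s fun x => F (s, x) :=
    (hV.integrable_smul_spaceTime hF).integral_prod_left
  rw [hV.timeSynth_eq hF, ← integral_inner hi.integrableOn]

end DispersiveFamily

section Duhamel

variable {d : ℕ} {ε : ℝ}

/-- The regularized propagator `(2π)^d e^{itΔ - ε|∇|²}` acting on `f`. -/
def gaussPropagator (ε t : ℝ) (f : Ed d → ℂ) (x : Ed d) : ℂ :=
  ∫ ξ, cexp (-gaussRate ε t * ‖ξ‖ ^ 2 + I * (⟪x, ξ⟫ : ℝ)) * FT d f ξ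

theorem norm_cexp_gaussRate (ε t : ℝ) (x ξ : Ed d) :
    ‖cexp (-gaussRate ε t * ‖ξ‖ ^ 2 + I * (⟪x, ξ⟫ : ℝ))‖ = Real.exp (-ε * ‖ξ‖ ^ 2) := by
  rw [Complex.norm_exp]
  congr 1
  simp [← ofReal_pow, re_gaussRate]

theorem inner_gaussFamily_synth (hε : 0 < ε) (z : ℝ × Ed d) (s : ℝ) {f : Ed d → ℂ}
    (hf : Integrable f) :
    inner ℂ (gaussFamily hε z) (synth volume (gaussFamily hε) s f) =
      gaussPropagator ε (z.1 - s) f z.2 := by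
  have hV := dispersiveFamily_gaussFamily (d := d) hε
  rw [hV.inner_synth _ _ hf]
  simp_rw [inner_gaussFamily_eq_integral, ← integral_const_mul]
  rw [integral_integral_swap]
  · rw [gaussPropagator]
    refine integral_congr_ae (ae_of_all _ fun ξ => ?_)
    simp only [FT]
    rw [← integral_const_mul]
    refine integral_congr_ae (ae_of_all _ fun y => ?_)
    simp only
    rw [← mul_assoc, ← Complex.exp_add, mul_comm, inner_sub_left]
    congr 2
    push_cast
    ring
  · have hg : Integrable fun ξ : Ed d => Real.exp (-ε * ‖ξ‖ ^ 2) := by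
      have := (GaussianFourier.integrable_cexp_neg_mul_sq_norm_add (V := Ed d) (b := ε)
        (by simpa) 0 0).norm
      refine this.congr (ae_of_all _ fun ξ => ?_)
      simp [Complex.norm_exp, ← ofReal_pow]
    refine (hf.norm.mul_prod hg).mono' (hf.aestronglyMeasurable.comp_fst.mul
      (Continuous.aestronglyMeasurable ?_)) (ae_of_all _ fun p => ?_)
    · fun_prop
    · simp only [Function.uncurry, norm_mul, norm_cexp_gaussRate]
      exact le_rfl

theorem gaussPropagator_zero (t : ℝ) (f : Ed d → ℂ) (x : Ed d) :
    gaussPropagator 0 t f x = ((2 * Real.pi) ^ d : ℝ) * schrod d t f x := by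
  have : (((2 * Real.pi) ^ d : ℝ) : ℂ) ≠ 0 := by
    have := Real.pi_pos
    exact_mod_cast (by positivity : (2 * Real.pi) ^ d ≠ 0)
  rw [schrod, FTinv, mul_inv_cancel_left₀ this, gaussPropagator]
  refine integral_congr_ae (ae_of_all _ fun ξ => ?_)
  simp only
  rw [← mul_assoc, ← Complex.exp_add, gaussRate]
  congr 2
  push_cast
  ring

variable (F : SchwartzMap (ℝ × Ed d) ℂ)

theorem stronglyMeasurable_gaussPropagator_slice (ε t : ℝ) (x : Ed d) :
    StronglyMeasurable fun s => gaussPropagator ε (t - s) (fun y => F (s, y)) x := by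
  unfold gaussPropagator
  refine StronglyMeasurable.integral_prod_right' (f := fun p : ℝ × Ed d =>
    cexp (-gaussRate ε (t - p.1) * ‖p.2‖ ^ 2 + I * (⟪x, p.2⟫ : ℝ)) *
      FT d (fun y => F (p.1, y)) p.2) (.mul (Continuous.stronglyMeasurable ?_)
      (stronglyMeasurable_FT_slice F))
  unfold gaussRate
  fun_prop

theorem tendsto_integral_gaussPropagator (t : ℝ) (x : Ed d) {e : ℕ → ℝ} (he : ∀ n, 0 < e n)
    (hlim : Tendsto e atTop (nhds 0)) :
    Tendsto (fun n => ∫ s in (0:ℝ)..t, gaussPropagator (e n) (t - s) (fun y => F (s, y)) x) atTop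
      (nhds (∫ s in (0:ℝ)..t, gaussPropagator 0 (t - s) (fun y => F (s, y)) x)) := by
  obtain ⟨B, hB⟩ := exists_norm_FT_slice_le F
  have hJ := (integrable_one_add_norm_pow d).const_mul B
  have hle : ∀ n s (ξ : Ed d), ‖cexp (-gaussRate (e n) (t - s) * ‖ξ‖ ^ 2 + I * (⟪x, ξ⟫ : ℝ)) *
      FT d (fun y => F (s, y)) ξ‖ ≤ B * ((1 + ‖ξ‖) ^ (d + 1))⁻¹ := by
    intro n s ξ
    rw [norm_mul, norm_cexp_gaussRate]
    refine (mul_le_of_le_one_left (norm_nonneg _) ?_).trans (hB s ξ)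
    rw [Real.exp_le_one_iff]
    have := he n
    have : 0 ≤ e n * ‖ξ‖ ^ 2 := by positivity
    linarith
  have hm : ∀ (ε s : ℝ), AEStronglyMeasurable (fun ξ : Ed d =>
      cexp (-gaussRate ε (t - s) * ‖ξ‖ ^ 2 + I * (⟪x, ξ⟫ : ℝ)) *
        FT d (fun y => F (s, y)) ξ) volume := by
    intro ε s
    refine (Continuous.aestronglyMeasurable ?_).mul
      ((stronglyMeasurable_FT_slice F).comp_measurable
        (measurable_prodMk_left (x := s))).aestronglyMeasurable
    fun_prop
  refine intervalIntegral.tendsto_integral_filter_of_dominated_convergence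
    (fun _ => ∫ ξ : Ed d, B * ((1 + ‖ξ‖) ^ (d + 1))⁻¹) (Eventually.of_forall fun n =>
      (stronglyMeasurable_gaussPropagator_slice F _ t x).aestronglyMeasurable)
    (Eventually.of_forall fun n => ae_of_all _ fun s _ => ?_) (by simp)
    (ae_of_all _ fun s _ => ?_)
  · exact norm_integral_le_of_norm_le hJ (ae_of_all _ (hle n s))
  · refine tendsto_integral_of_dominated_convergence _ (fun n => hm _ s) hJ
      (fun n => ae_of_all _ (hle n s)) (ae_of_all _ fun ξ => ?_)
    have hc : Continuous fun ε : ℝ => cexp (-gaussRate ε (t - s) * ‖ξ‖ ^ 2 + I * (⟪x, ξ⟫ : ℝ)) *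
        FT d (fun y => F (s, y)) ξ := by
      unfold gaussRate
      fun_prop
    exact (hc.tendsto 0).comp hlim

/-- The truncation of `F` to times in `I`. -/
def timeCutoff (I : Set ℝ) (F : ℝ × Ed d → ℂ) : ℝ × Ed d → ℂ := (Prod.fst ⁻¹' I).indicator F

theorem retarded_gaussFamily (hε : 0 < ε) {I : Set ℝ} (hI : I.OrdConnected)
    (hI0 : I ⊆ Set.Ici 0) (h0 : (0 : ℝ) ∈ I) {t : ℝ} (ht : t ∈ I) (x : Ed d) :
    retarded volume (gaussFamily hε) {p | p.1 < p.2} (timeCutoff I F) (t, x) =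
      ∫ s in (0:ℝ)..t, gaussPropagator ε (t - s) (fun y => F (s, y)) x := by
  have hV := dispersiveFamily_gaussFamily (d := d) hε
  have hF : SpaceTimeIntegrable volume (timeCutoff I F) :=
    (spaceTimeIntegrable_schwartz F).indicator (measurable_fst hI.measurableSet)
  have hJ : timeSlice {p : ℝ × ℝ | p.1 < p.2} t = Set.Iio t := rfl
  rw [retarded, hV.inner_timeSynth _ _ hF, hJ]
  simp_rw [inner_gaussFamily_synth hε _ _ (hF.slice _)]
  have e : ∀ s, gaussPropagator ε (t - s) (fun y => timeCutoff I F (s, y)) x =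
      I.indicator (fun s => gaussPropagator ε (t - s) (fun y => F (s, y)) x) s := by
    intro s
    by_cases hs : s ∈ I <;> simp [timeCutoff, hs, gaussPropagator, Set.indicator, FT]
  simp_rw [e]
  rw [setIntegral_indicator hI.measurableSet]
  have e2 : Set.Iio t ∩ I = Set.Ico 0 t := by
    ext s
    refine ⟨fun h => ⟨hI0 h.2, h.1⟩, fun h => ⟨h.2, hI.out h0 ht ⟨h.1, h.2.le⟩⟩⟩
  rw [e2, intervalIntegral.integral_of_le (hI0 ht), integral_Ico_eq_integral_Ioc]

end Duhamel

section Exponents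

variable {d : ℕ} {q r : ℝ≥0∞}

theorem Admissible.exists_time (hd : 1 ≤ d) (h : Admissible d q r) :
    ∃ θ : ℝ, AdmissibleTime (d / 2) θ ∧ q = (ENNReal.ofReal θ)⁻¹ ∧
      r = outputExponent (d / 2) θ := by
  obtain ⟨hq, hr, hs, hne⟩ := h
  have hd0 : (1 : ℝ) ≤ d := by exact_mod_cast hd
  have hqi : q⁻¹ ≤ 2⁻¹ := ENNReal.inv_le_inv.2 hq
  have hri : r⁻¹ ≤ 2⁻¹ := ENNReal.inv_le_inv.2 hr
  have h2 : (2⁻¹ : ℝ≥0∞) ≠ ∞ := by simp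
  have hq' := ne_top_of_le_ne_top h2 hqi
  have hr' := ne_top_of_le_ne_top h2 hri
  set a := q⁻¹.toReal with ha
  set b := r⁻¹.toReal with hb
  have ha0 : 0 ≤ a := ENNReal.toReal_nonneg
  have hb0 : 0 ≤ b := ENNReal.toReal_nonneg
  have ha2 : a ≤ 1 / 2 := by
    have := ENNReal.toReal_mono h2 hqi
    simpa [ha] using this
  have hqa : q = (ENNReal.ofReal a)⁻¹ := by rw [ha, ENNReal.ofReal_toReal hq', inv_inv]
  have hrb : r = (ENNReal.ofReal b)⁻¹ := by rw [hb, ENNReal.ofReal_toReal hr', inv_inv]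
  have hab : 2 * a + d * b = d / 2 := by
    have := congrArg ENNReal.toReal hs
    rw [div_eq_mul_inv, div_eq_mul_inv, ENNReal.toReal_add (ENNReal.mul_ne_top (by simp) hq')
      (ENNReal.mul_ne_top (by simp) hr')] at this
    simpa [ha, hb] using this
  have hb' : b = 1 / 2 - a / (d / 2) := by
    field_simp
    linarith
  refine ⟨a, ⟨ha0, ha2, by nlinarith, fun h => ?_⟩, hqa, by rw [outputExponent, ← hb', hrb]⟩
  rw [h] at hab
  have h2d : 2 ≤ d := by
    have : (2 : ℝ) ≤ d := by nlinarith
    exact_mod_cast this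
  rcases h2d.eq_or_lt with h2d | h2d
  · refine (hne ⟨?_, ?_, h2d.symm⟩).elim
    · rw [hqa, h, one_div, ENNReal.ofReal_inv_of_pos two_pos, inv_inv]
      simp
    · have : b = 0 := by
        rw [← h2d] at hab
        norm_num at hab
        exact hab
      rw [hrb, this]
      simp
  · have : (2 : ℝ) < d := by exact_mod_cast h2d
    linarith

theorem conjugate_time {θ : ℝ} (h1 : θ < 1) (h0 : 0 ≤ θ) {p : ℝ≥0∞}
    (h : 1 / (ENNReal.ofReal θ)⁻¹ + 1 / p = 1) : p = ENNReal.ofReal (1 / (1 - θ)) := by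
  rw [one_div, inv_inv, one_div] at h
  have e : p⁻¹ = ENNReal.ofReal (1 - θ) := by
    rw [ENNReal.ofReal_sub _ h0, ENNReal.ofReal_one]
    exact ENNReal.eq_sub_of_add_eq' (by simp) (by rwa [add_comm])
  rw [← inv_inv p, e, one_div, ENNReal.ofReal_inv_of_pos (by linarith)]

theorem conjugate_outputExponent {σ θ : ℝ} (hσ : 0 < σ) (h0 : 0 ≤ θ) (h1 : θ ≤ σ / 2) {p : ℝ≥0∞}
    (h : 1 / outputExponent σ θ + 1 / p = 1) : p = ENNReal.ofReal (inputExponent σ θ) := by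
  have h2 : θ / σ ≤ 1 / 2 := by rw [div_le_iff₀ hσ]; linarith
  have h3 : 0 ≤ θ / σ := by positivity
  have := conjugate_time (θ := 1 / 2 - θ / σ) (by linarith) (by linarith) h
  rw [this, inputExponent]
  congr 1
  rw [one_div]
  congr 1
  ring

end Exponents

section MixedNorm

variable {d : ℕ} {θ : ℝ} {I : Set ℝ}

theorem mixedNorm_eq_inputNorm (σ : ℝ) (hI : MeasurableSet I) (h1 : θ < 1) (F : ℝ × Ed d → ℂ) :
    mixedNorm (ENNReal.ofReal (1 / (1 - θ))) I (fun s => eLpNorm (fun y => F (s, y))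
      (ENNReal.ofReal (inputExponent σ θ)) volume) = inputNorm σ θ volume (timeCutoff I F) := by
  have h2 : 0 < 1 / (1 - θ) := by
    have : 0 < 1 - θ := by linarith
    positivity
  rw [mixedNorm, if_neg ENNReal.ofReal_ne_top, ENNReal.toReal_ofReal h2.le, one_div_one_div,
    inputNorm, ← lintegral_indicator hI]
  congr 1
  refine lintegral_congr fun t => ?_
  by_cases ht : t ∈ I
  · simp [timeCutoff, ht, Set.indicator]
  · have : (fun x : Ed d => timeCutoff I F (t, x)) = 0 := by
      ext x
      simp [timeCutoff, ht]
    rw [this, eLpNorm_zero, ENNReal.zero_rpow_of_pos h2, Set.indicator_of_notMem ht]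

theorem mixedNorm_le_of_tendsto (σ : ℝ) (hI : MeasurableSet I) (h0 : 0 ≤ θ) {A : ℝ≥0∞}
    {w : ℕ → ℝ × Ed d → ℂ} {u : ℝ × Ed d → ℂ} (hw : ∀ n, Measurable (w n))
    (hlim : ∀ t ∈ I, ∀ x, Tendsto (fun n => w n (t, x)) atTop (nhds (u (t, x))))
    (hA : ∀ n, outputNorm σ θ volume (w n) ≤ A) :
    mixedNorm (ENNReal.ofReal θ)⁻¹ I
      (fun t => eLpNorm (fun x => u (t, x)) (outputExponent σ θ) volume) ≤ A := by
  rcases h0.eq_or_lt with rfl | h0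
  · rw [mixedNorm, if_pos (by simp)]
    refine essSup_le_of_ae_le _ ?_
    filter_upwards [ae_restrict_mem hI] with t ht
    refine Lp.eLpNorm_le_of_ae_tendsto (u := atTop) (f := fun n x => w n (t, x))
      (Eventually.of_forall fun n => ?_) (fun n => ((hw n).comp
        measurable_prodMk_left).aestronglyMeasurable) (ae_of_all _ (hlim t ht))
    refine le_trans ?_ (hA n)
    rw [outputNorm, if_pos rfl]
    exact le_iSup (fun t => eLpNorm (fun x => w n (t, x)) (outputExponent σ 0) volume) t
  · have e : (ENNReal.ofReal θ)⁻¹.toReal = 1 / θ := by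
      rw [ENNReal.toReal_inv, ENNReal.toReal_ofReal h0.le, one_div]
    rw [mixedNorm, if_neg (by simpa using h0), e, one_div_one_div]
    refine lintegral_eLpNorm_rpow_le_of_tendsto outputExponent_ne_zero h0 hw
      ((ae_restrict_mem hI).mono hlim) fun n => le_trans ?_ (hA n)
    rw [outputNorm, if_neg h0.ne']
    gcongr
    exact Measure.restrict_le_self

theorem mixedNorm_mono (q : ℝ≥0∞) (I : Set ℝ) {f g : ℝ → ℝ≥0∞} (h : ∀ t, f t ≤ g t) :
    mixedNorm q I f ≤ mixedNorm q I g := by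
  unfold mixedNorm
  split_ifs
  · exact essSup_mono_ae (ae_of_all _ h)
  · gcongr
    exact h _

end MixedNorm

/-- Inhomogeneous Strichartz estimate for the Schrödinger equation.
For `d ≥ 1` and admissible pairs `(q,r)`, `(q̃,r̃)` there is `C = C(d,q,r,q̃,r̃) > 0` such that,
for every interval `I ⊆ [0,∞)` containing `0` and every Schwartz `F` on `ℝ × ℝ^d`,
`‖∫₀ᵗ e^{i(t-s)Δ} F(s,·) ds‖_{L^q_I L^r} ≤ C ‖F‖_{L^{q̃'}_I L^{r̃'}}`. -/
theorem inhomogeneous_strichartz_schrodinger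
    (d : ℕ) (hd : 1 ≤ d) (q r qt rt qt' rt' : ℝ≥0∞)
    (hadm : Admissible d q r) (hadmt : Admissible d qt rt)
    (hqt' : 1 / qt + 1 / qt' = 1) (hrt' : 1 / rt + 1 / rt' = 1) :
    ∃ C : ℝ, 0 < C ∧
      ∀ I : Set ℝ, I.OrdConnected → I ⊆ Set.Ici (0 : ℝ) → (0 : ℝ) ∈ I →
        ∀ F : SchwartzMap (ℝ × Ed d) ℂ,
          mixedNorm q I (fun t => eLpNorm
              (fun x => ∫ s in (0:ℝ)..t, schrod d (t - s) (fun y => F (s, y)) x) r volume) ≤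
            ENNReal.ofReal C *
              mixedNorm qt' I (fun s => eLpNorm (fun y => F (s, y)) rt' volume) := by
  have hσ : (0 : ℝ) < d / 2 := by
    have : (1 : ℝ) ≤ d := by exact_mod_cast hd
    linarith
  obtain ⟨θ, hθ, rfl, rfl⟩ := hadm.exists_time hd
  obtain ⟨θ', hθ', rfl, rfl⟩ := hadmt.exists_time hd
  have hθ'1 : θ' < 1 := hθ'.le_half.trans_lt (by norm_num)
  obtain rfl := conjugate_time hθ'1 hθ'.nonneg hqt'
  obtain rfl := conjugate_outputExponent hσ hθ'.nonneg hθ'.le_rate hrt'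
  obtain ⟨K, hK, hmain⟩ := exists_outputNorm_le (H := Lp ℂ 2 (volume : Measure (Ed d))) hσ
    (C := ENNReal.ofReal ((2 * Real.pi) ^ d)) ENNReal.ofReal_ne_top
    (volume : Measure (Ed d)) hθ hθ'
  refine ⟨K.toReal + 1, by positivity, fun I hI hI0 h0 F => ?_⟩
  have hKC : K ≤ ENNReal.ofReal (K.toReal + 1) := by
    rw [ENNReal.le_ofReal_iff_toReal_le hK (by positivity)]
    linarith
  rw [mixedNorm_eq_inputNorm _ hI.measurableSet hθ'1]
  by_cases hN : inputNorm (d / 2) θ' volume (timeCutoff I F) = ∞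
  · rw [hN, ENNReal.mul_top (by simp; positivity)]
    exact le_top
  have hF : SpaceTimeIntegrable volume (timeCutoff I F) :=
    (spaceTimeIntegrable_schwartz F).indicator (measurable_fst hI.measurableSet)
  have hR : MeasurableSet {p : ℝ × ℝ | p.1 < p.2} := measurableSet_lt measurable_fst measurable_snd
  have he : ∀ n : ℕ, (0 : ℝ) < 1 / (n + 1 : ℝ) := fun n => by positivity
  refine le_trans ?_ (mul_le_mul_left hKC _)
  refine (mixedNorm_mono _ _ fun t => ?_).trans (mixedNorm_le_of_tendsto (d / 2 : ℝ)
    hI.measurableSet hθ.nonneg (w := fun n => retarded volume (gaussFamily (he n))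
      {p | p.1 < p.2} (timeCutoff I F))
    (u := fun z => ∫ s in (0:ℝ)..z.1, gaussPropagator 0 (z.1 - s) (fun y => F (s, y)) z.2)
    (fun n => ((dispersiveFamily_gaussFamily (he n)).stronglyMeasurable_retarded hF hR).measurable)
    (fun t ht x => ?_)
    fun n => hmain _ (dispersiveFamily_gaussFamily (he n)) _ hF hN _ hR)
  · refine eLpNorm_mono fun x => ?_
    simp_rw [gaussPropagator_zero]
    rw [intervalIntegral.integral_const_mul, norm_mul, Complex.norm_real]
    refine le_mul_of_one_le_left (norm_nonneg _) ((one_le_pow₀ ?_).trans (le_abs_self _))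
    linarith [Real.pi_gt_three]
  · simp_rw [retarded_gaussFamily F _ hI hI0 h0 ht]
    exact tendsto_integral_gaussPropagator F t x he tendsto_one_div_add_atTop_nhds_zero_nat
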